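/- arXiv:1012.2428 — 5 statements merged into one kernel-verified Lean document; each statement's English description precedes it below -/
import Mathlib

section
/- (Lemma 4, first inequality) Let N ≥ 2 be an integer, let y_1,…,y_N and r_1,…,r_N be real numbers with 0 ≤ |r_1| ≤ |r_2| ≤ … ≤ |r_N|, let r_{N+1} be a real number with |r_N| ≤ r_{N+1}, and for each integer j let x_j be the N-dimensional vector whose i-th entry is |y_i + j r_i|. Then for all integers k_1, k_2, k_3 with 1 < k_1 < k_2 < k_3 < N+2: r_{N+1} + max[x_2 … x̂_{k_2} … x_{N+2}] + max[x_1 … x̂_{k_1} … x̂_{k_3} … x_{N+2}] ≥ max[x_1 … x̂_{k_2} … x_{N+1}] + max[x_2 … x̂_{k_1} … x̂_{k_3} … x_{N+3}]. -/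
/-- The ultradiscrete permanent of an `N × N` real matrix:
the maximum over all permutations `π` of `∑ i, A i (π i)`. -/
noncomputable def uperm {N : ℕ} (A : Matrix (Fin N) (Fin N) ℝ) : ℝ :=
  Finset.univ.sup' ⟨1, Finset.mem_univ 1⟩
    (fun π : Equiv.Perm (Fin N) => ∑ i, A i (π i))

/-- Ultradiscrete permanent of the matrix whose `j`-th column is the vector `x (c j)`. -/
noncomputable def upX {N : ℕ} (x : ℤ → Fin N → ℝ) (c : Fin N → ℤ) : ℝ :=
  uperm (Matrix.of fun i j => x (c j) i)

/-- The column vector `x_j` with `i`-th entry `|y_i + j r_i|`. -/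
noncomputable def xcol {N : ℕ} (y r : Fin N → ℝ) (j : ℤ) : Fin N → ℝ :=
  fun i => |y i + (j : ℝ) * r i|

/-- Enumeration (in increasing order) of the column index set `{a, a+1, …, a+N} \ {k}`. -/
def omitOne (N : ℕ) (a k : ℤ) : Fin N → ℤ :=
  fun j => if (j.1 : ℤ) + a < k then (j.1 : ℤ) + a else (j.1 : ℤ) + a + 1

/-- Enumeration (in increasing order) of the column index set
`{a, a+1, …, a+N+1} \ {k₁, k₂}` (for `k₁ < k₂`). -/
def omitTwo (N : ℕ) (a k₁ k₂ : ℤ) : Fin N → ℤ :=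
  fun j =>
    if (j.1 : ℤ) + a < k₁ then (j.1 : ℤ) + a
    else if (j.1 : ℤ) + a + 1 < k₂ then (j.1 : ℤ) + a + 1
    else (j.1 : ℤ) + a + 2

/-- The greedy value of assigning the rows `|y i + α j * ρ i|`, `i < m`, to the column slots
`a, …, a + m - 1`: the last row takes either the top slot, with sign `+`, or the bottom slot,
with sign `-`. -/
noncomputable def windowMax (y ρ : ℕ → ℝ) (α : ℕ → ℤ) : ℕ → ℕ → ℝ
  | 0, _ => 0
  | m + 1, a => max (y m + α (a + m) * ρ m + windowMax y ρ α m a)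
      (-(y m + α a * ρ m) + windowMax y ρ α m (a + 1))

/-- Some injective assignment of the rows to the slots attains at least the greedy value. -/
theorem exists_le_sum_of_windowMax (y ρ : ℕ → ℝ) (α : ℕ → ℤ) (m a : ℕ) :
    ∃ f : ℕ → ℕ, Set.InjOn f (Finset.range m) ∧ (∀ i < m, f i ∈ Finset.Ico a (a + m)) ∧
      windowMax y ρ α m a ≤ ∑ i ∈ Finset.range m, |y i + α (f i) * ρ i| := by
  induction m generalizing a with
  | zero => exact ⟨id, by simp, by simp, by simp [windowMax]⟩
  | succ m ih =>
    have extend : ∀ b k : ℕ, (∀ j ∈ Finset.Ico b (b + m), j ∈ Finset.Ico a (a + (m + 1)) ∧ j ≠ k) →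
        k ∈ Finset.Ico a (a + (m + 1)) → ∃ f : ℕ → ℕ, Set.InjOn f (Finset.range (m + 1)) ∧
          (∀ i < m + 1, f i ∈ Finset.Ico a (a + (m + 1))) ∧
          |y m + α k * ρ m| + windowMax y ρ α m b ≤
            ∑ i ∈ Finset.range (m + 1), |y i + α (f i) * ρ i| := by
      intro b k hb hk
      obtain ⟨f, hinj, hmaps, hle⟩ := ih b
      have hf : ∀ i < m, Function.update f m k i = f i := fun i hi =>
        Function.update_of_ne hi.ne _ _
      refine ⟨Function.update f m k, ?_, ?_, ?_⟩
      · intro i hi j hj hij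
        simp only [Finset.coe_range, Set.mem_Iio] at hi hj
        rcases Nat.lt_succ_iff_lt_or_eq.1 hi with hi | rfl <;>
          rcases Nat.lt_succ_iff_lt_or_eq.1 hj with hj | rfl
        · rw [hf i hi, hf j hj] at hij
          exact hinj (by simpa using hi) (by simpa using hj) hij
        · rw [hf i hi, Function.update_self] at hij
          exact absurd hij (hb _ (hmaps i hi)).2
        · rw [hf j hj, Function.update_self] at hij
          exact absurd hij.symm (hb _ (hmaps j hj)).2
        · rfl
      · intro i hi
        rcases Nat.lt_succ_iff_lt_or_eq.1 hi with hi | rfl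
        · rw [hf i hi]
          exact (hb _ (hmaps i hi)).1
        · rwa [Function.update_self]
      · rw [Finset.sum_range_succ, Function.update_self, add_comm]
        gcongr
        refine hle.trans (Finset.sum_congr rfl fun i hi => ?_).le
        rw [hf i (Finset.mem_range.1 hi)]
    rw [windowMax]
    rcases max_cases (y m + α (a + m) * ρ m + windowMax y ρ α m a)
      (-(y m + α a * ρ m) + windowMax y ρ α m (a + 1)) with ⟨h, -⟩ | ⟨h, -⟩ <;> rw [h]
    · obtain ⟨f, h₁, h₂, h₃⟩ := extend a (a + m)
        (by intro j; simp only [Finset.mem_Ico]; omega) (by simp only [Finset.mem_Ico]; omega)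
      exact ⟨f, h₁, h₂, by linarith [le_abs_self (y m + α (a + m) * ρ m)]⟩
    · obtain ⟨f, h₁, h₂, h₃⟩ := extend (a + 1) a
        (by intro j; simp only [Finset.mem_Ico]; omega) (by simp only [Finset.mem_Ico]; omega)
      exact ⟨f, h₁, h₂, by linarith [neg_le_abs (y m + α a * ρ m)]⟩

/-- Exchange step: the last row can be moved to the column `k` if doing so never decreases
the total weight, when the row occupying `k` takes over the old column of the last row. -/
theorem exists_sum_le_add_of_exchange (w : ℕ → ℕ → ℝ) (m k : ℕ) (M : ℝ) (S : Finset ℕ)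
    (hS : S.card = m + 1) (hk : k ∈ S) (f : ℕ → ℕ) (hinj : Set.InjOn f (Finset.range (m + 1)))
    (hmaps : ∀ i < m + 1, f i ∈ S) (hM : f m = k → w m k ≤ M)
    (hex : ∀ i < m, w m (f m) + w i k ≤ M + w i (f m)) :
    ∃ g : ℕ → ℕ, Set.InjOn g (Finset.range m) ∧ (∀ i < m, g i ∈ S.erase k) ∧
      ∑ i ∈ Finset.range (m + 1), w i (f i) ≤ M + ∑ i ∈ Finset.range m, w i (g i) := by
  have hne : ∀ i < m + 1, ∀ j < m + 1, f i = f j → i = j := fun i hi j hj h =>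
    hinj (by simpa using hi) (by simpa using hj) h
  have himg : (Finset.range (m + 1)).image f = S := by
    apply Finset.eq_of_subset_of_card_le
    · intro j hj
      obtain ⟨i, hi, rfl⟩ := Finset.mem_image.1 hj
      exact hmaps i (Finset.mem_range.1 hi)
    · rw [Finset.card_image_of_injOn hinj, hS, Finset.card_range]
  obtain ⟨i₀, hi₀, hfi₀⟩ := Finset.mem_image.1 (himg ▸ hk)
  rw [Finset.mem_range] at hi₀
  by_cases him : i₀ = m
  · subst him
    refine ⟨f, hinj.mono (by simp), fun i hi => Finset.mem_erase.2 ⟨?_, hmaps i (by omega)⟩, ?_⟩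
    · intro h
      have := hne i (by omega) i₀ hi₀ (h.trans hfi₀.symm)
      omega
    · rw [Finset.sum_range_succ, hfi₀]
      linarith [hM hfi₀]
  · have hlt : i₀ < m := by omega
    have hf : ∀ i, i ≠ i₀ → Function.update f i₀ (f m) i = f i := fun i hi =>
      Function.update_of_ne hi _ _
    refine ⟨Function.update f i₀ (f m), ?_, ?_, ?_⟩
    · intro i hi j hj hij
      simp only [Finset.coe_range, Set.mem_Iio] at hi hj
      by_cases h1 : i = i₀ <;> by_cases h2 : j = i₀
      · rw [h1, h2]
      · rw [h1, hf j h2, Function.update_self] at hij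
        have := hne m (by omega) j (by omega) hij
        omega
      · rw [h2, hf i h1, Function.update_self] at hij
        have := hne i (by omega) m (by omega) hij
        omega
      · rw [hf i h1, hf j h2] at hij
        exact hne i (by omega) j (by omega) hij
    · intro i hi
      rw [Finset.mem_erase]
      by_cases h1 : i = i₀
      · rw [h1, Function.update_self]
        refine ⟨fun h => ?_, hmaps m (by omega)⟩
        exact him (hne i₀ hi₀ m (by omega) (hfi₀.trans h.symm))
      · rw [hf i h1]
        refine ⟨fun h => ?_, hmaps i (by omega)⟩
        exact h1 (hne i (by omega) i₀ hi₀ (h.trans hfi₀.symm))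
    · have hmem : i₀ ∈ Finset.range m := Finset.mem_range.2 hlt
      rw [Finset.sum_range_succ, ← Finset.add_sum_erase _ _ hmem,
        ← Finset.add_sum_erase _ (fun i => w i (Function.update f i₀ (f m) i)) hmem,
        Finset.sum_congr rfl fun i hi =>
          (congrArg (w i) (hf i (Finset.ne_of_mem_erase hi))), Function.update_self, hfi₀]
      linarith [hex i₀ hlt]

/-- With monotone slopes and columns no injective assignment beats the greedy value. -/
theorem sum_le_windowMax (y ρ : ℕ → ℝ) (hρ0 : ∀ i, 0 ≤ ρ i) (hρ : Monotone ρ) (α : ℕ → ℤ)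
    (hα : Monotone α) (m a : ℕ) (f : ℕ → ℕ) (hinj : Set.InjOn f (Finset.range m))
    (hmaps : ∀ i < m, f i ∈ Finset.Ico a (a + m)) :
    ∑ i ∈ Finset.range m, |y i + α (f i) * ρ i| ≤ windowMax y ρ α m a := by
  induction m generalizing a f with
  | zero => simp [windowMax]
  | succ m ih =>
    have hlip : ∀ i < m, ∀ j k : ℕ, j ≤ k →
        |(|y i + α j * ρ i| - |y i + α k * ρ i|)| ≤ (α k - α j) * ρ m := by
      intro i hi j k hjk
      have hcast : (0 : ℝ) ≤ α k - α j := sub_nonneg.2 (by exact_mod_cast hα hjk)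
      refine (abs_abs_sub_abs_le _ _).trans ?_
      have e : y i + α j * ρ i - (y i + α k * ρ i) = -((α k - α j) * ρ i) := by ring
      rw [e, abs_neg, abs_of_nonneg (mul_nonneg hcast (hρ0 i))]
      exact mul_le_mul_of_nonneg_left (hρ hi.le) hcast
    have hm := Finset.mem_Ico.1 (hmaps m (by omega))
    rw [windowMax]
    rcases abs_cases (y m + α (f m) * ρ m) with ⟨hs, -⟩ | ⟨hs, -⟩
    · refine le_max_of_le_left ?_
      obtain ⟨g, h₁, h₂, h₃⟩ := exists_sum_le_add_of_exchange
        (fun i j => |y i + α j * ρ i|) m (a + m) (y m + α (a + m) * ρ m)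
        (Finset.Ico a (a + (m + 1))) (by simp) (by simp) f hinj hmaps
        (by intro h; rw [← h]; exact hs.le)
        (by
          intro i hi
          have := (abs_le.1 (hlip i hi (f m) (a + m) (by omega))).1
          simp only [hs]
          linarith)
      refine h₃.trans (add_le_add_right (ih a g h₁ fun i hi => ?_) _)
      have := h₂ i hi
      simp only [Finset.mem_erase, Finset.mem_Ico] at this ⊢
      omega
    · refine le_max_of_le_right ?_
      obtain ⟨g, h₁, h₂, h₃⟩ := exists_sum_le_add_of_exchange
        (fun i j => |y i + α j * ρ i|) m a (-(y m + α a * ρ m))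
        (Finset.Ico a (a + (m + 1))) (by simp) (by simp) f hinj hmaps
        (by intro h; rw [← h]; exact hs.le)
        (by
          intro i hi
          have := (abs_le.1 (hlip i hi a (f m) (by omega))).2
          simp only [hs]
          linarith)
      refine h₃.trans (add_le_add_right (ih (a + 1) g h₁ fun i hi => ?_) _)
      have := h₂ i hi
      simp only [Finset.mem_erase, Finset.mem_Ico] at this ⊢
      omega

/-- The difference between the initial sums of `α`, `β` of lengths `a`, `b` and those of
`α'`, `β'` when the total length is split as evenly as possible. -/
def slotGap (α β α' β' : ℕ → ℤ) (a b : ℕ) : ℤ :=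
  ∑ j ∈ Finset.range a, α j + ∑ j ∈ Finset.range b, β j -
    ∑ j ∈ Finset.range ((a + b) / 2), α' j - ∑ j ∈ Finset.range ((a + b + 1) / 2), β' j

/-- If all gaps are nonnegative, two greedy values are bounded by those of a balanced
pair of windows, up to a multiple of the next slope. -/
theorem windowMax_add_le (y ρ : ℕ → ℝ) (hρ0 : ∀ i, 0 ≤ ρ i) (hρ : Monotone ρ)
    (α β α' β' : ℕ → ℤ) (hgap : ∀ a b, 0 ≤ slotGap α β α' β' a b) (m a b : ℕ) :
    windowMax y ρ α m a + windowMax y ρ β m b ≤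
      windowMax y ρ α' m ((a + b) / 2) + windowMax y ρ β' m ((a + b + 1) / 2) +
        (slotGap α β α' β' a b + slotGap α β α' β' (a + m) (b + m) : ℤ) * ρ m := by
  induction m generalizing a b with
  | zero =>
    have h : (0 : ℝ) ≤ (slotGap α β α' β' a b + slotGap α β α' β' (a + 0) (b + 0) : ℤ) := by
      exact_mod_cast add_nonneg (hgap _ _) (hgap _ _)
    simpa [windowMax] using mul_nonneg h (hρ0 0)
  | succ m ih =>
    have hc : (0 : ℝ) ≤ (slotGap α β α' β' a b +
        slotGap α β α' β' (a + (m + 1)) (b + (m + 1)) : ℤ) := by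
      exact_mod_cast add_nonneg (hgap _ _) (hgap _ _)
    refine le_trans ?_ (add_le_add_right (mul_le_mul_of_nonneg_left (hρ (Nat.le_succ m)) hc) _)
    have d₁ : (a + (m + 1) + (b + (m + 1))) / 2 = (a + b) / 2 + m + 1 := by omega
    have d₂ : (a + (m + 1) + (b + (m + 1)) + 1) / 2 = (a + b + 1) / 2 + m + 1 := by omega
    have hpp := ih a b
    have hmm := ih (a + 1) (b + 1)
    have hpm := ih a (b + 1)
    have hmp := ih (a + 1) b
    have e₁ : (a + m + (b + m)) / 2 = (a + b) / 2 + m := by omega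
    have e₂ : (a + m + (b + m) + 1) / 2 = (a + b + 1) / 2 + m := by omega
    have e₃ : (a + 1 + (b + 1)) / 2 = (a + b) / 2 + 1 := by omega
    have e₄ : (a + 1 + (b + 1) + 1) / 2 = (a + b + 1) / 2 + 1 := by omega
    have p₁ : a + 1 + m = a + m + 1 := by omega
    have p₂ : b + 1 + m = b + m + 1 := by omega
    have e₅ : (a + m + 1 + (b + m + 1)) / 2 = (a + b) / 2 + m + 1 := by omega
    have e₆ : (a + m + 1 + (b + m + 1) + 1) / 2 = (a + b + 1) / 2 + m + 1 := by omega
    have f₁ : (a + m + (b + m + 1)) / 2 = (a + b + 1) / 2 + m := by omega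
    have f₂ : (a + m + (b + m + 1) + 1) / 2 = (a + b) / 2 + m + 1 := by omega
    have f₃ : (a + m + 1 + (b + m)) / 2 = (a + b + 1) / 2 + m := by omega
    have f₄ : (a + m + 1 + (b + m) + 1) / 2 = (a + b) / 2 + m + 1 := by omega
    have f₅ : (a + (b + 1)) / 2 = (a + b + 1) / 2 := by omega
    have f₆ : (a + (b + 1) + 1) / 2 = (a + b) / 2 + 1 := by omega
    have f₇ : (a + 1 + b) / 2 = (a + b + 1) / 2 := by omega
    have f₈ : (a + 1 + b + 1) / 2 = (a + b) / 2 + 1 := by omega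
    have la : ∀ (γ : ℕ → ℤ) (c : ℕ), y m + γ (c + m) * ρ m + windowMax y ρ γ m c ≤
        windowMax y ρ γ (m + 1) c := fun γ c => le_max_left _ _
    have lb : ∀ (γ : ℕ → ℤ) (c : ℕ), -(y m + γ c * ρ m) + windowMax y ρ γ m (c + 1) ≤
        windowMax y ρ γ (m + 1) c := fun γ c => le_max_right _ _
    have A₁ := la α' ((a + b) / 2)
    have A₂ := lb α' ((a + b) / 2)
    have B₁ := la β' ((a + b + 1) / 2)
    have B₂ := lb β' ((a + b + 1) / 2)
    simp only [slotGap, d₁, d₂, p₁, p₂, e₁, e₂, e₃, e₄, e₅, e₆, f₁, f₂, f₃, f₄, f₅, f₆, f₇,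
      f₈] at hpp hmm hpm hmp ⊢
    have hpar : (a + b + 1) / 2 = (a + b) / 2 ∨ (a + b + 1) / 2 = (a + b) / 2 + 1 := by omega
    generalize (a + b) / 2 = k at *
    generalize (a + b + 1) / 2 = l at *
    have hα : windowMax y ρ α (m + 1) a = max (y m + α (a + m) * ρ m + windowMax y ρ α m a)
      (-(y m + α a * ρ m) + windowMax y ρ α m (a + 1)) := rfl
    have hβ : windowMax y ρ β (m + 1) b = max (y m + β (b + m) * ρ m + windowMax y ρ β m b)
      (-(y m + β b * ρ m) + windowMax y ρ β m (b + 1)) := rfl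
    have q : k + 1 + m = k + m + 1 := by omega
    rw [hα, hβ]
    rcases hpar with rfl | rfl <;>
    · simp only [q, ← Nat.add_assoc, Finset.sum_range_succ, Int.cast_add, Int.cast_sub]
        at hpp hmm hpm hmp A₁ A₂ B₁ B₂ ⊢
      rcases max_cases (y m + α (a + m) * ρ m + windowMax y ρ α m a)
          (-(y m + α a * ρ m) + windowMax y ρ α m (a + 1)) with ⟨h, -⟩ | ⟨h, -⟩ <;>
        rcases max_cases (y m + β (b + m) * ρ m + windowMax y ρ β m b)
          (-(y m + β b * ρ m) + windowMax y ρ β m (b + 1)) with ⟨h', -⟩ | ⟨h', -⟩ <;>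
        rw [h, h'] <;> linarith

/-- The increasing enumeration of the integers `≥ a` other than `k`. -/
def slotOne (a k : ℤ) (j : ℕ) : ℤ :=
  if (j : ℤ) + a < k then (j : ℤ) + a else (j : ℤ) + a + 1

/-- The increasing enumeration of the integers `≥ a` other than `k₁ < k₂`. -/
def slotTwo (a k₁ k₂ : ℤ) (j : ℕ) : ℤ :=
  if (j : ℤ) + a < k₁ then (j : ℤ) + a
  else if (j : ℤ) + a + 1 < k₂ then (j : ℤ) + a + 1
  else (j : ℤ) + a + 2

theorem slotOne_monotone (a k : ℤ) : Monotone (slotOne a k) := by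
  intro i j h
  unfold slotOne
  split_ifs <;> omega

theorem slotTwo_monotone (a k₁ k₂ : ℤ) : Monotone (slotTwo a k₁ k₂) := by
  intro i j h
  unfold slotTwo
  split_ifs <;> omega

theorem two_mul_sum_slotOne (a k : ℤ) (hk : a ≤ k) (n : ℕ) :
    2 * ∑ j ∈ Finset.range n, slotOne a k j =
      (n : ℤ) * n + (2 * a - 1) * n + 2 * max (n + a - k) 0 := by
  induction n with
  | zero => simp; omega
  | succ n ih =>
    rw [Finset.sum_range_succ, mul_add, ih, slotOne]
    push_cast
    split_ifs
    · rw [max_eq_right (by omega), max_eq_right (by omega)]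
      ring
    · rw [max_eq_left (by omega), max_eq_left (by omega)]
      ring

theorem two_mul_sum_slotTwo (a k₁ k₂ : ℤ) (hk : a ≤ k₁) (h₁₂ : k₁ < k₂) (n : ℕ) :
    2 * ∑ j ∈ Finset.range n, slotTwo a k₁ k₂ j =
      (n : ℤ) * n + (2 * a - 1) * n + 2 * max (n + a - k₁) 0 + 2 * max (n + a + 1 - k₂) 0 := by
  induction n with
  | zero => simp; omega
  | succ n ih =>
    rw [Finset.sum_range_succ, mul_add, ih, slotTwo]
    push_cast
    split_ifs
    · rw [max_eq_right (by omega), max_eq_right (by omega), max_eq_right (by omega),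
        max_eq_right (by omega)]
      ring
    · rw [max_eq_left (by omega), max_eq_right (by omega), max_eq_left (by omega),
        max_eq_right (by omega)]
      ring
    · rw [max_eq_left (by omega), max_eq_left (by omega), max_eq_left (by omega),
        max_eq_left (by omega)]
      ring

/-- Moving `x` by `e` and `y`, `z` by `-e` decreases the sum of the positive parts by at most
a quadratic amount, provided `z ≤ x ≤ y`. -/
theorem posPart_exchange_nonneg (e x y z x' y' z' : ℤ) (hx : x' = x + e) (hy : y' = y - e)
    (hz : z' = z - e) (hxy : x ≤ y) (hzx : z ≤ x) :
    0 ≤ e * e + e + (max x' 0 - max x 0) + (max y' 0 - max y 0) + (max z' 0 - max z 0) ∧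
      0 ≤ e * e + (max x' 0 - max x 0) + (max y' 0 - max y 0) + (max z' 0 - max z 0) := by
  have lip : ∀ s t : ℤ, s ≤ t → max s 0 ≤ max t 0 ∧ max t 0 ≤ max s 0 + (t - s) := by
    intro s t
    omega
  have conv : ∀ s s' t t' : ℤ, s' = s + 1 → t' = t + 1 → s ≤ t →
      max s' 0 - max s 0 ≤ max t' 0 - max t 0 := by
    intro s s' t t'
    omega
  have : e ≤ -2 ∨ e = -1 ∨ e = 0 ∨ e = 1 ∨ 2 ≤ e := by omega
  rcases this with h | h | h | h | h
  · have b₁ := lip x' x (by omega)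
    have b₂ := lip y y' (by omega)
    have b₃ := lip z z' (by omega)
    constructor <;> nlinarith
  · have b₁ := conv x' x y y' (by omega) (by omega) (by omega)
    have b₃ := lip z z' (by omega)
    rw [h]
    constructor <;> linarith
  · have b₁ : x' = x := by omega
    have b₂ : y' = y := by omega
    have b₃ : z' = z := by omega
    rw [h, b₁, b₂, b₃]
    constructor <;> linarith
  · have b₁ := conv z' z x x' (by omega) (by omega) (by omega)
    have b₂ := lip y' y (by omega)
    rw [h]
    constructor <;> linarith
  · have b₁ := lip x x' (by omega)
    have b₂ := lip y' y (by omega)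
    have b₃ := lip z' z (by omega)
    constructor <;> nlinarith

theorem slotGap_slot_nonneg (k₁ k₂ k₃ : ℤ) (hk₁ : 1 < k₁) (h₁₂ : k₁ < k₂) (h₂₃ : k₂ < k₃)
    (a b : ℕ) :
    0 ≤ slotGap (slotOne 1 k₂) (slotTwo 2 k₁ k₃) (slotOne 2 k₂) (slotTwo 1 k₁ k₃) a b := by
  have a₁ := two_mul_sum_slotOne 1 k₂ (by omega) a
  have a₂ := two_mul_sum_slotTwo 2 k₁ k₃ (by omega) (by omega) b
  have a₃ := two_mul_sum_slotOne 2 k₂ (by omega) ((a + b) / 2)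
  have a₄ := two_mul_sum_slotTwo 1 k₁ k₃ (by omega) (by omega) ((a + b + 1) / 2)
  have hpar : (a + b + 1) / 2 = (a + b) / 2 ∨ (a + b + 1) / 2 = (a + b) / 2 + 1 := by omega
  have hsum : (a + b) / 2 + (a + b + 1) / 2 = a + b := by omega
  unfold slotGap
  generalize (a + b) / 2 = k at *
  generalize (a + b + 1) / 2 = l at *
  obtain ⟨d, hd⟩ : ∃ d : ℤ, (a : ℤ) = k + d := ⟨a - k, by ring⟩
  have hb : (b : ℤ) = l - d := by omega
  rw [hd] at a₁
  rw [hb] at a₂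
  rcases hpar with rfl | rfl
  · have := (posPart_exchange_nonneg (d - 1) (l + 2 - k₂) (l + 1 - k₁) (l + 1 + 1 - k₃)
      (l + d + 1 - k₂) (l - d + 2 - k₁) (l - d + 2 + 1 - k₃) (by ring) (by ring) (by ring)
      (by omega) (by omega)).1
    linarith
  · push_cast at a₂ a₄
    have := (posPart_exchange_nonneg (d - 1) (k + 2 - k₂) (k + 1 + 1 - k₁) (k + 1 + 1 + 1 - k₃)
      (k + d + 1 - k₂) (k + 1 - d + 2 - k₁) (k + 1 - d + 2 + 1 - k₃) (by ring) (by ring)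
      (by ring) (by omega) (by omega)).2
    linarith

/-- The slopes `|r i|`, continued by the constant `r'`. -/
noncomputable def extSlope {N : ℕ} (r : Fin N → ℝ) (r' : ℝ) (i : ℕ) : ℝ :=
  if h : i < N then |r ⟨i, h⟩| else r'

/-- The offsets `y i`, with the sign changed where the slope is negative, continued by `0`. -/
noncomputable def extOffset {N : ℕ} (y r : Fin N → ℝ) (i : ℕ) : ℝ :=
  if h : i < N then (if r ⟨i, h⟩ < 0 then -y ⟨i, h⟩ else y ⟨i, h⟩) else 0

theorem xcol_eq_abs_ext {N : ℕ} (y r : Fin N → ℝ) (r' : ℝ) (j : ℤ) (i : Fin N) :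
    xcol y r j i = |extOffset y r i + j * extSlope r r' i| := by
  simp only [xcol, extOffset, extSlope, i.2, dif_pos, Fin.eta]
  split_ifs with h
  · rw [abs_of_neg h, ← abs_neg]
    congr 1
    ring
  · rw [abs_of_nonneg (not_lt.1 h)]

theorem upX_le_windowMax (N : ℕ) (y r : Fin N → ℝ) (r' : ℝ) (hρ0 : ∀ i, 0 ≤ extSlope r r' i)
    (hρ : Monotone (extSlope r r')) (c : ℕ → ℤ) (hc : Monotone c) :
    upX (xcol y r) (fun j => c j) ≤ windowMax (extOffset y r) (extSlope r r') c N 0 := by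
  unfold upX uperm
  refine Finset.sup'_le _ _ fun π _ => ?_
  have hf : ∀ i : Fin N, (if h : (i : ℕ) < N then (π ⟨i, h⟩ : ℕ) else 0) = π i := by
    intro i
    simp
  have key := sum_le_windowMax (extOffset y r) (extSlope r r') hρ0 hρ c hc N 0
    (fun i => if h : i < N then (π ⟨i, h⟩ : ℕ) else 0)
    (by
      intro i hi j hj hij
      simp only [Finset.coe_range, Set.mem_Iio] at hi hj
      simpa [hi, hj, Fin.val_inj] using hij)
    (by
      intro i hi
      simp [hi])
  rw [Finset.sum_range] at key
  refine le_trans (Finset.sum_congr rfl fun i _ => ?_).le key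
  rw [hf]
  exact xcol_eq_abs_ext y r r' _ i

theorem windowMax_le_upX (N : ℕ) (y r : Fin N → ℝ) (r' : ℝ) (c : ℕ → ℤ) :
    windowMax (extOffset y r) (extSlope r r') c N 0 ≤ upX (xcol y r) (fun j => c j) := by
  obtain ⟨f, hinj, hmaps, hle⟩ :=
    exists_le_sum_of_windowMax (extOffset y r) (extSlope r r') c N 0
  have hlt : ∀ i : Fin N, f i < N := fun i => by simpa using hmaps i i.2
  have hg : Function.Injective fun i : Fin N => (⟨f i, hlt i⟩ : Fin N) := by
    intro i j hij
    exact Fin.ext (hinj (by simp) (by simp) (Fin.mk.inj hij))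
  rw [Finset.sum_range] at hle
  refine hle.trans (le_trans (Finset.sum_congr rfl fun i _ => ?_).le
    (Finset.le_sup' (fun π : Equiv.Perm (Fin N) => ∑ i, Matrix.of
      (fun i (j : Fin N) => xcol y r (c j) i) i (π i))
      (Finset.mem_univ (Equiv.ofBijective _ (Finite.injective_iff_bijective.1 hg)))))
  exact (xcol_eq_abs_ext y r r' _ i).symm

/-- Lemma 4, first inequality.  The hypothesis `hmono` encodes
`0 ≤ |r_1| ≤ |r_2| ≤ … ≤ |r_N|` and `hr'` encodes `|r_N| ≤ r_{N+1}` (where `r' = r_{N+1}`). -/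
theorem lemma4_first (N : ℕ) (hN : 2 ≤ N) (y r : Fin N → ℝ)
    (hmono : ∀ i j : Fin N, i ≤ j → |r i| ≤ |r j|)
    (r' : ℝ) (hr' : |r ⟨N - 1, by omega⟩| ≤ r')
    (k₁ k₂ k₃ : ℤ) (hk₁ : 1 < k₁) (h₁₂ : k₁ < k₂) (h₂₃ : k₂ < k₃) (hk₃ : k₃ < (N : ℤ) + 2) :
    r' + upX (xcol y r) (omitOne N 2 k₂) + upX (xcol y r) (omitTwo N 1 k₁ k₃) ≥
      upX (xcol y r) (omitOne N 1 k₂) + upX (xcol y r) (omitTwo N 2 k₁ k₃) := by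
  have hρ0 : ∀ i, 0 ≤ extSlope r r' i := by
    intro i
    unfold extSlope
    split_ifs
    exacts [abs_nonneg _, (abs_nonneg _).trans hr']
  have hρ : Monotone (extSlope r r') := by
    intro i j hij
    unfold extSlope
    split_ifs with hi hj hj
    · exact hmono _ _ hij
    · exact (hmono _ _ (Fin.mk_le_mk.2 (by omega))).trans hr'
    · omega
    · exact le_rfl
  have upper := fun c hc => upX_le_windowMax N y r r' hρ0 hρ c hc
  have lower := fun c => windowMax_le_upX N y r r' c
  have hA := upper (slotOne 1 k₂) (slotOne_monotone _ _)
  have hB := upper (slotTwo 2 k₁ k₃) (slotTwo_monotone _ _ _)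
  have hA' := lower (slotOne 2 k₂)
  have hB' := lower (slotTwo 1 k₁ k₃)
  have key := windowMax_add_le (extOffset y r) (extSlope r r') hρ0 hρ (slotOne 1 k₂)
    (slotTwo 2 k₁ k₃) (slotOne 2 k₂) (slotTwo 1 k₁ k₃)
    (slotGap_slot_nonneg k₁ k₂ k₃ hk₁ h₁₂ h₂₃) N 0 0
  have hgap : slotGap (slotOne 1 k₂) (slotTwo 2 k₁ k₃) (slotOne 2 k₂) (slotTwo 1 k₁ k₃)
      (0 + N) (0 + N) = 1 := by
    have e : (0 + N + (0 + N)) / 2 = N := by omega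
    have e' : (0 + N + (0 + N) + 1) / 2 = N := by omega
    have a₁ := two_mul_sum_slotOne 1 k₂ (by omega) N
    have a₂ := two_mul_sum_slotOne 2 k₂ (by omega) N
    have a₃ := two_mul_sum_slotTwo 2 k₁ k₃ (by omega) (by omega) N
    have a₄ := two_mul_sum_slotTwo 1 k₁ k₃ (by omega) (by omega) N
    unfold slotGap
    rw [e, e', zero_add]
    generalize (N : ℤ) * N = q at *
    omega
  have hzero : slotGap (slotOne 1 k₂) (slotTwo 2 k₁ k₃) (slotOne 2 k₂) (slotTwo 1 k₁ k₃)
      0 0 = 0 := by simp [slotGap]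
  have hN' : extSlope r r' N = r' := by simp [extSlope]
  rw [hgap, hzero, hN'] at key
  simp only [Nat.add_zero, Nat.zero_div, Nat.zero_add, Nat.reduceDiv] at key
  push_cast at key
  change upX (xcol y r) (omitOne N 1 k₂) ≤ _ at hA
  change upX (xcol y r) (omitTwo N 2 k₁ k₃) ≤ _ at hB
  change _ ≤ upX (xcol y r) (omitOne N 2 k₂) at hA'
  change _ ≤ upX (xcol y r) (omitTwo N 1 k₁ k₃) at hB'
  linarith
end

section
/- (Lemma 4, second inequality) Let N ≥ 2 be an integer, let y_1,…,y_N and r_1,…,r_N be real numbers with 0 ≤ |r_1| ≤ |r_2| ≤ … ≤ |r_N|, let r_{N+1} be a real number with |r_N| ≤ r_{N+1}, and for each integer j let x_j be the N-dimensional vector whose i-th entry is |y_i + j r_i|. Then for all integers k_1, k_2, k_3 with 1 < k_1 < k_2 < k_3 < N+2: r_{N+1} + max[x_2 … x̂_{k_3} … x_{N+2}] + max[x_1 … x̂_{k_1} … x̂_{k_2} … x_{N+2}] ≥ max[x_1 … x̂_{k_3} … x_{N+1}] + max[x_2 … x̂_{k_1} … x̂_{k_2} … x_{N+3}]. -/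
/-- The sign `±1` encoded by a Boolean. -/
def boolSign (b : Bool) : ℤ := if b then 1 else -1

/-- Column position given to row `s` when the rows `0, 1, 2, …` successively choose among `N`
columns, a row of sign `true` taking the last free column and a row of sign `false` the first
free one. -/
def greedyPos (N : ℕ) (e : ℕ → Bool) (s : ℕ) : ℕ :=
  if e s then N - 1 - Nat.count (fun u => e u = true) s
  else s - Nat.count (fun u => e u = true) s

theorem count_step (e : ℕ → Bool) (s : ℕ) :
    Nat.count (fun u => e u = true) (s + 1) =
      Nat.count (fun u => e u = true) s + (if e s then 1 else 0) := by
  rw [Nat.count_succ]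

theorem greedyPos_lt {N : ℕ} (e : ℕ → Bool) {s : ℕ} (hs : s < N) : greedyPos N e s < N := by
  unfold greedyPos
  split_ifs <;> omega

/-- Both the number of `true` and the number of `false` entries before `s` are monotone in `s`. -/
theorem count_between (e : ℕ → Bool) {s t : ℕ} (h : s ≤ t) :
    Nat.count (fun u => e u = true) s ≤ Nat.count (fun u => e u = true) t ∧
      Nat.count (fun u => e u = true) t + s ≤ Nat.count (fun u => e u = true) s + t := by
  induction t, h using Nat.le_induction with
  | base => omega
  | succ t _ ih =>
    rw [count_step]
    split_ifs <;> omega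

/-- A row of sign `true` lies strictly to the right of every later row, and a row of sign `false`
strictly to the left. -/
theorem greedyPos_lt_iff {N : ℕ} (e : ℕ → Bool) {s t : ℕ} (hst : s < t) (ht : t < N) :
    if e s then greedyPos N e t < greedyPos N e s else greedyPos N e s < greedyPos N e t := by
  have hb := count_between e (Nat.succ_le_of_lt hst)
  rw [Nat.succ_eq_add_one, count_step] at hb
  have hs := Nat.count_le (p := fun u => e u = true) (n := s)
  have ht' := Nat.count_le (p := fun u => e u = true) (n := t)
  unfold greedyPos
  cases he : e s <;> cases hf : e t <;> simp [he] at hb ⊢ <;> omega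

theorem greedyPos_injective {N : ℕ} (e : ℕ → Bool) :
    Function.Injective (fun i : Fin N => (⟨greedyPos N e i, greedyPos_lt e i.2⟩ : Fin N)) := by
  intro i j hij
  simp only [Fin.mk.injEq] at hij
  rcases lt_trichotomy i j with h | h | h
  · have := greedyPos_lt_iff e (Fin.lt_def.1 h) j.2
    split_ifs at this <;> omega
  · exact h
  · have := greedyPos_lt_iff e (Fin.lt_def.1 h) i.2
    split_ifs at this <;> omega

/-- The permutation of `Fin N` with underlying function `greedyPos N e`. -/
noncomputable def greedyPerm (N : ℕ) (e : ℕ → Bool) : Equiv.Perm (Fin N) :=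
  Equiv.ofBijective _ (Finite.injective_iff_bijective.1 (greedyPos_injective e))

theorem greedyPerm_val {N : ℕ} (e : ℕ → Bool) (i : Fin N) :
    (greedyPerm N e i : ℕ) = greedyPos N e i := rfl

theorem boolSign_mul_le_abs (b : Bool) (a : ℝ) : (boolSign b : ℝ) * a ≤ |a| := by
  cases b
  · simpa [boolSign] using neg_le_abs a
  · simpa [boolSign] using le_abs_self a

theorem sum_le_uperm {N : ℕ} (A : Matrix (Fin N) (Fin N) ℝ) (σ : Equiv.Perm (Fin N)) :
    ∑ i, A i (σ i) ≤ uperm A :=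
  Finset.le_sup' (fun π : Equiv.Perm (Fin N) => ∑ i, A i (π i)) (Finset.mem_univ σ)

theorem exists_uperm_eq_sum {N : ℕ} (A : Matrix (Fin N) (Fin N) ℝ) :
    ∃ σ : Equiv.Perm (Fin N), uperm A = ∑ i, A i (σ i) := by
  obtain ⟨σ, -, h⟩ := Finset.exists_mem_eq_sup' (⟨1, Finset.mem_univ 1⟩ : Finset.univ.Nonempty)
    (fun π : Equiv.Perm (Fin N) => ∑ i, A i (π i))
  exact ⟨σ, h⟩

/-- The ultradiscrete permanent is invariant under permuting the rows. -/
theorem uperm_submatrix {N : ℕ} (A : Matrix (Fin N) (Fin N) ℝ) (τ : Equiv.Perm (Fin N)) :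
    uperm (A.submatrix τ id) = uperm A := by
  have key : ∀ (B : Matrix (Fin N) (Fin N) ℝ) (τ : Equiv.Perm (Fin N)),
      uperm (B.submatrix τ id) ≤ uperm B := by
    intro B τ
    obtain ⟨σ, hσ⟩ := exists_uperm_eq_sum (B.submatrix τ id)
    rw [hσ]
    refine le_trans (le_of_eq ?_) (sum_le_uperm B (τ.symm.trans σ))
    rw [← Equiv.sum_comp τ (fun i => B i ((τ.symm.trans σ) i))]
    simp
  refine le_antisymm (key A τ) ?_
  simpa [Matrix.submatrix_submatrix] using key (A.submatrix τ id) τ⁻¹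

/-- The sum obtained from a sign pattern `e` and the corresponding greedy choice of columns. -/
noncomputable def greedySum (N : ℕ) (Y R : ℕ → ℝ) (c : ℕ → ℤ) (e : ℕ → Bool) : ℝ :=
  ∑ s ∈ Finset.range N, (boolSign (e s) : ℝ) * (Y s + (c (greedyPos N e s) : ℝ) * R s)

theorem greedySum_le_upX (N : ℕ) (Y R : ℕ → ℝ) (c : ℕ → ℤ) (e : ℕ → Bool) :
    greedySum N Y R c e ≤
      upX (xcol (fun i : Fin N => Y i) (fun i => R i)) (fun j => c j) := by
  refine le_trans ?_ (sum_le_uperm _ (greedyPerm N e))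
  rw [greedySum, ← Fin.sum_univ_eq_sum_range
    (fun s => (boolSign (e s) : ℝ) * (Y s + (c (greedyPos N e s) : ℝ) * R s))]
  exact Finset.sum_le_sum fun i _ => boolSign_mul_le_abs _ _

/-- Among all assignments of columns, the greedy one is optimal for a given sign pattern. -/
theorem sum_perm_le_greedy {N : ℕ} {R : ℕ → ℝ} (hR0 : ∀ s < N, 0 ≤ R s)
    (hR : ∀ s t, s ≤ t → t < N → R t ≤ R s) {c : ℕ → ℤ} (hc : Monotone c) (e : ℕ → Bool)
    (σ : Equiv.Perm (Fin N)) :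
    ∑ i : Fin N, (boolSign (e i) : ℝ) * R i * (c (σ i) : ℝ) ≤
      ∑ i : Fin N, (boolSign (e i) : ℝ) * R i * (c (greedyPos N e i) : ℝ) := by
  have hmv : Monovary (fun i : Fin N => (boolSign (e i) : ℝ) * R i)
      (fun i : Fin N => (c (greedyPos N e i) : ℝ)) := by
    intro i j hij
    have hpos : greedyPos N e i < greedyPos N e j := by
      by_contra! hle
      exact absurd (Int.cast_lt.1 hij) (not_lt.2 (hc hle))
    have hi := hR0 i i.2
    have hj := hR0 j j.2
    rcases lt_trichotomy (i : ℕ) j with h | h | h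
    · have hg := greedyPos_lt_iff e h j.2
      have hr := hR i j h.le j.2
      cases he : e i <;> cases hf : e j <;> simp [he] at hg <;> simp [boolSign, he, hf] <;>
        linarith
    · rw [h] at hpos
      omega
    · have hg := greedyPos_lt_iff e h i.2
      have hr := hR j i h.le i.2
      cases he : e i <;> cases hf : e j <;> simp [hf] at hg <;> simp [boolSign, he, hf] <;>
        linarith
  have := hmv.sum_mul_comp_perm_le_sum_mul (σ := σ.trans (greedyPerm N e).symm)
  simpa [← greedyPerm_val] using this

theorem exists_upX_le_greedySum {N : ℕ} (Y : ℕ → ℝ) {R : ℕ → ℝ} (hR0 : ∀ s < N, 0 ≤ R s)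
    (hR : ∀ s t, s ≤ t → t < N → R t ≤ R s) {c : ℕ → ℤ} (hc : Monotone c) :
    ∃ e : ℕ → Bool, upX (xcol (fun i : Fin N => Y i) (fun i => R i)) (fun j => c j) ≤
      greedySum N Y R c e := by
  classical
  obtain ⟨σ, hσ⟩ := exists_uperm_eq_sum
    (Matrix.of fun i j : Fin N => xcol (fun i : Fin N => Y i) (fun i => R i) (c j) i)
  let e : ℕ → Bool := fun s =>
    if h : s < N then decide (0 ≤ Y s + (c (σ ⟨s, h⟩) : ℝ) * R s) else true
  refine ⟨e, ?_⟩
  have habs : ∀ i : Fin N, |Y i + (c (σ i) : ℝ) * R i| =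
      (boolSign (e i) : ℝ) * Y i + (boolSign (e i) : ℝ) * R i * (c (σ i) : ℝ) := by
    intro i
    by_cases h : 0 ≤ Y i + (c (σ i) : ℝ) * R i
    · rw [abs_of_nonneg h]
      simp [e, boolSign, h]
      ring
    · rw [abs_of_neg (not_le.1 h)]
      simp [e, boolSign, h]
      ring
  rw [upX, hσ, greedySum, ← Fin.sum_univ_eq_sum_range
    (fun s => (boolSign (e s) : ℝ) * (Y s + (c (greedyPos N e s) : ℝ) * R s))]
  have hopt := sum_perm_le_greedy hR0 hR hc e σ
  calc ∑ i : Fin N, |Y i + (c (σ i) : ℝ) * R i|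
      = ∑ i : Fin N, (boolSign (e i) : ℝ) * Y i +
          ∑ i : Fin N, (boolSign (e i) : ℝ) * R i * (c (σ i) : ℝ) := by
        rw [← Finset.sum_add_distrib]
        exact Finset.sum_congr rfl fun i _ => habs i
    _ ≤ ∑ i : Fin N, (boolSign (e i) : ℝ) * Y i +
          ∑ i : Fin N, (boolSign (e i) : ℝ) * R i * (c (greedyPos N e i) : ℝ) := by gcongr
    _ = _ := by
        rw [← Finset.sum_add_distrib]
        exact Finset.sum_congr rfl fun i _ => by ring

/-- Abel summation bound: if all partial sums of `D` are at least `-1`, the sum of `D` weighted by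
a nonnegative decreasing sequence `R` is at least `-R 0`. -/
theorem neg_le_sum_mul_of_partial_sums {R : ℕ → ℝ} {D : ℕ → ℤ} {N : ℕ} (hN : 0 < N)
    (hR0 : ∀ s < N, 0 ≤ R s) (hR : ∀ s t, s ≤ t → t < N → R t ≤ R s)
    (hD : ∀ n ≤ N, -1 ≤ ∑ s ∈ Finset.range n, D s) :
    -R 0 ≤ ∑ s ∈ Finset.range N, (D s : ℝ) * R s := by
  have key : ∀ n, n < N → R n * ((∑ s ∈ Finset.range (n + 1), D s : ℤ) + 1 : ℝ) - R 0 ≤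
      ∑ s ∈ Finset.range (n + 1), (D s : ℝ) * R s := by
    intro n
    induction n with
    | zero => intro _; simp; linarith
    | succ n ih =>
      intro hn
      have h1 := ih (by omega)
      have h2 := hR n (n + 1) (by omega) hn
      have h3 : (0 : ℝ) ≤ (∑ s ∈ Finset.range (n + 1), D s : ℤ) + 1 := by
        exact_mod_cast (by linarith [hD (n + 1) (by omega)] :
          (0 : ℤ) ≤ (∑ s ∈ Finset.range (n + 1), D s) + 1)
      rw [Finset.sum_range_succ _ (n + 1), Finset.sum_range_succ _ (n + 1)]
      push_cast at h1 h3 ⊢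
      nlinarith [mul_le_mul_of_nonneg_right h2 h3]
  obtain ⟨n, rfl⟩ : ∃ n, N = n + 1 := ⟨N - 1, by omega⟩
  have h1 := key n (by omega)
  have h3 : (0 : ℝ) ≤ (∑ s ∈ Finset.range (n + 1), D s : ℤ) + 1 := by
    exact_mod_cast (by linarith [hD (n + 1) le_rfl] :
      (0 : ℤ) ≤ (∑ s ∈ Finset.range (n + 1), D s) + 1)
  nlinarith [mul_nonneg (hR0 n (by omega)) h3]

/-- Natural-number indexed version of `omitOne`. -/
def skipOne (a k : ℤ) (n : ℕ) : ℤ := if (n : ℤ) + a < k then (n : ℤ) + a else (n : ℤ) + a + 1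

/-- Natural-number indexed version of `omitTwo`. -/
def skipTwo (a k₁ k₂ : ℤ) (n : ℕ) : ℤ :=
  if (n : ℤ) + a < k₁ then (n : ℤ) + a
  else if (n : ℤ) + a + 1 < k₂ then (n : ℤ) + a + 1
  else (n : ℤ) + a + 2

theorem skipOne_monotone (a k : ℤ) : Monotone (skipOne a k) := by
  intro m n h
  unfold skipOne
  split_ifs <;> omega

theorem skipTwo_monotone (a k₁ k₂ : ℤ) : Monotone (skipTwo a k₁ k₂) := by
  intro m n h
  unfold skipTwo
  split_ifs <;> omega

/-- The change of the coefficient of row `s` in a greedy sum when the sign pattern `e` is replaced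
by `e'` and the columns `{1, …, N + 1} \ {k}` by `{2, …, N + 2} \ {k}`. -/
def changeOne (N : ℕ) (k : ℤ) (e e' : ℕ → Bool) (s : ℕ) : ℤ :=
  boolSign (e' s) * skipOne 2 k (greedyPos N e' s) - boolSign (e s) * skipOne 1 k (greedyPos N e s)

/-- The change of the coefficient of row `s` in a greedy sum when the sign pattern `f` is replaced
by `f'` and the columns `{2, …, N + 3} \ {k₁, k₂}` by `{1, …, N + 2} \ {k₁, k₂}`. -/
def changeTwo (N : ℕ) (k₁ k₂ : ℤ) (f f' : ℕ → Bool) (s : ℕ) : ℤ :=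
  boolSign (f' s) * skipTwo 1 k₁ k₂ (greedyPos N f' s) -
    boolSign (f s) * skipTwo 2 k₁ k₂ (greedyPos N f s)

/-- Partial sum of `changeOne` over the first `n` rows, `p` of them of sign `true`, when the signs
are kept. -/
def keptOne (N : ℕ) (k : ℤ) (n p : ℕ) : ℤ :=
  2 * (p : ℤ) - n + (if (N : ℤ) + 2 - k ≤ p then 1 else 0)
    - (if k - 1 ≤ (n : ℤ) - p then 1 else 0)

/-- Partial sum of `changeTwo` over the first `n` rows, `q` of them of sign `true`, when the signs
are kept. -/
def keptTwo (N : ℕ) (k₁ k₂ : ℤ) (n q : ℕ) : ℤ :=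
  (n : ℤ) - 2 * q - (if (N : ℤ) + 3 - k₂ ≤ q then 1 else 0)
    - (if (N : ℤ) + 2 - k₁ ≤ q then 1 else 0) + (if k₁ - 1 ≤ (n : ℤ) - q then 1 else 0)
    + (if k₂ - 2 ≤ (n : ℤ) - q then 1 else 0)

theorem count_congr_of_lt {e e' : ℕ → Bool} {n : ℕ} (h : ∀ s < n, e' s = e s) :
    Nat.count (fun u => e' u = true) n = Nat.count (fun u => e u = true) n := by
  induction n with
  | zero => simp
  | succ n ih =>
    rw [count_step, count_step, ih fun s hs => h s (by omega), h n (by omega)]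

theorem sum_changeOne_of_kept {N : ℕ} {k : ℤ} (hk : 1 < k) (hkN : k < (N : ℤ) + 2)
    {e e' : ℕ → Bool} {n : ℕ} (hn : n ≤ N) (h : ∀ s < n, e' s = e s) :
    ∑ s ∈ Finset.range n, changeOne N k e e' s =
      keptOne N k n (Nat.count (fun u => e u = true) n) := by
  induction n with
  | zero =>
    simp [keptOne]
    split_ifs <;> omega
  | succ n ih =>
    rw [Finset.sum_range_succ, ih (by omega) fun s hs => h s (by omega), count_step]
    have hc := count_congr_of_lt (n := n) fun s hs => h s (by omega)
    have hle := Nat.count_le (p := fun u => e u = true) (n := n)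
    simp only [changeOne, greedyPos, h n (by omega), hc]
    generalize Nat.count (fun u => e u = true) n = p at *
    cases e n <;> simp [keptOne, skipOne, boolSign] <;> split_ifs <;> omega

theorem keptTwo_step_true {N : ℕ} {k₁ k₂ : ℤ} (h₁₂ : k₁ < k₂) {q : ℕ} (hq : q < N) (n : ℕ) :
    keptTwo N k₁ k₂ n q + (skipTwo 1 k₁ k₂ (N - 1 - q) - skipTwo 2 k₁ k₂ (N - 1 - q)) =
      keptTwo N k₁ k₂ (n + 1) (q + 1) := by
  obtain ⟨m, rfl⟩ : ∃ m, N = m + q + 1 := ⟨N - 1 - q, by omega⟩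
  have hm : m + q + 1 - 1 - q = m := by omega
  have hd : ((n + 1 : ℕ) : ℤ) - (q + 1 : ℕ) = n - q := by push_cast; ring
  simp only [keptTwo, hd, hm]
  generalize (if k₁ - 1 ≤ (n : ℤ) - q then (1 : ℤ) else 0) = a
  generalize (if k₂ - 2 ≤ (n : ℤ) - q then (1 : ℤ) else 0) = b
  simp only [skipTwo]
  split_ifs <;> omega

theorem keptTwo_step_false {N : ℕ} {k₁ k₂ : ℤ} (h₁₂ : k₁ < k₂) {n q : ℕ} (hq : q ≤ n) :
    keptTwo N k₁ k₂ n q - (skipTwo 1 k₁ k₂ (n - q) - skipTwo 2 k₁ k₂ (n - q)) =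
      keptTwo N k₁ k₂ (n + 1) q := by
  obtain ⟨m, rfl⟩ : ∃ m, n = m + q := ⟨n - q, by omega⟩
  have hm : m + q - q = m := by omega
  simp only [keptTwo, hm]
  generalize (if (N : ℤ) + 3 - k₂ ≤ q then (1 : ℤ) else 0) = a
  generalize (if (N : ℤ) + 2 - k₁ ≤ q then (1 : ℤ) else 0) = b
  simp only [skipTwo]
  split_ifs <;> omega

theorem sum_changeTwo_of_kept {N : ℕ} {k₁ k₂ : ℤ} (hk₁ : 1 < k₁) (h₁₂ : k₁ < k₂)
    (hkN : k₂ < (N : ℤ) + 2) {f f' : ℕ → Bool} {n : ℕ} (hn : n ≤ N) (h : ∀ s < n, f' s = f s) :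
    ∑ s ∈ Finset.range n, changeTwo N k₁ k₂ f f' s =
      keptTwo N k₁ k₂ n (Nat.count (fun u => f u = true) n) := by
  induction n with
  | zero =>
    simp [keptTwo]
    split_ifs <;> omega
  | succ n ih =>
    rw [Finset.sum_range_succ, ih (by omega) fun s hs => h s (by omega), count_step]
    have hc := count_congr_of_lt (n := n) fun s hs => h s (by omega)
    have hle := Nat.count_le (p := fun u => f u = true) (n := n)
    simp only [changeTwo, greedyPos, h n (by omega), hc]
    generalize Nat.count (fun u => f u = true) n = q at *
    cases f n
    · have hstep := keptTwo_step_false (N := N) h₁₂ hle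
      simp [boolSign]
      linarith
    · have hstep := keptTwo_step_true h₁₂ (by omega : q < N) n
      simp [boolSign]
      linarith

theorem neg_one_le_kept {N : ℕ} {k₁ k₂ k₃ : ℤ} (h₁₂ : k₁ < k₂) (h₂₃ : k₂ < k₃) {n p q : ℕ}
    (hqp : q ≤ p) :
    -1 ≤ keptOne N k₃ n p + keptTwo N k₁ k₂ n q := by
  unfold keptOne keptTwo
  split_ifs <;> omega

theorem count_update_of_lt (e : ℕ → Bool) (b : Bool) {t n : ℕ} (hn : t < n) :
    Nat.count (fun u => Function.update e t b u = true) n + (if e t then 1 else 0) =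
      Nat.count (fun u => e u = true) n + (if b then 1 else 0) := by
  induction n, hn using Nat.le_induction with
  | base =>
    rw [Nat.succ_eq_add_one, count_step, count_step,
      count_congr_of_lt (e := e) fun s hs => Function.update_of_ne hs.ne _ _,
      Function.update_self]
    omega
  | succ n hn ih =>
    rw [count_step, count_step, Function.update_of_ne (by omega)]
    omega

/-- After the row whose sign was switched to `true`, the greedy coefficients do not change. -/
theorem changeOne_update_of_lt {N : ℕ} {k : ℤ} (e : ℕ → Bool) {t s : ℕ}
    (het : e t = false) (hts : t < s) (hs : s < N) :
    changeOne N k e (Function.update e t true) s = 0 := by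
  have hc := count_update_of_lt e true hts
  have hb := count_between e (Nat.succ_le_of_lt hts)
  have hle := Nat.count_le (p := fun u => e u = true) (n := t)
  rw [Nat.succ_eq_add_one, count_step] at hb
  simp only [changeOne, greedyPos, Function.update_of_ne hts.ne']
  simp [het] at hc hb
  rw [hc]
  generalize Nat.count (fun u => e u = true) s = p at *
  cases he : e s <;> simp [skipOne, boolSign] <;> split_ifs <;> omega

/-- After the row whose sign was switched to `false`, the greedy coefficients do not change. -/
theorem changeTwo_update_of_lt {N : ℕ} {k₁ k₂ : ℤ} (f : ℕ → Bool) {t s : ℕ}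
    (hft : f t = true) (hts : t < s) (hs : s < N) :
    changeTwo N k₁ k₂ f (Function.update f t false) s = 0 := by
  have hc := count_update_of_lt f false hts
  have hb := count_between f (Nat.succ_le_of_lt hts)
  have hle := Nat.count_le (p := fun u => f u = true) (n := s)
  rw [Nat.succ_eq_add_one, count_step] at hb
  simp only [changeTwo, greedyPos, Function.update_of_ne hts.ne']
  simp [hft] at hc hb
  rw [← hc] at hb hle ⊢
  generalize Nat.count (fun u => Function.update f t false u = true) s = q at *
  cases he : f s <;> simp [skipTwo, boolSign] <;> split_ifs <;> omega

/-- The row where the signs are switched brings the partial sum to exactly `-1`. -/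
theorem kept_add_change_of_switch {N : ℕ} {k₁ k₂ k₃ : ℤ} (hk₁ : 1 < k₁) (h₁₂ : k₁ < k₂)
    (h₂₃ : k₂ < k₃) {e f : ℕ → Bool} {t : ℕ} (ht : t < N)
    (hct : Nat.count (fun u => f u = true) t = Nat.count (fun u => e u = true) t)
    (het : e t = false) (hft : f t = true) :
    keptOne N k₃ t (Nat.count (fun u => e u = true) t) +
      keptTwo N k₁ k₂ t (Nat.count (fun u => f u = true) t) +
      (changeOne N k₃ e (Function.update e t true) t +
        changeTwo N k₁ k₂ f (Function.update f t false) t) = -1 := by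
  have hce : Nat.count (fun u => Function.update e t true u = true) t =
      Nat.count (fun u => e u = true) t :=
    count_congr_of_lt fun s hs => Function.update_of_ne hs.ne _ _
  have hcf : Nat.count (fun u => Function.update f t false u = true) t =
      Nat.count (fun u => e u = true) t :=
    (count_congr_of_lt fun s hs => Function.update_of_ne hs.ne _ _).trans hct
  have hle := Nat.count_le (p := fun u => e u = true) (n := t)
  simp only [changeOne, changeTwo, greedyPos, Function.update_self, hce, hcf, hct, het, hft]
  generalize Nat.count (fun u => e u = true) t = p at *
  have h₁ : keptOne N k₃ t p + skipOne 2 k₃ (N - 1 - p) + skipOne 1 k₃ (t - p) = N + 3 := by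
    simp only [keptOne, skipOne]
    split_ifs <;> omega
  have h₂ : keptTwo N k₁ k₂ t p - skipTwo 1 k₁ k₂ (t - p) - skipTwo 2 k₁ k₂ (N - 1 - p) =
      -(N + 4 : ℤ) := by
    simp only [keptTwo, skipTwo]
    split_ifs <;> omega
  simp [boolSign]
  linarith

/-- New sign patterns with the same sum of signs, for which all partial sums of the coefficient
changes are at least `-1`. -/
theorem exists_signs {N : ℕ} {k₁ k₂ k₃ : ℤ} (hk₁ : 1 < k₁) (h₁₂ : k₁ < k₂)
    (h₂₃ : k₂ < k₃) (hk₃ : k₃ < (N : ℤ) + 2) (e f : ℕ → Bool) :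
    ∃ e' f' : ℕ → Bool,
      (∀ s, boolSign (e' s) + boolSign (f' s) = boolSign (e s) + boolSign (f s)) ∧
      ∀ n ≤ N, -1 ≤ ∑ s ∈ Finset.range n, (changeOne N k₃ e e' s + changeTwo N k₁ k₂ f f' s) := by
  classical
  have hkept : ∀ e' f' : ℕ → Bool, ∀ n ≤ N, (∀ s < n, e' s = e s) → (∀ s < n, f' s = f s) →
      ∑ s ∈ Finset.range n, (changeOne N k₃ e e' s + changeTwo N k₁ k₂ f f' s) =
        keptOne N k₃ n (Nat.count (fun u => e u = true) n) +
          keptTwo N k₁ k₂ n (Nat.count (fun u => f u = true) n) := fun e' f' n hn he hf => by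
    rw [Finset.sum_add_distrib, sum_changeOne_of_kept (by omega) hk₃ hn he,
      sum_changeTwo_of_kept hk₁ h₁₂ (by omega) hn hf]
  by_cases hall : ∀ n ≤ N,
      Nat.count (fun u => f u = true) n ≤ Nat.count (fun u => e u = true) n
  · refine ⟨e, f, fun _ => rfl, fun n hn => ?_⟩
    rw [hkept e f n hn (fun _ _ => rfl) (fun _ _ => rfl)]
    exact neg_one_le_kept h₁₂ h₂₃ (hall n hn)
  · obtain ⟨t, ht, hct, het, hft, hbefore⟩ : ∃ t < N,
        Nat.count (fun u => f u = true) t = Nat.count (fun u => e u = true) t ∧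
        e t = false ∧ f t = true ∧
        ∀ n ≤ t, Nat.count (fun u => f u = true) n ≤ Nat.count (fun u => e u = true) n := by
      push Not at hall
      have hfind := Nat.find_spec hall
      have hmin := fun m => Nat.find_min (m := m) hall
      generalize Nat.find hall = m at hfind hmin
      obtain _ | t := m
      · simp at hfind
      have hbefore : ∀ n ≤ t,
          Nat.count (fun u => f u = true) n ≤ Nat.count (fun u => e u = true) n := by
        intro n hn
        by_contra! hlt
        exact hmin n (by omega) ⟨by omega, hlt⟩
      have ht := hbefore t le_rfl
      rw [count_step, count_step] at hfind
      refine ⟨t, by omega, ?_, ?_, ?_, hbefore⟩ <;>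
        cases he : e t <;> cases hf : f t <;> simp [he, hf] at hfind ⊢ <;> omega
    refine ⟨Function.update e t true, Function.update f t false, fun s => ?_, fun n hn => ?_⟩
    · rcases eq_or_ne s t with rfl | hs
      · simp [het, hft, boolSign]
      · simp [hs]
    · have hprefix : ∀ m ≤ t, _ := fun m hm =>
        hkept (Function.update e t true) (Function.update f t false) m (by omega)
          (fun s hs => Function.update_of_ne (by omega) _ _)
          (fun s hs => Function.update_of_ne (by omega) _ _)
      rcases le_or_gt n t with hnt | hnt
      · rw [hprefix n hnt]
        exact neg_one_le_kept h₁₂ h₂₃ (hbefore n hnt)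
      · refine ge_of_eq ?_
        induction n, hnt using Nat.le_induction with
        | base =>
          rw [Nat.succ_eq_add_one, Finset.sum_range_succ, hprefix t le_rfl]
          exact kept_add_change_of_switch hk₁ h₁₂ h₂₃ ht hct het hft
        | succ n hnt ih =>
          rw [Finset.sum_range_succ, ih (by omega), changeOne_update_of_lt e het hnt hn,
            changeTwo_update_of_lt f hft hnt hn]
          rfl

/-- The inequality for rows listed in order of decreasing nonnegative slopes `R`. -/
theorem upX_exchange {N : ℕ} (hN : 0 < N) (Y : ℕ → ℝ) {R : ℕ → ℝ} (hR0 : ∀ s < N, 0 ≤ R s)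
    (hR : ∀ s t, s ≤ t → t < N → R t ≤ R s) {k₁ k₂ k₃ : ℤ} (hk₁ : 1 < k₁) (h₁₂ : k₁ < k₂)
    (h₂₃ : k₂ < k₃) (hk₃ : k₃ < (N : ℤ) + 2) :
    upX (xcol (fun i : Fin N => Y i) (fun i => R i)) (omitOne N 1 k₃) +
      upX (xcol (fun i : Fin N => Y i) (fun i => R i)) (omitTwo N 2 k₁ k₂) ≤
    R 0 + upX (xcol (fun i : Fin N => Y i) (fun i => R i)) (omitOne N 2 k₃) +
      upX (xcol (fun i : Fin N => Y i) (fun i => R i)) (omitTwo N 1 k₁ k₂) := by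
  obtain ⟨e, he⟩ := exists_upX_le_greedySum Y hR0 hR (skipOne_monotone 1 k₃)
  obtain ⟨f, hf⟩ := exists_upX_le_greedySum Y hR0 hR (skipTwo_monotone 2 k₁ k₂)
  obtain ⟨e', f', hsign, hpartial⟩ := exists_signs hk₁ h₁₂ h₂₃ hk₃ e f
  have he' := greedySum_le_upX N Y R (skipOne 2 k₃) e'
  have hf' := greedySum_le_upX N Y R (skipTwo 1 k₁ k₂) f'
  have hchange : greedySum N Y R (skipOne 2 k₃) e' + greedySum N Y R (skipTwo 1 k₁ k₂) f' -
      greedySum N Y R (skipOne 1 k₃) e - greedySum N Y R (skipTwo 2 k₁ k₂) f =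
      ∑ s ∈ Finset.range N,
        ((changeOne N k₃ e e' s + changeTwo N k₁ k₂ f f' s : ℤ) : ℝ) * R s := by
    simp only [greedySum, ← Finset.sum_add_distrib, ← Finset.sum_sub_distrib]
    refine Finset.sum_congr rfl fun s _ => ?_
    have hs : (boolSign (e' s) + boolSign (f' s) : ℝ) = boolSign (e s) + boolSign (f s) := by
      exact_mod_cast hsign s
    simp only [changeOne, changeTwo]
    push_cast
    linear_combination Y s * hs
  have hbound := neg_le_sum_mul_of_partial_sums hN hR0 hR hpartial
  rw [← hchange] at hbound
  change upX _ (fun j => skipOne 1 k₃ j) + upX _ (fun j => skipTwo 2 k₁ k₂ j) ≤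
    R 0 + upX _ (fun j => skipOne 2 k₃ j) + upX _ (fun j => skipTwo 1 k₁ k₂ j)
  linarith

/-- Making the slopes nonnegative and listing the rows in reverse order does not change the
ultradiscrete permanent. -/
theorem upX_xcol_rev {N : ℕ} (y r : Fin N → ℝ) (c : Fin N → ℤ) :
    upX (xcol y r) c =
      upX (xcol (fun i => if 0 ≤ r i.rev then y i.rev else -y i.rev) (fun i => |r i.rev|)) c := by
  unfold upX
  rw [← uperm_submatrix _ Fin.revPerm]
  congr 1
  ext i j
  simp only [xcol, Matrix.submatrix_apply, Matrix.of_apply, Fin.revPerm_apply, id]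
  split_ifs with h
  · rw [abs_of_nonneg h]
  · rw [abs_of_neg (not_le.1 h), ← abs_neg]
    congr 1
    ring

/-- Lemma 4, second inequality.  The hypothesis `hmono` encodes
`0 ≤ |r_1| ≤ |r_2| ≤ … ≤ |r_N|` and `hr'` encodes `|r_N| ≤ r_{N+1}` (where `r' = r_{N+1}`). -/
theorem lemma4_second (N : ℕ) (hN : 2 ≤ N) (y r : Fin N → ℝ)
    (hmono : ∀ i j : Fin N, i ≤ j → |r i| ≤ |r j|)
    (r' : ℝ) (hr' : |r ⟨N - 1, by omega⟩| ≤ r')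
    (k₁ k₂ k₃ : ℤ) (hk₁ : 1 < k₁) (h₁₂ : k₁ < k₂) (h₂₃ : k₂ < k₃) (hk₃ : k₃ < (N : ℤ) + 2) :
    r' + upX (xcol y r) (omitOne N 2 k₃) + upX (xcol y r) (omitTwo N 1 k₁ k₂) ≥
      upX (xcol y r) (omitOne N 1 k₃) + upX (xcol y r) (omitTwo N 2 k₁ k₂) := by
  let Y : ℕ → ℝ := fun s => if h : s < N then
    (if 0 ≤ r (Fin.rev ⟨s, h⟩) then y (Fin.rev ⟨s, h⟩) else -y (Fin.rev ⟨s, h⟩)) else 0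
  let R : ℕ → ℝ := fun s => if h : s < N then |r (Fin.rev ⟨s, h⟩)| else 0
  have hR0 : ∀ s < N, 0 ≤ R s := fun s hs => by simp [R, hs]
  have hR : ∀ s t, s ≤ t → t < N → R t ≤ R s := fun s t hst ht => by
    simp only [R, ht, hst.trans_lt ht, dif_pos]
    exact hmono _ _ (Fin.rev_le_rev.2 (Fin.mk_le_mk.2 hst))
  have hzero : R 0 ≤ r' := by
    have h0 : 0 < N := by omega
    simp only [R, h0, dif_pos]
    exact hr'
  have hup : ∀ c : Fin N → ℤ,
      upX (xcol y r) c = upX (xcol (fun i : Fin N => Y i) (fun i => R i)) c := fun c => by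
    rw [upX_xcol_rev]
    simp [Y, R]
  have := upX_exchange (by omega) Y hR0 hR hk₁ h₁₂ h₂₃ hk₃
  simp only [hup]
  linarith
end

section
/- (Ultradiscrete Plücker identity for the uKP tau function) In the uKP setting, for all integers l, m, n and all integers k_1, k_2, k_3 with 0 < k_1 < k_2 < k_3 < N+1: τ_c(k_2, N+1) + τ_c(k_1, k_3) = max( τ_c(k_1, N+1) + τ_c(k_2, k_3), τ_c(k_3, N+1) + τ_c(k_1, k_2) ). -/
/-- uKP setting: `φ_i(l,m,n,σ) = max(η_i(l,m,n,σ), η'_i(l,m,n,σ))`. -/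
noncomputable def phiKP {N : ℕ} (a₁ a₂ a₃ : ℝ) (p c c' : Fin N → ℝ)
    (i : Fin N) (l m n σ : ℤ) : ℝ :=
  max
    (p i * (σ : ℝ) + max 0 (p i - a₁) * (l : ℝ) + max 0 (p i - a₂) * (m : ℝ) +
      max 0 (p i - a₃) * (n : ℝ) + c i)
    (-p i * (σ : ℝ) + max 0 (-p i - a₁) * (l : ℝ) + max 0 (-p i - a₂) * (m : ℝ) +
      max 0 (-p i - a₃) * (n : ℝ) + c' i)

/-- uKP tau function: the ultradiscrete permanent of the `N × N` matrix with
`(i, j)` entry `φ_i(l, m, n, s + j - 1)` (with `j` running over `1, …, N`). -/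
noncomputable def tauKP {N : ℕ} (a₁ a₂ a₃ : ℝ) (p c c' : Fin N → ℝ)
    (s l m n : ℤ) : ℝ :=
  uperm (Matrix.of fun i j : Fin N => phiKP a₁ a₂ a₃ p c c' i l m n (s + (j.1 : ℤ)))

/-- `τ_c(α, β)`: the ultradiscrete permanent of the `N × N` matrix whose columns are
the vectors `φ(l, m, n, s + j)` for `j ∈ {0, 1, …, N+1} ∖ {α, β}` (symmetric in `α, β`). -/
noncomputable def taucKP {N : ℕ} (a₁ a₂ a₃ : ℝ) (p c c' : Fin N → ℝ)
    (s l m n : ℤ) (α β : ℤ) : ℝ :=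
  uperm (Matrix.of fun i j : Fin N =>
    phiKP a₁ a₂ a₃ p c c' i l m n (s + omitTwo N 0 (min α β) (max α β) j))

/-- Two families over the same finite type enumerate the same multiset exactly when they differ by
a permutation of the indices. -/
theorem map_univ_eq_iff_exists_perm {κ γ : Type*} [Fintype κ] (f g : κ → γ) :
    Finset.univ.val.map f = Finset.univ.val.map g ↔ ∃ π : Equiv.Perm κ, f = g ∘ π := by
  classical
  constructor
  · intro h
    have hfib : ∀ b, Nonempty ({a // f a = b} ≃ {a // g a = b}) := by
      intro b
      rw [← Fintype.card_eq, Fintype.card_subtype, Fintype.card_subtype]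
      have hb := congrArg (Multiset.count b) h
      rw [Multiset.count_map, Multiset.count_map] at hb
      simpa only [Finset.card_def, Finset.filter_val, eq_comm] using hb
    let e := fun b => (hfib b).some
    refine ⟨(Equiv.sigmaFiberEquiv f).symm.trans
      ((Equiv.sigmaCongrRight e).trans (Equiv.sigmaFiberEquiv g)), funext fun a => ?_⟩
    exact (e (f a) ⟨a, rfl⟩).2.symm
  · rintro ⟨π, rfl⟩
    rw [← Multiset.map_map, Multiset.map_univ_val_equiv]


/-- Slopes coming in pairs `w i true`, `w i false` of equal absolute value can be placed in
increasing order on an interval of integers so that the two members of each pair occupy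
positions of opposite parity. -/
theorem exists_sorted_placement_opposite_parity {ι : Type*} [DecidableEq ι] (w : ι → Bool → ℝ)
    (hw : ∀ i, |w i true| = |w i false|) (n : ℕ) :
    ∀ s : Finset ι, s.card = n → ∀ base : ℤ, ∃ σ : ι → Bool → ℤ,
      (∀ i ∈ s, ∀ b, base ≤ σ i b ∧ σ i b < base + 2 * n) ∧
      (∀ i ∈ s, ∀ j ∈ s, ∀ b b', σ i b = σ j b' → i = j ∧ b = b') ∧
      (∀ i ∈ s, (σ i true + σ i false) % 2 = 1) ∧
      (∀ i ∈ s, ∀ j ∈ s, ∀ b b', w i b < w j b' → σ i b < σ j b') := by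
  induction n with
  | zero =>
    intro s hs base
    rw [Finset.card_eq_zero] at hs
    subst hs
    exact ⟨fun _ _ => 0, by simp, by simp, by simp, by simp⟩
  | succ n ih =>
    intro s hs base
    obtain ⟨k, hk, hmax⟩ := s.exists_max_image (fun i => |w i true|)
      (Finset.card_pos.mp (by omega))
    have hcard : (s.erase k).card = n := by rw [Finset.card_erase_of_mem hk]; omega
    have habs : ∀ i ∈ s, ∀ b b', |w i b| ≤ |w k b'| := by
      intro i hi b b'
      have h := hmax i hi
      cases b <;> cases b' <;> simp only [hw] at h ⊢ <;> exact h
    have key : ∀ (base' : ℤ) (t f : ℤ), base ≤ base' → base' ≤ base + 2 →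
        (t + f) % 2 = 1 →
        (∀ b, (cond b t f < base' ∧ base ≤ cond b t f ∧ w k b ≤ 0) ∨
          (base' + 2 * n ≤ cond b t f ∧ cond b t f < base + 2 * n + 2 ∧ 0 ≤ w k b)) →
        (w k true < w k false → t < f) → (w k false < w k true → f < t) →
        ∃ σ : ι → Bool → ℤ,
          (∀ i ∈ s, ∀ b, base ≤ σ i b ∧ σ i b < base + 2 * (n + 1 : ℕ)) ∧
          (∀ i ∈ s, ∀ j ∈ s, ∀ b b', σ i b = σ j b' → i = j ∧ b = b') ∧
          (∀ i ∈ s, (σ i true + σ i false) % 2 = 1) ∧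
          (∀ i ∈ s, ∀ j ∈ s, ∀ b b', w i b < w j b' → σ i b < σ j b') := by
      intro base' t f h1 h2 hpar hpos htf hft
      obtain ⟨σ, hr, hinj, hp, hm⟩ := ih _ hcard base'
      have hr' : ∀ i ∈ s, i ≠ k → ∀ b, base' ≤ σ i b ∧ σ i b < base' + 2 * n :=
        fun i hi hik => hr i (Finset.mem_erase.mpr ⟨hik, hi⟩)
      refine ⟨fun i b => if i = k then cond b t f else σ i b, ?_, ?_, ?_, ?_⟩
      · intro i hi b
        by_cases hik : i = k
        · simp only [hik, if_true]
          have := hpos b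
          push_cast
          omega
        · simp only [hik, if_false]
          have := hr' i hi hik b
          push_cast
          omega
      · intro i hi j hj b b' h
        by_cases hik : i = k <;> by_cases hjk : j = k <;>
          simp only [hik, hjk, if_true, if_false] at h
        · refine ⟨hik.trans hjk.symm, ?_⟩
          cases b <;> cases b' <;> simp only [cond_true, cond_false] at h <;>
            first | rfl | omega
        · have := hpos b
          have := hr' j hj hjk b'
          omega
        · have := hpos b'
          have := hr' i hi hik b
          omega
        · exact hinj i (Finset.mem_erase.mpr ⟨hik, hi⟩) j (Finset.mem_erase.mpr ⟨hjk, hj⟩) b b' h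
      · intro i hi
        by_cases hik : i = k
        · simpa only [hik, if_true, cond_true, cond_false] using hpar
        · simpa only [hik, if_false] using hp i (Finset.mem_erase.mpr ⟨hik, hi⟩)
      · intro i hi j hj b b' h
        by_cases hik : i = k <;> by_cases hjk : j = k <;>
          simp only [hik, hjk, if_true, if_false] at h ⊢
        · cases b <;> cases b' <;> simp only [cond_true, cond_false]
          · exact absurd h (lt_irrefl _)
          · exact hft h
          · exact htf h
          · exact absurd h (lt_irrefl _)
        · have hr0 := hr' j hj hjk b'
          rcases hpos b with h0 | ⟨-, -, h0⟩
          · omega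
          · have h3 := habs j hj b' b
            rw [abs_of_nonneg h0] at h3
            exact absurd ((le_abs_self _).trans h3) (not_le.mpr h)
        · have hr0 := hr' i hi hik b
          rcases hpos b' with ⟨-, -, h0⟩ | h0
          · have h3 := habs i hi b b'
            rw [abs_of_nonpos h0] at h3
            linarith [neg_abs_le (w i b)]
          · omega
        · exact hm i (Finset.mem_erase.mpr ⟨hik, hi⟩) j (Finset.mem_erase.mpr ⟨hjk, hj⟩) b b' h
    rcases le_total 0 (w k true) with ht | ht <;> rcases le_total 0 (w k false) with hf | hf
    · have he : w k true = w k false := by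
        have := hw k
        rwa [abs_of_nonneg ht, abs_of_nonneg hf] at this
      refine key base (base + 2 * n) (base + 2 * n + 1) (by omega) (by omega) (by omega) ?_
        (by simp [he]) (by simp [he])
      rintro (_ | _) <;> right <;> simp only [cond_true, cond_false] <;>
        refine ⟨by omega, by omega, by assumption⟩
    · refine key (base + 1) (base + 2 * n + 1) base (by omega) (by omega) (by omega) ?_
        (fun h => by linarith) (fun _ => by omega)
      rintro (_ | _)
      · left; simp only [cond_false]; exact ⟨by omega, by omega, hf⟩
      · right; simp only [cond_true]; exact ⟨by omega, by omega, ht⟩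
    · refine key (base + 1) base (base + 2 * n + 1) (by omega) (by omega) (by omega) ?_
        (fun _ => by omega) (fun h => by linarith)
      rintro (_ | _)
      · right; simp only [cond_false]; exact ⟨by omega, by omega, hf⟩
      · left; simp only [cond_true]; exact ⟨by omega, by omega, ht⟩
    · have he : w k true = w k false := by
        have := hw k
        rw [abs_of_nonpos ht, abs_of_nonpos hf] at this
        linarith
      refine key (base + 2) base (base + 1) (by omega) (by omega) (by omega) ?_
        (by simp [he]) (by simp [he])
      rintro (_ | _) <;> left <;> simp only [cond_true, cond_false] <;>
        refine ⟨by omega, by omega, by assumption⟩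

/-- The sum of the entries of a matrix along any rearrangement of its columns is at most its
ultradiscrete permanent. -/
theorem sum_le_uperm_of_map_eq {N : ℕ} (φ : Fin N → ℤ → ℝ) (f g : Fin N → ℤ)
    (h : Finset.univ.val.map f = Finset.univ.val.map g) :
    ∑ i, φ i (f i) ≤ uperm (Matrix.of fun i j => φ i (g j)) := by
  obtain ⟨π, rfl⟩ := map_univ_eq_iff_exists_perm f g |>.mp h
  exact Finset.le_sup' (fun π : Equiv.Perm (Fin N) => ∑ i, φ i (g (π i))) (Finset.mem_univ π)

theorem exists_uperm_eq_sum_s14 {N : ℕ} (φ : Fin N → ℤ → ℝ) (g : Fin N → ℤ) :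
    ∃ f : Fin N → ℤ, Finset.univ.val.map f = Finset.univ.val.map g ∧
      uperm (Matrix.of fun i j => φ i (g j)) = ∑ i, φ i (f i) := by
  obtain ⟨π, -, h⟩ := Finset.exists_mem_eq_sup' (s := (Finset.univ : Finset (Equiv.Perm (Fin N))))
    ⟨1, Finset.mem_univ 1⟩ (fun π => ∑ i, φ i (g (π i)))
  exact ⟨g ∘ π, (map_univ_eq_iff_exists_perm _ _).mpr ⟨π, rfl⟩, h⟩

/-- Among all ways of splitting a multiset of columns into two matrices, the interlacing one
maximizes the sum of the two ultradiscrete permanents, when each row is a maximum of two affine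
functions of opposite slopes. -/
theorem uperm_add_uperm_le_of_interlacing {N : ℕ} (p c d : Fin N → ℝ) (φ : Fin N → ℤ → ℝ)
    (hφ : ∀ i t, φ i t = max (p i * t + c i) (-p i * t + d i)) (f g x y : Fin N → ℤ)
    (hxy : ∀ i j : Fin N, i ≤ j → x i ≤ y j) (hyx : ∀ i j : Fin N, i < j → y i ≤ x j)
    (hx : Monotone x) (hy : Monotone y)
    (h : Finset.univ.val.map f + Finset.univ.val.map g =
      Finset.univ.val.map x + Finset.univ.val.map y) :
    uperm (Matrix.of fun i j => φ i (f j)) + uperm (Matrix.of fun i j => φ i (g j)) ≤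
      uperm (Matrix.of fun i j => φ i (x j)) + uperm (Matrix.of fun i j => φ i (y j)) := by
  obtain ⟨f', hf', hF⟩ := exists_uperm_eq_sum_s14 φ f
  obtain ⟨g', hg', hG⟩ := exists_uperm_eq_sum_s14 φ g
  rw [hF, hG]
  rw [← hf', ← hg'] at h
  have hpiece : ∀ i t, ∃ w e : ℝ, |w| = |p i| ∧ φ i t = w * t + e ∧
      ∀ t' : ℤ, w * t' + e ≤ φ i t' := by
    intro i t
    rcases max_choice (p i * t + c i) (-p i * t + d i) with h1 | h1
    · exact ⟨p i, c i, rfl, by rw [hφ, h1], fun t' => by rw [hφ]; exact le_max_left _ _⟩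
    · exact ⟨-p i, d i, abs_neg _, by rw [hφ, h1], fun t' => by rw [hφ]; exact le_max_right _ _⟩
  choose w e hw he hle using hpiece
  let v : Fin N → Bool → ℤ := fun i b => cond b (f' i) (g' i)
  let W : Fin N → Bool → ℝ := fun i b => w i (v i b)
  obtain ⟨σ, hr, hinj, hpar, hm⟩ := exists_sorted_placement_opposite_parity W
    (fun i => by simp only [W, hw]) N Finset.univ (by simp) 0
  simp only [Finset.mem_univ, true_implies, zero_add] at hr hinj hpar hm
  -- the half-position of each slot
  let q : Fin N → Bool → Fin N := fun i b =>
    ⟨(σ i b / 2).toNat, by have := hr i b; omega⟩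
  have hq : ∀ i b, ((q i b : ℕ) : ℤ) = σ i b / 2 := fun i b => by
    have := hr i b
    simp only [q]
    omega
  let z : Fin N → Bool → ℤ := fun i b => if σ i b % 2 = 0 then x (q i b) else y (q i b)
  have hz : ∀ i b j b', σ i b ≤ σ j b' → z i b ≤ z j b' := by
    intro i b j b' hij
    have h1 := hq i b
    have h2 := hq j b'
    simp only [z]
    split_ifs
    · exact hx (Fin.le_def.mpr (by omega))
    · exact hxy _ _ (Fin.le_def.mpr (by omega))
    · exact hyx _ _ (Fin.lt_def.mpr (by omega))
    · exact hy (Fin.le_def.mpr (by omega))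
  -- the slot of each row in an even position, and the one in an odd position
  let ev : Fin N → Bool := fun i => decide (σ i true % 2 = 0)
  have hev : ∀ i, σ i (ev i) % 2 = 0 ∧ σ i (!ev i) % 2 = 1 := by
    intro i
    have := hpar i
    by_cases h0 : σ i true % 2 = 0
    · have he : ev i = true := decide_eq_true h0
      rw [he, Bool.not_true]
      omega
    · have he : ev i = false := decide_eq_false h0
      rw [he, Bool.not_false]
      omega
  have hinjx : Function.Injective fun i => q i (ev i) := by
    intro i j hij
    have h1 := hq i (ev i)
    have h2 := hq j (ev j)
    simp only at hij
    rw [hij] at h1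
    exact (hinj i j (ev i) (ev j) (by have := hev i; have := hev j; omega)).1
  have hinjy : Function.Injective fun i => q i (!ev i) := by
    intro i j hij
    have h1 := hq i (!ev i)
    have h2 := hq j (!ev j)
    simp only at hij
    rw [hij] at h1
    exact (hinj i j (!ev i) (!ev j) (by have := hev i; have := hev j; omega)).1
  have hzx : ∀ i, z i (ev i) = x (q i (ev i)) := fun i => by simp only [z, (hev i).1, if_true]
  have hzy : ∀ i, z i (!ev i) = y (q i (!ev i)) := fun i => by simp [z, (hev i).2]
  have hmapx : Finset.univ.val.map (fun i => z i (ev i)) = Finset.univ.val.map x := by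
    refine (map_univ_eq_iff_exists_perm _ _).mpr
      ⟨Equiv.ofBijective _ (Finite.injective_iff_bijective.mp hinjx), funext hzx⟩
  have hmapy : Finset.univ.val.map (fun i => z i (!ev i)) = Finset.univ.val.map y := by
    refine (map_univ_eq_iff_exists_perm _ _).mpr
      ⟨Equiv.ofBijective _ (Finite.injective_iff_bijective.mp hinjy), funext hzy⟩
  have hpair : ∀ {M : Type} [AddCommMonoid M] (u : Fin N → Bool → M),
      ∑ i, u i true + ∑ i, u i false = ∑ i, u i (ev i) + ∑ i, u i (!ev i) := by
    intro M _ u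
    rw [← Finset.sum_add_distrib, ← Finset.sum_add_distrib]
    refine Finset.sum_congr rfl fun i _ => ?_
    cases ev i
    · exact add_comm _ _
    · rfl
  have hsum : ∀ {M : Type} [AddCommMonoid M] (u : Fin N → Bool → M),
      ∑ a : Fin N × Bool, u a.1 a.2 = ∑ i, u i true + ∑ i, u i false := by
    intro M _ u
    rw [Fintype.sum_prod_type, ← Finset.sum_add_distrib]
    simp
  have hms : ∀ {κ : Type} [Fintype κ] (u : κ → ℤ),
      Finset.univ.val.map u = ∑ i, ({u i} : Multiset ℤ) := by
    intro κ _ u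
    change _ = (Multiset.map ((fun a : ℤ => ({a} : Multiset ℤ)) ∘ u) Finset.univ.val).sum
    rw [← Multiset.map_map, Multiset.sum_map_singleton]
  have hvz : Finset.univ.val.map (fun a : Fin N × Bool => v a.1 a.2) =
      Finset.univ.val.map (fun a : Fin N × Bool => z a.1 a.2) := by
    rw [hms, hms, hsum (fun i b => ({v i b} : Multiset ℤ)),
      hsum (fun i b => ({z i b} : Multiset ℤ)), hpair (fun i b => ({z i b} : Multiset ℤ)),
      ← hms, ← hms, ← hms, ← hms, hmapx, hmapy]
    exact h
  obtain ⟨π, hπ⟩ := (map_univ_eq_iff_exists_perm _ _).mp hvz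
  have hmono : Monovary (fun a : Fin N × Bool => W a.1 a.2)
      (fun a : Fin N × Bool => (z a.1 a.2 : ℝ)) := by
    intro a b hab
    by_contra hlt
    have h1 := hz _ _ _ _ (hm _ _ _ _ (not_le.mp hlt)).le
    exact absurd (Int.cast_lt.mp hab) (not_lt.mpr h1)
  have hrearr := hmono.sum_mul_comp_perm_le_sum_mul (σ := π)
  have hcomp : ∀ a : Fin N × Bool, z (π a).1 (π a).2 = v a.1 a.2 := fun a =>
    (congrFun hπ a).symm
  simp only [hcomp] at hrearr
  rw [hsum (fun i b => W i b * (v i b : ℝ)), hsum (fun i b => W i b * (z i b : ℝ))] at hrearr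
  calc ∑ i, φ i (f' i) + ∑ i, φ i (g' i)
      = (∑ i, W i true * (v i true : ℝ) + ∑ i, W i false * (v i false : ℝ)) +
        (∑ i, e i (v i true) + ∑ i, e i (v i false)) := by
        simp only [← Finset.sum_add_distrib]
        refine Finset.sum_congr rfl fun i _ => ?_
        rw [he i (f' i), he i (g' i)]
        simp only [W, v, cond_true, cond_false]
        ring
    _ ≤ (∑ i, W i true * (z i true : ℝ) + ∑ i, W i false * (z i false : ℝ)) +
        (∑ i, e i (v i true) + ∑ i, e i (v i false)) := by gcongr
    _ = ∑ i, (W i true * (z i true : ℝ) + e i (v i true)) +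
        ∑ i, (W i false * (z i false : ℝ) + e i (v i false)) := by
        simp only [Finset.sum_add_distrib]
        ring
    _ ≤ ∑ i, φ i (z i true) + ∑ i, φ i (z i false) := by
        gcongr <;> exact hle _ _ _
    _ = ∑ i, φ i (z i (ev i)) + ∑ i, φ i (z i (!ev i)) := hpair (fun i b => φ i (z i b))
    _ ≤ _ := add_le_add (sum_le_uperm_of_map_eq φ _ _ hmapx) (sum_le_uperm_of_map_eq φ _ _ hmapy)

/-- Two points are separated by a set invariant under `σ` or under `σ * swap α β`. -/
theorem exists_invariant_separating {κ : Type*} [Finite κ] [DecidableEq κ] (σ : Equiv.Perm κ)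
    {α β : κ} (hαβ : α ≠ β) :
    ∃ ρ : Equiv.Perm κ, (ρ = σ ∨ ρ = σ * Equiv.swap α β) ∧
      ∃ U : Set κ, (∀ x, ρ x ∈ U ↔ x ∈ U) ∧ (α ∈ U ∧ β ∉ U ∨ α ∉ U ∧ β ∈ U) := by
  classical
  have hex : ∃ k : ℕ, 0 < k ∧ ((σ ^ k) α = α ∨ (σ ^ k) α = β) :=
    ⟨orderOf σ, orderOf_pos σ, by simp [pow_orderOf_eq_one]⟩
  have hk := Nat.find_spec hex
  have hmin : ∀ j, 0 < j → j < Nat.find hex → (σ ^ j) α ≠ α ∧ (σ ^ j) α ≠ β := fun j hj hlt =>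
    not_or.mp fun hc => Nat.find_min hex hlt ⟨hj, hc⟩
  set k := Nat.find hex
  let U : Set κ := {x | ∃ j, 0 < j ∧ j ≤ k ∧ (σ ^ j) α = x}
  have hinv : ∀ ρ : Equiv.Perm κ, (∀ x ∈ U, ρ x ∈ U) → ∀ x, ρ x ∈ U ↔ x ∈ U := by
    intro ρ h x
    refine ⟨fun hx => ?_, h x⟩
    have hs : Set.SurjOn ρ U U :=
      ((Set.toFinite U).injOn_iff_bijOn_of_mapsTo h |>.mp ρ.injective.injOn).surjOn
    obtain ⟨y, hy, hyx⟩ := hs hx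
    exact ρ.injective hyx ▸ hy
  rcases hk with ⟨hk0, hk | hk⟩
  · refine ⟨σ, Or.inl rfl, U, hinv σ ?_, Or.inl ⟨⟨k, hk0, le_rfl, hk⟩, ?_⟩⟩
    · rintro x ⟨j, hj, hjk, rfl⟩
      rcases hjk.eq_or_lt with rfl | hlt
      · exact ⟨1, one_pos, hk0, by rw [hk, pow_one]⟩
      · exact ⟨j + 1, j.succ_pos, hlt, by rw [pow_succ', Equiv.Perm.mul_apply]⟩
    · rintro ⟨j, hj, hjk, hc⟩
      rcases hjk.eq_or_lt with rfl | hlt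
      · exact hαβ (hk.symm.trans hc)
      · exact (hmin j hj hlt).2 hc
  · refine ⟨σ * Equiv.swap α β, Or.inr rfl, U, hinv _ ?_, Or.inr ⟨?_, ⟨k, hk0, le_rfl, hk⟩⟩⟩
    · rintro x ⟨j, hj, hjk, rfl⟩
      rcases hjk.eq_or_lt with rfl | hlt
      · exact ⟨1, one_pos, hk0, by simp [hk]⟩
      · refine ⟨j + 1, j.succ_pos, hlt, ?_⟩
        rw [Equiv.Perm.mul_apply, Equiv.swap_apply_of_ne_of_ne (hmin j hj hlt).1 (hmin j hj hlt).2,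
          pow_succ', Equiv.Perm.mul_apply]
    · rintro ⟨j, hj, hjk, hc⟩
      rcases hjk.eq_or_lt with rfl | hlt
      · exact hαβ (hc.symm.trans hk)
      · exact (hmin j hj hlt).1 hc

theorem map_univ_piecewise_of_invariant {κ γ : Type*} [Fintype κ] (M : κ → γ)
    (ρ : Equiv.Perm κ) (U : Set κ) [DecidablePred (· ∈ U)] (hU : ∀ x, ρ x ∈ U ↔ x ∈ U) :
    Finset.univ.val.map (fun x => if x ∈ U then M (ρ x) else M x) = Finset.univ.val.map M := by
  classical
  refine (map_univ_eq_iff_exists_perm _ _).mpr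
    ⟨Equiv.Perm.ofSubtype (ρ.subtypePerm hU), funext fun x => ?_⟩
  by_cases hx : x ∈ U
  · simp [hx, Equiv.Perm.ofSubtype_apply_of_mem (ρ.subtypePerm hU) hx]
  · simp [hx, Equiv.Perm.ofSubtype_apply_of_not_mem (ρ.subtypePerm hU) hx]

/-- Exchange property of two enumerations of the same multiset, along an invariant set separating
two chosen indices. -/
theorem exists_exchange {κ γ : Type*} [Fintype κ] [DecidableEq κ] (M M' : κ → γ)
    (h : Finset.univ.val.map M' = Finset.univ.val.map M) {α β : κ} (hαβ : α ≠ β) :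
    ∃ f g : κ → γ, Finset.univ.val.map f = Finset.univ.val.map M ∧
      Finset.univ.val.map g = Finset.univ.val.map M ∧
      (∀ x, x ≠ α → x ≠ β → f x = M x ∧ g x = M' x ∨ f x = M' x ∧ g x = M x) ∧
      f β = M β ∧ g α = M α ∧ (f α = M' α ∧ g β = M' β ∨ f α = M' β ∧ g β = M' α) := by
  classical
  obtain ⟨σ, rfl⟩ := (map_univ_eq_iff_exists_perm _ _).mp h
  obtain ⟨ρ, hρ, U, hU, hsep⟩ := exists_invariant_separating σ hαβ
  have hV : ∃ V : Set κ, (∀ x, ρ x ∈ V ↔ x ∈ V) ∧ α ∈ V ∧ β ∉ V := by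
    rcases hsep with h1 | h1
    · exact ⟨U, hU, h1⟩
    · exact ⟨Uᶜ, fun x => not_congr (hU x), h1.1, fun hc => hc h1.2⟩
  obtain ⟨V, hV, hα, hβ⟩ := hV
  have hoff : ∀ x, x ≠ α → x ≠ β → ρ x = σ x := by
    intro x h1 h2
    rcases hρ with rfl | rfl
    · rfl
    · rw [Equiv.Perm.mul_apply, Equiv.swap_apply_of_ne_of_ne h1 h2]
  refine ⟨fun x => if x ∈ V then M (ρ x) else M x, fun x => if x ∈ Vᶜ then M (ρ x) else M x,
    map_univ_piecewise_of_invariant M ρ V hV,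
    map_univ_piecewise_of_invariant M ρ Vᶜ fun x => not_congr (hV x), ?_, by simp [hβ],
    by simp [hα], ?_⟩
  · intro x h1 h2
    by_cases hx : x ∈ V <;> simp [hx, hoff x h1 h2]
  · rcases hρ with rfl | rfl <;> simp [hα, hβ]

/-- One inequality of the three-term relation for ultradiscrete permanents of arbitrary
matrices. -/
theorem uperm_add_uperm_le_max {N : ℕ} (φ : Fin N → ℤ → ℝ) (T : Multiset ℤ) (a b a' b' : ℤ)
    (h : ℤ → ℤ → Fin N → ℤ)
    (hab : Finset.univ.val.map (h a b) + {a, b} = T)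
    (hab' : Finset.univ.val.map (h a' b') + {a', b'} = T)
    (haa' : Finset.univ.val.map (h a' a) + {a', a} = T)
    (hba' : Finset.univ.val.map (h a' b) + {a', b} = T)
    (hbb' : Finset.univ.val.map (h b' b) + {b', b} = T)
    (hab'' : Finset.univ.val.map (h a b') + {a, b'} = T) :
    uperm (Matrix.of fun i j => φ i (h a b j)) + uperm (Matrix.of fun i j => φ i (h a' b' j)) ≤
      max (uperm (Matrix.of fun i j => φ i (h a' b j)) +
          uperm (Matrix.of fun i j => φ i (h a b' j)))
        (uperm (Matrix.of fun i j => φ i (h b' b j)) +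
          uperm (Matrix.of fun i j => φ i (h a' a j))) := by
  obtain ⟨f, hf, hF⟩ := exists_uperm_eq_sum_s14 φ (h a b)
  obtain ⟨f', hf', hF'⟩ := exists_uperm_eq_sum_s14 φ (h a' b')
  have hmap : ∀ u : Fin N ⊕ Bool → ℤ, Finset.univ.val.map u =
      Finset.univ.val.map (fun i => u (Sum.inl i)) + {u (Sum.inr false), u (Sum.inr true)} := by
    intro u
    rw [← Finset.univ_disjSum_univ, Finset.val_disjSum, Multiset.disjSum, Multiset.map_add,
      Multiset.map_map, Multiset.map_map]
    congr 1
    exact Multiset.pair_comm (u (Sum.inr true)) (u (Sum.inr false))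
  let M : Fin N ⊕ Bool → ℤ := Sum.elim f fun t => cond t b a
  let M' : Fin N ⊕ Bool → ℤ := Sum.elim f' fun t => cond t b' a'
  have hM : Finset.univ.val.map M = T := by rw [hmap, ← hab, ← hf]; rfl
  have hM' : Finset.univ.val.map M' = T := by rw [hmap, ← hab', ← hf']; rfl
  obtain ⟨u, v, hu, hv, huv, huβ, hvα, hend⟩ := exists_exchange M M' (hM'.trans hM.symm)
    (α := Sum.inr false) (β := Sum.inr true) (by simp)
  rw [hM, hmap] at hu hv
  rw [huβ] at hu
  rw [hvα] at hv
  have hsum : ∑ i, φ i (f i) + ∑ i, φ i (f' i) =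
      ∑ i, φ i (u (Sum.inl i)) + ∑ i, φ i (v (Sum.inl i)) := by
    simp only [← Finset.sum_add_distrib]
    refine Finset.sum_congr rfl fun i _ => ?_
    rcases huv (Sum.inl i) (by simp) (by simp) with ⟨h1, h2⟩ | ⟨h1, h2⟩ <;> rw [h1, h2]
    · rfl
    · exact add_comm _ _
  rw [hF, hF', hsum]
  rcases hend with ⟨h1, h2⟩ | ⟨h1, h2⟩ <;> rw [h1] at hu <;> rw [h2] at hv
  · exact le_max_of_le_left (add_le_add
      (sum_le_uperm_of_map_eq φ _ _ (add_right_cancel (hu.trans hba'.symm)))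
      (sum_le_uperm_of_map_eq φ _ _ (add_right_cancel (hv.trans hab''.symm))))
  · rw [Multiset.pair_comm] at hv
    exact le_max_of_le_right (add_le_add
      (sum_le_uperm_of_map_eq φ _ _ (add_right_cancel (hu.trans hbb'.symm)))
      (sum_le_uperm_of_map_eq φ _ _ (add_right_cancel (hv.trans haa'.symm))))

theorem omitTwo_strictMono (N : ℕ) (a k₁ k₂ : ℤ) :
    StrictMono (omitTwo N a k₁ k₂) := by
  intro i j hij
  have := Fin.lt_def.mp hij
  simp only [omitTwo]
  split_ifs <;> omega

theorem map_omitTwo_add_pair (N : ℕ) (k₁ k₂ : ℤ) (h₁ : 0 ≤ k₁) (h : k₁ < k₂)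
    (h₂ : k₂ ≤ (N : ℤ) + 1) :
    Finset.univ.val.map (omitTwo N 0 k₁ k₂) + {k₁, k₂} = (Finset.Icc 0 ((N : ℤ) + 1)).val := by
  have hne : ∀ j, omitTwo N 0 k₁ k₂ j ≠ k₁ ∧ omitTwo N 0 k₁ k₂ j ≠ k₂ ∧
      0 ≤ omitTwo N 0 k₁ k₂ j ∧ omitTwo N 0 k₁ k₂ j ≤ (N : ℤ) + 1 := by
    intro j
    have := j.2
    simp only [omitTwo]
    split_ifs <;> omega
  have hnd : (Finset.univ.val.map (omitTwo N 0 k₁ k₂) + {k₁, k₂}).Nodup := by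
    refine Multiset.nodup_add.mpr ⟨Finset.univ.nodup.map (omitTwo_strictMono N 0 k₁ k₂).injective,
      by simp [h.ne], ?_⟩
    rw [Multiset.disjoint_left]
    intro x hx
    obtain ⟨j, -, rfl⟩ := Multiset.mem_map.mp hx
    simp [(hne j).1, (hne j).2.1]
  refine (Multiset.Nodup.ext hnd (Finset.nodup _)).mpr fun x => ?_
  simp only [Multiset.mem_add, Multiset.mem_map, Finset.mem_val, Finset.mem_univ, true_and,
    Multiset.insert_eq_cons, Multiset.mem_cons, Multiset.mem_singleton, Finset.mem_Icc]
  constructor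
  · rintro (⟨j, rfl⟩ | rfl | rfl)
    · exact (hne j).2.2
    · omega
    · omega
  · intro hx
    by_cases h1 : x = k₁
    · exact Or.inr (Or.inl h1)
    by_cases h2 : x = k₂
    · exact Or.inr (Or.inr h2)
    left
    rcases lt_or_gt_of_ne h1 with h3 | h3
    · refine ⟨⟨x.toNat, by omega⟩, ?_⟩
      simp only [omitTwo]
      split_ifs <;> omega
    rcases lt_or_gt_of_ne h2 with h4 | h4
    · refine ⟨⟨(x - 1).toNat, by omega⟩, ?_⟩
      simp only [omitTwo]
      split_ifs <;> omega
    · refine ⟨⟨(x - 2).toNat, by omega⟩, ?_⟩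
      simp only [omitTwo]
      split_ifs <;> omega

/-- Ultradiscrete Plücker identity for the uKP tau function. -/
theorem taucKP_plucker (N : ℕ) (hN : 1 ≤ N) (a₁ a₂ a₃ : ℝ) (h₁₂ : a₂ < a₁) (h₂₃ : a₃ < a₂)
    (p c c' : Fin N → ℝ) (s l m n : ℤ)
    (k₁ k₂ k₃ : ℤ) (hk₁ : 0 < k₁) (h₁₂' : k₁ < k₂) (h₂₃' : k₂ < k₃) (hk₃ : k₃ < (N : ℤ) + 1) :
    taucKP a₁ a₂ a₃ p c c' s l m n k₂ ((N : ℤ) + 1) + taucKP a₁ a₂ a₃ p c c' s l m n k₁ k₃ =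
      max
        (taucKP a₁ a₂ a₃ p c c' s l m n k₁ ((N : ℤ) + 1) +
          taucKP a₁ a₂ a₃ p c c' s l m n k₂ k₃)
        (taucKP a₁ a₂ a₃ p c c' s l m n k₃ ((N : ℤ) + 1) +
          taucKP a₁ a₂ a₃ p c c' s l m n k₁ k₂) := by
  have heq : ∀ α β : ℤ, α < β → taucKP a₁ a₂ a₃ p c c' s l m n α β =
      uperm (Matrix.of fun i j : Fin N =>
        phiKP a₁ a₂ a₃ p c c' i l m n (s + omitTwo N 0 α β j)) := by
    intro α β h
    rw [taucKP, min_eq_left h.le, max_eq_right h.le]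
  have hφ : ∃ e d : Fin N → ℝ, ∀ i (t : ℤ), phiKP a₁ a₂ a₃ p c c' i l m n (s + t) =
      max (p i * t + e i) (-p i * t + d i) := by
    refine ⟨fun i => p i * s + max 0 (p i - a₁) * l + max 0 (p i - a₂) * m +
      max 0 (p i - a₃) * n + c i, fun i => -p i * s + max 0 (-p i - a₁) * l +
      max 0 (-p i - a₂) * m + max 0 (-p i - a₃) * n + c' i, fun i t => ?_⟩
    rw [phiKP]
    push_cast
    congr 1 <;> ring
  obtain ⟨e, d, hφ⟩ := hφ
  have hT : ∀ α β : ℤ, 0 ≤ α → α < β → β ≤ (N : ℤ) + 1 → _ := map_omitTwo_add_pair N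
  rw [heq _ _ (h₂₃'.trans hk₃), heq _ _ (h₁₂'.trans h₂₃'),
    heq _ _ ((h₁₂'.trans h₂₃').trans hk₃), heq _ _ h₂₃', heq _ _ hk₃, heq _ _ h₁₂']
  have hcancel : ∀ α β γ δ : ℤ, 0 ≤ α → α < β → β ≤ (N : ℤ) + 1 → 0 ≤ γ → γ < δ →
      δ ≤ (N : ℤ) + 1 → ({α, β} + {γ, δ} : Multiset ℤ) = {k₂, (N : ℤ) + 1} + {k₁, k₃} →
      Finset.univ.val.map (omitTwo N 0 α β) + Finset.univ.val.map (omitTwo N 0 γ δ) =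
      Finset.univ.val.map (omitTwo N 0 k₂ ((N : ℤ) + 1)) +
        Finset.univ.val.map (omitTwo N 0 k₁ k₃) := by
    intro α β γ δ h1 h2 h3 h4 h5 h6 hk
    refine add_right_cancel (b := ({α, β} + {γ, δ} : Multiset ℤ)) ?_
    rw [add_add_add_comm, hT α β h1 h2 h3, hT γ δ h4 h5 h6, hk, add_add_add_comm,
      hT k₂ _ (by omega) (by omega) (by omega), hT k₁ _ (by omega) (by omega) (by omega)]
  have hge : ∀ α β γ δ : ℤ, 0 ≤ α → α < β → β ≤ (N : ℤ) + 1 → 0 ≤ γ → γ < δ →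
      δ ≤ (N : ℤ) + 1 → ({α, β} + {γ, δ} : Multiset ℤ) = {k₂, (N : ℤ) + 1} + {k₁, k₃} → _ :=
    fun α β γ δ h1 h2 h3 h4 h5 h6 hk =>
      uperm_add_uperm_le_of_interlacing p e d
        (fun i t => phiKP a₁ a₂ a₃ p c c' i l m n (s + t)) hφ
        (omitTwo N 0 α β) (omitTwo N 0 γ δ) (omitTwo N 0 k₂ ((N : ℤ) + 1)) (omitTwo N 0 k₁ k₃)
        (fun i j hij => by
          have := Fin.le_def.mp hij
          simp only [omitTwo]
          split_ifs <;> omega)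
        (fun i j hij => by
          have := Fin.lt_def.mp hij
          simp only [omitTwo]
          split_ifs <;> omega)
        (omitTwo_strictMono _ _ _ _).monotone
        (omitTwo_strictMono _ _ _ _).monotone
        (hcancel α β γ δ h1 h2 h3 h4 h5 h6 hk)
  refine le_antisymm ?_ (max_le ?_ ?_)
  · exact uperm_add_uperm_le_max (fun i t => phiKP a₁ a₂ a₃ p c c' i l m n (s + t))
      (Finset.Icc 0 ((N : ℤ) + 1)).val k₂ ((N : ℤ) + 1) k₁ k₃ (omitTwo N 0)
      (hT _ _ (by omega) (by omega) (by omega)) (hT _ _ (by omega) (by omega) (by omega))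
      (hT _ _ (by omega) (by omega) (by omega)) (hT _ _ (by omega) (by omega) (by omega))
      (hT _ _ (by omega) (by omega) (by omega)) (hT _ _ (by omega) (by omega) (by omega))
  · refine hge _ _ _ _ (by omega) (by omega) (by omega) (by omega) (by omega) (by omega) ?_
    ext x
    simp only [Multiset.count_add, Multiset.insert_eq_cons, Multiset.count_cons,
      Multiset.count_singleton]
    omega
  · refine hge _ _ _ _ (by omega) (by omega) (by omega) (by omega) (by omega) (by omega) ?_
    ext x
    simp only [Multiset.count_add, Multiset.insert_eq_cons, Multiset.count_cons,
      Multiset.count_singleton]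
    omega
end

section
/- In the uKP setting, the tau function τ satisfies, for all integers l, m, n: max( τ(l+1,m,n) + τ(l,m+1,n+1) − a_1 − a_2, τ(l,m+1,n) + τ(l+1,m,n+1) − a_2 − a_3, τ(l,m,n+1) + τ(l+1,m+1,n) − a_1 − a_3 ) = max( τ(l+1,m,n) + τ(l,m+1,n+1) − a_1 − a_3, τ(l,m+1,n) + τ(l+1,m,n+1) − a_1 − a_2, τ(l,m,n+1) + τ(l+1,m+1,n) − a_2 − a_3 ). -/
/-- The function `f` is bounded above and below on `t ≥ 0` by positive multiples of
`exp (t * X)`. -/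
def HasExpOrder (f : ℝ → ℝ) (X : ℝ) : Prop :=
  ∃ c > 0, ∃ C > 0, ∀ t : ℝ, 0 ≤ t → c * Real.exp (t * X) ≤ f t ∧ f t ≤ C * Real.exp (t * X)

namespace HasExpOrder

variable {f g : ℝ → ℝ} {X Y : ℝ}

theorem pos (hf : HasExpOrder f X) {t : ℝ} (ht : 0 ≤ t) : 0 < f t := by
  obtain ⟨c, hc, C, -, h⟩ := hf
  exact lt_of_lt_of_le (by positivity) (h t ht).1

theorem const {k : ℝ} (hk : 0 < k) : HasExpOrder (fun _ => k) 0 :=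
  ⟨k, hk, k, hk, fun t _ => by simp⟩

theorem exp (X : ℝ) : HasExpOrder (fun t => Real.exp (t * X)) X :=
  ⟨1, one_pos, 1, one_pos, fun t _ => by simp⟩

theorem mul (hf : HasExpOrder f X) (hg : HasExpOrder g Y) :
    HasExpOrder (fun t => f t * g t) (X + Y) := by
  have hf' := hf
  have hg' := hg
  obtain ⟨c, hc, C, hC, h⟩ := hf
  obtain ⟨d, hd, D, hD, k⟩ := hg
  refine ⟨c * d, mul_pos hc hd, C * D, mul_pos hC hD, fun t ht => ?_⟩
  have hfp := (hf'.pos ht).le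
  have hgp := (hg'.pos ht).le
  rw [mul_add, Real.exp_add, mul_mul_mul_comm, mul_mul_mul_comm C]
  exact ⟨mul_le_mul (h t ht).1 (k t ht).1 (by positivity) hfp,
    mul_le_mul (h t ht).2 (k t ht).2 hgp (by positivity)⟩

theorem inv (hf : HasExpOrder f X) : HasExpOrder (fun t => (f t)⁻¹) (-X) := by
  have hf' := hf
  obtain ⟨c, hc, C, hC, h⟩ := hf
  refine ⟨C⁻¹, inv_pos.2 hC, c⁻¹, inv_pos.2 hc, fun t ht => ?_⟩
  rw [mul_neg, Real.exp_neg, ← mul_inv, ← mul_inv]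
  exact ⟨inv_anti₀ (hf'.pos ht) (h t ht).2, inv_anti₀ (by positivity) (h t ht).1⟩

theorem add (hf : HasExpOrder f X) (hg : HasExpOrder g Y) :
    HasExpOrder (fun t => f t + g t) (max X Y) := by
  have hf' := hf
  have hg' := hg
  obtain ⟨c, hc, C, hC, h⟩ := hf
  obtain ⟨d, hd, D, hD, k⟩ := hg
  refine ⟨min c d, lt_min hc hd, C + D, add_pos hC hD, fun t ht => ⟨?_, ?_⟩⟩
  · rcases max_cases X Y with ⟨e, -⟩ | ⟨e, -⟩ <;> rw [e]
    · have : min c d * Real.exp (t * X) ≤ c * Real.exp (t * X) := by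
        gcongr
        exact min_le_left c d
      linarith [(h t ht).1, hg'.pos ht]
    · have : min c d * Real.exp (t * Y) ≤ d * Real.exp (t * Y) := by
        gcongr
        exact min_le_right c d
      linarith [(k t ht).1, hf'.pos ht]
  · have h₁ : C * Real.exp (t * X) ≤ C * Real.exp (t * max X Y) := by
      gcongr
      exact le_max_left X Y
    have h₂ : D * Real.exp (t * Y) ≤ D * Real.exp (t * max X Y) := by
      gcongr
      exact le_max_right X Y
    linarith [(h t ht).2, (k t ht).2]

theorem pow (hf : HasExpOrder f X) (k : ℕ) : HasExpOrder (fun t => f t ^ k) (X * k) := by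
  induction k with
  | zero => simpa using const one_pos
  | succ k ih =>
    have h : X * ((k + 1 : ℕ) : ℝ) = X * k + X := by
      push_cast
      ring
    rw [h]
    exact ih.mul hf

theorem zpow (hf : HasExpOrder f X) (k : ℤ) : HasExpOrder (fun t => f t ^ k) (X * k) := by
  obtain ⟨k, rfl | rfl⟩ := k.eq_nat_or_neg
  · simpa using hf.pow k
  · simpa using (hf.pow k).inv

theorem prod {ι : Type*} (s : Finset ι) {f : ι → ℝ → ℝ} {X : ι → ℝ}
    (h : ∀ i ∈ s, HasExpOrder (f i) (X i)) :
    HasExpOrder (fun t => ∏ i ∈ s, f i t) (∑ i ∈ s, X i) := by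
  classical
  induction s using Finset.induction_on with
  | empty => simpa using const one_pos
  | insert a s ha ih =>
    simp only [Finset.prod_insert ha, Finset.sum_insert ha]
    exact (h a (by simp)).mul (ih fun i hi => h i (by simp [hi]))

theorem sum {ι : Type*} {s : Finset ι} (hs : s.Nonempty) {f : ι → ℝ → ℝ} {X : ι → ℝ}
    (h : ∀ i, HasExpOrder (f i) (X i)) :
    HasExpOrder (fun t => ∑ i ∈ s, f i t) (s.sup' hs X) := by
  induction hs using Finset.Nonempty.cons_induction with
  | singleton a => simpa using h a
  | cons a s ha hs ih =>
    simp only [Finset.sum_cons, Finset.sup'_cons hs]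
    exact (h a).add ih

theorem le_of_le (hf : HasExpOrder f X) (hg : HasExpOrder g Y) (hfg : ∀ t, 0 ≤ t → f t ≤ g t) :
    X ≤ Y := by
  obtain ⟨c, hc, _, _, h⟩ := hf
  obtain ⟨_, _, C, hC, k⟩ := hg
  by_contra! hXY
  have hd : 0 < X - Y := sub_pos.2 hXY
  set t := C / c / (X - Y) with ht
  have ht0 : 0 ≤ t := by positivity
  have h₁ : c * Real.exp (t * X) ≤ C * Real.exp (t * Y) :=
    (h t ht0).1.trans ((hfg t ht0).trans (k t ht0).2)
  have h₂ : t * (X - Y) = C / c := div_mul_cancel₀ _ hd.ne'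
  have h₃ : t * X = C / c + t * Y := by linarith
  rw [h₃, Real.exp_add, ← mul_assoc] at h₁
  have h₄ : c * Real.exp (C / c) ≤ C := le_of_mul_le_mul_right h₁ (Real.exp_pos _)
  have h₅ : c * (C / c + 1) ≤ c * Real.exp (C / c) := by
    gcongr
    exact Real.add_one_le_exp _
  have h₆ : c * (C / c + 1) = C + c := by field_simp
  linarith

theorem unique (hf : HasExpOrder f X) (hg : HasExpOrder g Y) (hfg : ∀ t, 0 ≤ t → f t = g t) :
    X = Y :=
  le_antisymm (hf.le_of_le hg fun t ht => (hfg t ht).le)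
    (hg.le_of_le hf fun t ht => (hfg t ht).ge)

theorem const_mul_exp {k : ℝ} (hk : 0 < k) (X : ℝ) :
    HasExpOrder (fun t => k * Real.exp (t * X)) X := by
  simpa using (const hk).mul (exp X)

theorem sub_of_lt {k₁ k₂ : ℝ} (h₂ : 0 < k₂) (hk : k₂ < k₁) (hXY : Y ≤ X) :
    HasExpOrder (fun t => k₁ * Real.exp (t * X) - k₂ * Real.exp (t * Y)) X := by
  refine ⟨k₁ - k₂, sub_pos.2 hk, k₁, h₂.trans hk, fun t ht => ⟨?_, ?_⟩⟩
  · have : k₂ * Real.exp (t * Y) ≤ k₂ * Real.exp (t * X) := by gcongr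
    linarith
  · have : 0 < k₂ * Real.exp (t * Y) := by positivity
    linarith

end HasExpOrder

open Matrix in
/-- For consecutive Casorati-type matrices `A, B, C` (each obtained from the previous one by
shifting the columns), the two-parameter determinants are governed by a one-variable function. -/
theorem exists_det_shift_eq {n : ℕ} {A B C : Matrix (Fin (n + 1)) (Fin (n + 1)) ℝ}
    (hAB : ∀ i (j : Fin n), B i j.castSucc = A i j.succ)
    (hBC : ∀ i (j : Fin n), C i j.castSucc = B i j.succ) (hA : A.det ≠ 0) :
    ∃ G : ℝ → ℝ, ∀ x y : ℝ, (A + x • B).det ≠ 0 → (A + y • B).det ≠ 0 →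
      (x - y) * (A + (x + y) • B + (x * y) • C).det * A.det =
        (A + x • B).det * (A + y • B).det * ((x - y) + x * y * (x * G x - y * G y)) := by
  have hAu : IsUnit A.det := hA.isUnit
  set K := A⁻¹ * B with hK
  have hAK : A * K = B := by rw [hK, Matrix.mul_nonsing_inv_cancel_left _ _ hAu]
  set R := A⁻¹ * C - K * K with hR
  have hcol : ∀ i (j : Fin n), R i j.castSucc = 0 := by
    intro i j
    have h₁ : (fun i => C i j.castSucc) = fun i => B i j.succ := funext fun i => hBC i j
    have h₂ : (fun k => K k j.castSucc) = fun k => (1 : Matrix _ _ ℝ) k j.succ := by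
      have h₃ : (fun i => B i j.castSucc) = fun i => A i j.succ := funext fun i => hAB i j
      funext k
      rw [hK, Matrix.mul_apply', h₃, ← Matrix.mul_apply', Matrix.nonsing_inv_mul _ hAu]
    rw [hR, Matrix.sub_apply, Matrix.mul_apply', h₁, ← Matrix.mul_apply', ← hK,
      Matrix.mul_apply', h₂, ← Matrix.mul_apply', Matrix.mul_one, sub_self]
  set e : Fin (n + 1) → ℝ := Pi.single (Fin.last n) 1 with he
  set r : Fin (n + 1) → ℝ := fun i => R i (Fin.last n) with hr
  have hRe : R = replicateCol Unit r * replicateRow Unit e := by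
    ext i j
    refine Fin.lastCases ?_ (fun j => ?_) j
    · simp [Matrix.mul_apply, hr, he]
    · simp [Matrix.mul_apply, hcol, he, Fin.castSucc_ne_last]
  have hC : C = A * (K * K + R) := by
    rw [hR, add_sub_cancel, Matrix.mul_nonsing_inv_cancel_left _ _ hAu]
  have hone : ∀ x : ℝ, A + x • B = A * (1 + x • K) := by
    intro x
    rw [Matrix.mul_add, Matrix.mul_one, Matrix.mul_smul, hAK]
  refine ⟨fun x => e ⬝ᵥ ((1 + x • K)⁻¹ *ᵥ r), fun x y hx hy => ?_⟩
  rw [hone, Matrix.det_mul] at hx hy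
  rw [hone x, hone y, Matrix.det_mul, Matrix.det_mul]
  have hx' : IsUnit (1 + x • K).det := (right_ne_zero_of_mul hx).isUnit
  have hy' : IsUnit (1 + y • K).det := (right_ne_zero_of_mul hy).isUnit
  have htwo : A + (x + y) • B + (x * y) • C =
      A * ((1 + x • K) * (1 + y • K) +
        replicateCol Unit ((x * y) • r) * replicateRow Unit e) := by
    rw [Matrix.replicateCol_smul, Matrix.smul_mul, ← hRe, hC, ← hAK]
    simp only [Matrix.mul_add, Matrix.add_mul, Matrix.mul_one, Matrix.one_mul,
      Matrix.mul_smul, Matrix.smul_mul]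
    module
  have hres : (x - y) • ((1 + x • K) * (1 + y • K))⁻¹ =
      x • (1 + x • K)⁻¹ - y • (1 + y • K)⁻¹ := by
    have hcomm : Commute (1 + x • K) (1 + y • K) := by
      apply Commute.add_left (Commute.one_left _)
      apply Commute.add_right (Commute.one_right _)
      exact ((Commute.refl K).smul_left x).smul_right y
    have h₁ : (x - y) • (1 : Matrix (Fin (n + 1)) (Fin (n + 1)) ℝ) =
        x • (1 + y • K) - y • (1 + x • K) := by
      rw [smul_add, smul_add, smul_smul, smul_smul, mul_comm y x, sub_smul]
      abel
    have h₂ : (1 + y • K) * ((1 + x • K) * (1 + y • K))⁻¹ = (1 + x • K)⁻¹ := by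
      rw [Matrix.mul_inv_rev, Matrix.mul_nonsing_inv_cancel_left _ _ hy']
    have h₃ : (1 + x • K) * ((1 + x • K) * (1 + y • K))⁻¹ = (1 + y • K)⁻¹ := by
      rw [hcomm.eq, Matrix.mul_inv_rev, Matrix.mul_nonsing_inv_cancel_left _ _ hx']
    rw [← Matrix.one_mul (((1 + x • K) * (1 + y • K))⁻¹), ← Matrix.smul_mul, h₁, Matrix.sub_mul,
      Matrix.smul_mul, Matrix.smul_mul, h₂, h₃]
  have hdot : (x - y) * (e ⬝ᵥ (((1 + x • K) * (1 + y • K))⁻¹ *ᵥ r)) =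
      x * (e ⬝ᵥ ((1 + x • K)⁻¹ *ᵥ r)) - y * (e ⬝ᵥ ((1 + y • K)⁻¹ *ᵥ r)) := by
    simpa only [smul_mulVec, sub_mulVec, dotProduct_sub, dotProduct_smul, smul_eq_mul] using
      congrArg (fun M => e ⬝ᵥ (M *ᵥ r)) hres
  have hu : IsUnit ((1 + x • K) * (1 + y • K)).det := by
    rw [Matrix.det_mul]
    exact hx'.mul hy'
  have hdet : (1 + replicateRow Unit e * ((1 + x • K) * (1 + y • K))⁻¹ *
      replicateCol Unit ((x * y) • r)).det =
      1 + x * y * (e ⬝ᵥ (((1 + x • K) * (1 + y • K))⁻¹ *ᵥ r)) := by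
    rw [Matrix.det_unique, Matrix.mul_assoc, ← Matrix.replicateCol_mulVec, Matrix.add_apply,
      Matrix.replicateRow_mul_replicateCol_apply, Matrix.one_apply_eq, mulVec_smul,
      dotProduct_smul, smul_eq_mul]
  rw [htwo, Matrix.det_mul, Matrix.det_add_replicateCol_mul_replicateRow hu, hdet,
    Matrix.det_mul, ← hdot]
  ring

/-- The three-term bilinear (discrete KP) identity for shifted determinants. -/
theorem det_shift_bilinear {n : ℕ} {A B C : Matrix (Fin (n + 1)) (Fin (n + 1)) ℝ}
    (hAB : ∀ i (j : Fin n), B i j.castSucc = A i j.succ)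
    (hBC : ∀ i (j : Fin n), C i j.castSucc = B i j.succ) (hA : A.det ≠ 0) {x y z : ℝ}
    (hx : x ≠ 0) (hy : y ≠ 0) (hz : z ≠ 0) (hAx : (A + x • B).det ≠ 0)
    (hAy : (A + y • B).det ≠ 0) (hAz : (A + z • B).det ≠ 0) :
    (x⁻¹ - z⁻¹) * ((A + y • B).det * (A + (x + z) • B + (x * z) • C).det) =
      (y⁻¹ - z⁻¹) * ((A + x • B).det * (A + (y + z) • B + (y * z) • C).det) +
      (x⁻¹ - y⁻¹) * ((A + z • B).det * (A + (x + y) • B + (x * y) • C).det) := by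
  obtain ⟨G, hG⟩ := exists_det_shift_eq hAB hBC hA
  have key : ∀ u v : ℝ, u ≠ 0 → v ≠ 0 → (A + u • B).det ≠ 0 → (A + v • B).det ≠ 0 →
      (u⁻¹ - v⁻¹) * (A + (u + v) • B + (u * v) • C).det * A.det =
        (A + u • B).det * (A + v • B).det * ((u⁻¹ - u * G u) - (v⁻¹ - v * G v)) := by
    intro u v hu hv hAu hAv
    have h := hG u v hAu hAv
    field_simp
    linear_combination -h
  apply mul_right_cancel₀ hA
  linear_combination (A + y • B).det * key x z hx hz hAx hAz
    - (A + x • B).det * key y z hy hz hAy hAz - (A + z • B).det * key x y hx hy hAx hAy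

open Finset in
/-- Pairing any real tuple with a permutation of `0, …, N - 1` is bounded by the sum of the
pairwise maxima. -/
theorem sum_mul_perm_le {N : ℕ} (y : Fin N → ℝ) (π : Equiv.Perm (Fin N)) :
    ∑ i, y i * ((π i : ℕ) : ℝ) ≤ ∑ i, ∑ j ∈ Ioi i, max (y i) (y j) := by
  have hcard : ∀ i, ((π i : ℕ) : ℝ) = ∑ j, if π j < π i then (1 : ℝ) else 0 := by
    intro i
    rw [Equiv.sum_comp π fun k => if k < π i then (1 : ℝ) else 0, Finset.sum_boole]
    have : (univ.filter fun k => k < π i) = Iio (π i) := by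
      ext
      simp
    rw [this, Fin.card_Iio]
  have hpair := sum_sum_Ioi_add_eq_sum_sum_off_diag fun j i : Fin N =>
    if π j < π i then y i else 0
  calc ∑ i, y i * ((π i : ℕ) : ℝ) = ∑ i, ∑ j ∈ {i}ᶜ, if π j < π i then y i else 0 := by
        refine sum_congr rfl fun i _ => ?_
        rw [hcard, mul_sum, Fintype.sum_eq_add_sum_compl i]
        simp
    _ ≤ ∑ i, ∑ j ∈ Ioi i, max (y i) (y j) := by
        rw [← hpair]
        refine sum_le_sum fun i _ => sum_le_sum fun j hj => ?_
        have hne : π i ≠ π j := π.injective.ne (mem_Ioi.1 hj).ne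
        rcases hne.lt_or_gt with h | h
        · simp [h, h.not_gt]
        · simp [h, h.not_gt]

open Finset Matrix in
/-- Expansion of a two-branch Casorati determinant into Vandermonde determinants. -/
theorem det_casorati_eq_sum {N : ℕ} (α β P : Fin N → ℝ) :
    (of fun i j : Fin N =>
      α i * P i ^ (j : ℕ) + (-1) ^ (i : ℕ) * (β i * (P i)⁻¹ ^ (j : ℕ))).det =
    ∑ S : Finset (Fin N), (∏ i, if i ∈ S then α i else β i) *
      ∏ i, ∏ j ∈ Ioi i, (if j ∈ S then 1 else -1) *
        ((if j ∈ S then P j else (P j)⁻¹) - if i ∈ S then P i else (P i)⁻¹) := by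
  have hsplit := (detRowAlternating (R := ℝ) (n := Fin N)).map_add_univ
    (fun i j => α i * P i ^ (j : ℕ)) (fun i j => (-1) ^ (i : ℕ) * (β i * (P i)⁻¹ ^ (j : ℕ)))
  refine hsplit.trans (sum_congr rfl fun S _ => ?_)
  have hrow : S.piecewise (fun i (j : Fin N) => α i * P i ^ (j : ℕ))
      (fun i j => (-1) ^ (i : ℕ) * (β i * (P i)⁻¹ ^ (j : ℕ))) =
      of fun i j => ((if i ∈ S then 1 else -1) ^ (i : ℕ) * if i ∈ S then α i else β i) *
        vandermonde (fun i => if i ∈ S then P i else (P i)⁻¹) i j := by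
    ext i j
    by_cases hi : i ∈ S <;> simp [hi, vandermonde_apply, mul_assoc]
  have hsign : ∏ i : Fin N, (if i ∈ S then (1 : ℝ) else -1) ^ (i : ℕ) =
      ∏ i, ∏ j ∈ Ioi i, if j ∈ S then (1 : ℝ) else -1 := by
    rw [prod_comm' (t' := univ) (s' := fun j => Iio j) (by simp)]
    simp
  rw [hrow]
  refine (det_mul_column _ _).trans ?_
  rw [det_vandermonde, prod_mul_distrib, hsign]
  simp only [prod_mul_distrib]
  ring

/-- Signed differences of the nodes `k i * exp (t * p i)` and their inverses. -/
theorem hasExpOrder_node_sub {k₁ k₂ p₁ p₂ : ℝ} (h₁ : 1 < k₁) (hk : k₁ < k₂) (hp₁ : 0 ≤ p₁)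
    (hp : p₁ ≤ p₂) (a b : Prop) [Decidable a] [Decidable b] :
    HasExpOrder (fun t => (if b then 1 else -1) *
      ((if b then k₂ * Real.exp (t * p₂) else (k₂ * Real.exp (t * p₂))⁻¹) -
        if a then k₁ * Real.exp (t * p₁) else (k₁ * Real.exp (t * p₁))⁻¹))
      (max (if a then p₁ else -p₁) (if b then p₂ else -p₂)) := by
  have h₁' : k₁⁻¹ < 1 := inv_lt_one_of_one_lt₀ h₁
  have h₂' : k₂⁻¹ < 1 := inv_lt_one_of_one_lt₀ (h₁.trans hk)
  have hk₁ : 0 < k₁⁻¹ := by positivity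
  have hk₂ : 0 < k₂⁻¹ := inv_pos.2 (by linarith)
  have hinv : k₂⁻¹ < k₁⁻¹ := inv_strictAnti₀ (by linarith) hk
  simp only [mul_inv, ← Real.exp_neg, ← mul_neg]
  by_cases ha : a <;> by_cases hb : b <;>
    simp only [ha, hb, if_true, if_false, one_mul, neg_one_mul, neg_sub]
  · rw [max_eq_right hp]
    exact .sub_of_lt (by linarith) hk hp
  · rw [max_eq_left (by linarith)]
    exact .sub_of_lt hk₂ (by linarith) (by linarith)
  · rw [max_eq_right (by linarith)]
    exact .sub_of_lt hk₁ (by linarith) (by linarith)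
  · rw [max_eq_left (by linarith)]
    exact .sub_of_lt hk₂ hinv (by linarith)

theorem le_uperm {N : ℕ} (A : Matrix (Fin N) (Fin N) ℝ) (π : Equiv.Perm (Fin N)) :
    ∑ i, A i (π i) ≤ uperm A :=
  Finset.le_sup' (fun π : Equiv.Perm (Fin N) => ∑ i, A i (π i)) (Finset.mem_univ π)

open Finset Matrix in
/-- The growth rate of a sign-alternating two-branch Casorati determinant is an ultradiscrete
permanent. -/
theorem hasExpOrder_det_casorati {N : ℕ} {k p : Fin N → ℝ} (hk₁ : ∀ i, 1 < k i)
    (hk : StrictMono k) (hp₀ : ∀ i, 0 ≤ p i) (hp : Monotone p) {α β : Fin N → ℝ → ℝ}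
    {u v : Fin N → ℝ} (hα : ∀ i, HasExpOrder (α i) (u i)) (hβ : ∀ i, HasExpOrder (β i) (v i)) :
    HasExpOrder (fun t => (of fun i j : Fin N =>
        α i t * (k i * Real.exp (t * p i)) ^ (j : ℕ) +
          (-1) ^ (i : ℕ) * (β i t * (k i * Real.exp (t * p i))⁻¹ ^ (j : ℕ))).det)
      (uperm (of fun i j : Fin N =>
        max (u i + p i * ((j : ℕ) : ℝ)) (v i + -p i * ((j : ℕ) : ℝ)))) := by
  set W : Finset (Fin N) → ℝ := fun S => (∑ i, if i ∈ S then u i else v i) +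
    ∑ i, ∑ j ∈ Ioi i, max (if i ∈ S then p i else -p i) (if j ∈ S then p j else -p j)
  have hdet : HasExpOrder (fun t => (of fun i j : Fin N =>
        α i t * (k i * Real.exp (t * p i)) ^ (j : ℕ) +
          (-1) ^ (i : ℕ) * (β i t * (k i * Real.exp (t * p i))⁻¹ ^ (j : ℕ))).det)
      (univ.sup' univ_nonempty W) := by
    have hexp := fun t => det_casorati_eq_sum (fun i => α i t) (fun i => β i t)
      (fun i => k i * Real.exp (t * p i))
    simp only [hexp]
    refine HasExpOrder.sum univ_nonempty fun S => .mul (.prod _ fun i _ => ?_)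
      (.prod _ fun i _ => .prod _ fun j hj => ?_)
    · by_cases hi : i ∈ S
      · simpa [hi] using hα i
      · simpa [hi] using hβ i
    · have hij := mem_Ioi.1 hj
      exact hasExpOrder_node_sub (hk₁ i) (hk hij) (hp₀ i) (hp hij.le) (i ∈ S) (j ∈ S)
  have hnode : ∀ i, HasExpOrder (fun t => k i * Real.exp (t * p i)) (p i) := fun i =>
    .const_mul_exp (zero_lt_one.trans (hk₁ i)) _
  have hperm : HasExpOrder (fun t => ∑ π : Equiv.Perm (Fin N), ∏ i,
        (α i t * (k i * Real.exp (t * p i)) ^ ((π i : Fin N) : ℕ) +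
          β i t * (k i * Real.exp (t * p i))⁻¹ ^ ((π i : Fin N) : ℕ)))
      (uperm (of fun i j : Fin N =>
        max (u i + p i * ((j : ℕ) : ℝ)) (v i + -p i * ((j : ℕ) : ℝ)))) :=
    HasExpOrder.sum _ fun π => .prod _ fun i _ =>
      ((hα i).mul ((hnode i).pow _)).add ((hβ i).mul ((hnode i).inv.pow _))
  have hle : univ.sup' univ_nonempty W ≤ uperm (of fun i j : Fin N =>
      max (u i + p i * ((j : ℕ) : ℝ)) (v i + -p i * ((j : ℕ) : ℝ))) := by
    refine hdet.le_of_le hperm fun t ht => (le_abs_self _).trans ?_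
    rw [← det_transpose, det_apply]
    refine (abs_sum_le_sum_abs _ _).trans (sum_le_sum fun π _ => ?_)
    rw [Units.smul_def, zsmul_eq_mul, abs_mul, abs_prod]
    have hs : |(((Equiv.Perm.sign π : ℤˣ) : ℤ) : ℝ)| = 1 := by
      rcases Int.units_eq_one_or (Equiv.Perm.sign π) with h | h <;> simp [h]
    rw [hs, one_mul]
    refine prod_le_prod (fun _ _ => abs_nonneg _) fun i _ => ?_
    have h₁ : 0 ≤ α i t * (k i * Real.exp (t * p i)) ^ ((π i : Fin N) : ℕ) :=
      (((hα i).mul ((hnode i).pow _)).pos ht).le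
    have h₂ : 0 ≤ β i t * (k i * Real.exp (t * p i))⁻¹ ^ ((π i : Fin N) : ℕ) :=
      (((hβ i).mul ((hnode i).inv.pow _)).pos ht).le
    refine (abs_add_le _ _).trans ?_
    rw [abs_of_nonneg h₁, abs_mul, abs_pow, abs_neg, abs_one, one_pow, one_mul, abs_of_nonneg h₂]
  have hge : uperm (of fun i j : Fin N =>
      max (u i + p i * ((j : ℕ) : ℝ)) (v i + -p i * ((j : ℕ) : ℝ))) ≤
      univ.sup' univ_nonempty W := by
    refine sup'_le _ _ fun π _ => ?_
    set S : Finset (Fin N) := univ.filter fun i =>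
      v i + -p i * (((π i : Fin N) : ℕ) : ℝ) ≤ u i + p i * (((π i : Fin N) : ℕ) : ℝ) with hS
    refine le_trans ?_ (le_sup' W (mem_univ S))
    have hbranch : ∀ i, of (fun i j : Fin N =>
        max (u i + p i * ((j : ℕ) : ℝ)) (v i + -p i * ((j : ℕ) : ℝ))) i (π i) =
        (if i ∈ S then u i else v i) +
          (if i ∈ S then p i else -p i) * (((π i : Fin N) : ℕ) : ℝ) := by
      intro i
      rw [of_apply]
      by_cases hi : i ∈ S
      · rw [if_pos hi, if_pos hi, max_eq_left (by simpa [hS] using hi)]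
      · rw [if_neg hi, if_neg hi, max_eq_right (le_of_not_ge (by simpa [hS] using hi))]
    rw [sum_congr rfl fun i _ => hbranch i, sum_add_distrib]
    exact add_le_add le_rfl (sum_mul_perm_le _ π)
  rwa [le_antisymm hge hle]

/-- The discrete KP plane wave with spectral parameter `P`. -/
noncomputable def kpWave (z₁ z₂ z₃ P : ℝ) (l m n σ : ℤ) : ℝ :=
  P ^ σ * (1 + P / z₁) ^ l * (1 + P / z₂) ^ m * (1 + P / z₃) ^ n

section kpWave

variable {z₁ z₂ z₃ P : ℝ}

theorem kpWave_succ₁ (h₁ : 0 < z₁) (hP : 0 < P) (l m n σ : ℤ) :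
    kpWave z₁ z₂ z₃ P (l + 1) m n σ =
      kpWave z₁ z₂ z₃ P l m n σ + z₁⁻¹ * kpWave z₁ z₂ z₃ P l m n (σ + 1) := by
  have h : 1 + P / z₁ ≠ 0 := by positivity
  unfold kpWave
  rw [zpow_add_one₀ h, zpow_add_one₀ hP.ne']
  ring

theorem kpWave_succ₂ (h₂ : 0 < z₂) (hP : 0 < P) (l m n σ : ℤ) :
    kpWave z₁ z₂ z₃ P l (m + 1) n σ =
      kpWave z₁ z₂ z₃ P l m n σ + z₂⁻¹ * kpWave z₁ z₂ z₃ P l m n (σ + 1) := by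
  have h : 1 + P / z₂ ≠ 0 := by positivity
  unfold kpWave
  rw [zpow_add_one₀ h, zpow_add_one₀ hP.ne']
  ring

theorem kpWave_succ₃ (h₃ : 0 < z₃) (hP : 0 < P) (l m n σ : ℤ) :
    kpWave z₁ z₂ z₃ P l m (n + 1) σ =
      kpWave z₁ z₂ z₃ P l m n σ + z₃⁻¹ * kpWave z₁ z₂ z₃ P l m n (σ + 1) := by
  have h : 1 + P / z₃ ≠ 0 := by positivity
  unfold kpWave
  rw [zpow_add_one₀ h, zpow_add_one₀ hP.ne']
  ring

theorem kpWave_add_nat (hP : 0 < P) (l m n σ : ℤ) (j : ℕ) :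
    kpWave z₁ z₂ z₃ P l m n (σ + j) = kpWave z₁ z₂ z₃ P l m n σ * P ^ j := by
  unfold kpWave
  rw [zpow_add₀ hP.ne', zpow_natCast]
  ring

end kpWave

theorem HasExpOrder.kpWave {z₁ z₂ z₃ P : ℝ → ℝ} {a₁ a₂ a₃ p : ℝ} (h₁ : HasExpOrder z₁ a₁)
    (h₂ : HasExpOrder z₂ a₂) (h₃ : HasExpOrder z₃ a₃) (hP : HasExpOrder P p) (l m n σ : ℤ) :
    HasExpOrder (fun t => kpWave (z₁ t) (z₂ t) (z₃ t) (P t) l m n σ)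
      (p * σ + max 0 (p - a₁) * l + max 0 (p - a₂) * m + max 0 (p - a₃) * n) := by
  have factor : ∀ {z : ℝ → ℝ} {a : ℝ}, HasExpOrder z a → ∀ k : ℤ,
      HasExpOrder (fun t => (1 + P t / z t) ^ k) (max 0 (p - a) * k) := by
    intro z a hz k
    simpa only [div_eq_mul_inv, sub_eq_add_neg] using
      ((HasExpOrder.const one_pos).add (hP.mul hz.inv)).zpow k
  exact (((hP.zpow σ).mul (factor h₁ l)).mul (factor h₂ m)).mul (factor h₃ n)

/-- The Casorati matrix of sign-alternating two-term superpositions of plane waves. -/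
noncomputable def kpMatrix {N : ℕ} (z₁ z₂ z₃ : ℝ) (b b' P : Fin N → ℝ) (l m n s : ℤ) :
    Matrix (Fin N) (Fin N) ℝ :=
  Matrix.of fun i j => b i * kpWave z₁ z₂ z₃ (P i) l m n (s + ((j : ℕ) : ℤ)) +
    (-1) ^ (i : ℕ) * (b' i * kpWave z₁ z₂ z₃ (P i)⁻¹ l m n (s + ((j : ℕ) : ℤ)))

/-- The discrete KP equation for the Casorati determinants. -/
theorem kpMatrix_det_bilinear {N : ℕ} (hN : 1 ≤ N) {z₁ z₂ z₃ : ℝ} (h₁ : 0 < z₁) (h₂ : 0 < z₂)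
    (h₃ : 0 < z₃) {b b' P : Fin N → ℝ} (hP : ∀ i, 0 < P i) {l m n s : ℤ} {D : ℤ → ℤ → ℤ → ℝ}
    (hD : ∀ l m n, D l m n = (kpMatrix z₁ z₂ z₃ b b' P l m n s).det)
    (hne : ∀ l m n, D l m n ≠ 0) :
    (z₁ - z₃) * (D l (m + 1) n * D (l + 1) m (n + 1)) =
      (z₂ - z₃) * (D (l + 1) m n * D l (m + 1) (n + 1)) +
        (z₁ - z₂) * (D l m (n + 1) * D (l + 1) (m + 1) n) := by
  obtain ⟨N, rfl⟩ := Nat.exists_eq_add_of_le' hN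
  have hP' : ∀ i, 0 < (P i)⁻¹ := fun i => inv_pos.2 (hP i)
  set A := kpMatrix z₁ z₂ z₃ b b' P l m n s with hA
  set B := kpMatrix z₁ z₂ z₃ b b' P l m n (s + 1) with hB
  set C := kpMatrix z₁ z₂ z₃ b b' P l m n (s + 1 + 1) with hC
  have hshift : ∀ (s : ℤ) (i : Fin (N + 1)) (j : Fin N),
      kpMatrix z₁ z₂ z₃ b b' P l m n (s + 1) i j.castSucc =
        kpMatrix z₁ z₂ z₃ b b' P l m n s i j.succ := by
    intro s i j
    have : s + 1 + ((j : ℕ) : ℤ) = s + (((j : ℕ) + 1 : ℕ) : ℤ) := by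
      push_cast
      ring
    simp only [kpMatrix, Matrix.of_apply, Fin.val_castSucc, Fin.val_succ, this]
  have e₁ : kpMatrix z₁ z₂ z₃ b b' P (l + 1) m n s = A + z₁⁻¹ • B := by
    ext i j
    simp only [hA, hB, kpMatrix, Matrix.of_apply, Matrix.add_apply, Matrix.smul_apply, smul_eq_mul,
      kpWave_succ₁ h₁ (hP i), kpWave_succ₁ h₁ (hP' i), add_right_comm s 1]
    ring
  have e₂ : kpMatrix z₁ z₂ z₃ b b' P l (m + 1) n s = A + z₂⁻¹ • B := by
    ext i j
    simp only [hA, hB, kpMatrix, Matrix.of_apply, Matrix.add_apply, Matrix.smul_apply, smul_eq_mul,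
      kpWave_succ₂ h₂ (hP i), kpWave_succ₂ h₂ (hP' i), add_right_comm s 1]
    ring
  have e₃ : kpMatrix z₁ z₂ z₃ b b' P l m (n + 1) s = A + z₃⁻¹ • B := by
    ext i j
    simp only [hA, hB, kpMatrix, Matrix.of_apply, Matrix.add_apply, Matrix.smul_apply, smul_eq_mul,
      kpWave_succ₃ h₃ (hP i), kpWave_succ₃ h₃ (hP' i), add_right_comm s 1]
    ring
  have e₁₂ : kpMatrix z₁ z₂ z₃ b b' P (l + 1) (m + 1) n s =
      A + (z₁⁻¹ + z₂⁻¹) • B + (z₁⁻¹ * z₂⁻¹) • C := by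
    ext i j
    simp only [hA, hB, hC, kpMatrix, Matrix.of_apply, Matrix.add_apply, Matrix.smul_apply,
      smul_eq_mul, kpWave_succ₁ h₁ (hP i), kpWave_succ₁ h₁ (hP' i), kpWave_succ₂ h₂ (hP i),
      kpWave_succ₂ h₂ (hP' i), add_right_comm _ (1 : ℤ) ((j : ℕ) : ℤ)]
    ring
  have e₁₃ : kpMatrix z₁ z₂ z₃ b b' P (l + 1) m (n + 1) s =
      A + (z₁⁻¹ + z₃⁻¹) • B + (z₁⁻¹ * z₃⁻¹) • C := by
    ext i j
    simp only [hA, hB, hC, kpMatrix, Matrix.of_apply, Matrix.add_apply, Matrix.smul_apply,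
      smul_eq_mul, kpWave_succ₁ h₁ (hP i), kpWave_succ₁ h₁ (hP' i), kpWave_succ₃ h₃ (hP i),
      kpWave_succ₃ h₃ (hP' i), add_right_comm _ (1 : ℤ) ((j : ℕ) : ℤ)]
    ring
  have e₂₃ : kpMatrix z₁ z₂ z₃ b b' P l (m + 1) (n + 1) s =
      A + (z₂⁻¹ + z₃⁻¹) • B + (z₂⁻¹ * z₃⁻¹) • C := by
    ext i j
    simp only [hA, hB, hC, kpMatrix, Matrix.of_apply, Matrix.add_apply, Matrix.smul_apply,
      smul_eq_mul, kpWave_succ₂ h₂ (hP i), kpWave_succ₂ h₂ (hP' i), kpWave_succ₃ h₃ (hP i),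
      kpWave_succ₃ h₃ (hP' i), add_right_comm _ (1 : ℤ) ((j : ℕ) : ℤ)]
    ring
  have n₀ := hne l m n
  have n₁ := hne (l + 1) m n
  have n₂ := hne l (m + 1) n
  have n₃ := hne l m (n + 1)
  simp only [hD, e₁, e₂, e₃, e₁₂, e₁₃, e₂₃] at n₀ n₁ n₂ n₃ ⊢
  simpa only [inv_inv] using det_shift_bilinear (hshift s) (hshift (s + 1)) n₀
    (inv_ne_zero h₁.ne') (inv_ne_zero h₂.ne') (inv_ne_zero h₃.ne') n₁ n₂ n₃

/-- The bilinear identity in its reduced form, for nonnegative sorted wave numbers. -/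
theorem tauKP_reduced_of_monotone {N : ℕ} (hN : 1 ≤ N) {a₁ a₂ a₃ : ℝ} (h₁₂ : a₂ < a₁)
    (h₂₃ : a₃ < a₂) {p : Fin N → ℝ} (hp₀ : ∀ i, 0 ≤ p i) (hp : Monotone p) (c c' : Fin N → ℝ)
    (s l m n : ℤ) :
    a₁ + (tauKP a₁ a₂ a₃ p c c' s l (m + 1) n + tauKP a₁ a₂ a₃ p c c' s (l + 1) m (n + 1)) =
      max
        (a₂ + (tauKP a₁ a₂ a₃ p c c' s (l + 1) m n +
          tauKP a₁ a₂ a₃ p c c' s l (m + 1) (n + 1)))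
        (a₁ + (tauKP a₁ a₂ a₃ p c c' s l m (n + 1) +
          tauKP a₁ a₂ a₃ p c c' s (l + 1) (m + 1) n)) := by
  set z₁ : ℝ → ℝ := fun t => 3 * Real.exp (t * a₁) with hz₁
  set z₂ : ℝ → ℝ := fun t => 2 * Real.exp (t * a₂) with hz₂
  set z₃ : ℝ → ℝ := fun t => 1 * Real.exp (t * a₃) with hz₃
  set k : Fin N → ℝ := fun i => ((i : ℕ) : ℝ) + 2 with hk
  have hk₁ : ∀ i, 1 < k i := fun i => by
    have : (0 : ℝ) ≤ ((i : ℕ) : ℝ) := Nat.cast_nonneg _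
    simp only [hk]
    linarith
  have hkm : StrictMono k := fun i j hij => by
    have : ((i : ℕ) : ℝ) < ((j : ℕ) : ℝ) := Nat.cast_lt.2 hij
    simp only [hk]
    linarith
  set P : ℝ → Fin N → ℝ := fun t i => k i * Real.exp (t * p i) with hP
  have hPpos : ∀ t i, 0 < P t i := fun t i =>
    mul_pos (zero_lt_one.trans (hk₁ i)) (Real.exp_pos _)
  have oz₁ : HasExpOrder z₁ a₁ := .const_mul_exp (by norm_num) _
  have oz₂ : HasExpOrder z₂ a₂ := .const_mul_exp (by norm_num) _
  have oz₃ : HasExpOrder z₃ a₃ := .const_mul_exp (by norm_num) _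
  have oP : ∀ i, HasExpOrder (fun t => P t i) (p i) := fun i =>
    .const_mul_exp (zero_lt_one.trans (hk₁ i)) _
  set D : ℝ → ℤ → ℤ → ℤ → ℝ := fun t l m n => (kpMatrix (z₁ t) (z₂ t) (z₃ t)
    (fun i => Real.exp (t * c i)) (fun i => Real.exp (t * c' i)) (P t) l m n s).det with hD
  have hDorder : ∀ l m n, HasExpOrder (fun t => D t l m n) (tauKP a₁ a₂ a₃ p c c' s l m n) := by
    intro l m n
    have h := hasExpOrder_det_casorati hk₁ hkm hp₀ hp
      (fun i => (HasExpOrder.exp (c i)).mul (.kpWave oz₁ oz₂ oz₃ (oP i) l m n s))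
      (fun i => (HasExpOrder.exp (c' i)).mul (.kpWave oz₁ oz₂ oz₃ (oP i).inv l m n s))
    have hdet : ∀ t, D t l m n = (Matrix.of fun i j : Fin N =>
        Real.exp (t * c i) * kpWave (z₁ t) (z₂ t) (z₃ t) (P t i) l m n s * P t i ^ (j : ℕ) +
          (-1) ^ (i : ℕ) * (Real.exp (t * c' i) *
            kpWave (z₁ t) (z₂ t) (z₃ t) (P t i)⁻¹ l m n s * (P t i)⁻¹ ^ (j : ℕ))).det := by
      intro t
      simp only [hD, kpMatrix, kpWave_add_nat (hPpos t _),
        kpWave_add_nat (inv_pos.2 (hPpos t _)), mul_assoc]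
    have htau : tauKP a₁ a₂ a₃ p c c' s l m n = uperm (Matrix.of fun i j : Fin N =>
        max (c i + (p i * s + max 0 (p i - a₁) * l + max 0 (p i - a₂) * m +
            max 0 (p i - a₃) * n) + p i * ((j : ℕ) : ℝ))
          (c' i + (-p i * s + max 0 (-p i - a₁) * l + max 0 (-p i - a₂) * m +
            max 0 (-p i - a₃) * n) + -p i * ((j : ℕ) : ℝ))) := by
      unfold tauKP
      congr 2
      funext i j
      unfold phiKP
      push_cast
      congr 1 <;> ring
    rw [htau]
    simpa only [hdet] using h
  have hlhs := (HasExpOrder.sub_of_lt (k₁ := 3) (k₂ := 1) one_pos (by norm_num)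
    (h₂₃.trans h₁₂).le).mul ((hDorder l (m + 1) n).mul (hDorder (l + 1) m (n + 1)))
  have hrhs := ((HasExpOrder.sub_of_lt (k₁ := 2) (k₂ := 1) one_pos (by norm_num) h₂₃.le).mul
    ((hDorder (l + 1) m n).mul (hDorder l (m + 1) (n + 1)))).add
    ((HasExpOrder.sub_of_lt (k₁ := 3) (k₂ := 2) two_pos (by norm_num) h₁₂.le).mul
    ((hDorder l m (n + 1)).mul (hDorder (l + 1) (m + 1) n)))
  exact hlhs.unique hrhs fun t ht => kpMatrix_det_bilinear hN (oz₁.pos ht) (oz₂.pos ht)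
    (oz₃.pos ht) (hPpos t) (fun _ _ _ => rfl) fun l m n => ((hDorder l m n).pos ht).ne'

/-- The ultradiscrete permanent does not depend on the order of the rows. -/
theorem uperm_comp_rows {N : ℕ} (A : Matrix (Fin N) (Fin N) ℝ) (e : Equiv.Perm (Fin N)) :
    uperm (Matrix.of fun i j => A (e i) j) = uperm A := by
  have hle : ∀ (A : Matrix (Fin N) (Fin N) ℝ) (e : Equiv.Perm (Fin N)),
      uperm (Matrix.of fun i j => A (e i) j) ≤ uperm A := by
    intro A e
    refine Finset.sup'_le _ _ fun π _ => le_trans (le_of_eq ?_) (le_uperm A (e.symm.trans π))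
    simp [← Equiv.sum_comp e fun i => A i (π (e.symm i))]
  refine le_antisymm (hle A e) (le_trans (le_of_eq (congrArg uperm ?_))
    (hle (Matrix.of fun i j => A (e i) j) e.symm))
  ext i j
  simp

theorem tauKP_comp_perm {N : ℕ} (a₁ a₂ a₃ : ℝ) (p c c' : Fin N → ℝ) (e : Equiv.Perm (Fin N))
    (s l m n : ℤ) :
    tauKP a₁ a₂ a₃ (p ∘ e) (c ∘ e) (c' ∘ e) s l m n = tauKP a₁ a₂ a₃ p c c' s l m n :=
  uperm_comp_rows (Matrix.of fun i j : Fin N => phiKP a₁ a₂ a₃ p c c' i l m n (s + (j.1 : ℤ))) e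

/-- Reversing the sign of a wave number amounts to exchanging the two phase constants. -/
theorem tauKP_abs {N : ℕ} (a₁ a₂ a₃ : ℝ) (p c c' : Fin N → ℝ) (s l m n : ℤ) :
    tauKP a₁ a₂ a₃ (fun i => |p i|) (fun i => if 0 ≤ p i then c i else c' i)
      (fun i => if 0 ≤ p i then c' i else c i) s l m n = tauKP a₁ a₂ a₃ p c c' s l m n := by
  unfold tauKP
  congr 2
  funext i j
  unfold phiKP
  by_cases h : 0 ≤ p i
  · simp [h, abs_of_nonneg]
  · rw [max_comm]
    simp [h, abs_of_neg (not_le.1 h)]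

/-- The bilinear identity with its dominated terms removed. -/
theorem tauKP_reduced {N : ℕ} (hN : 1 ≤ N) {a₁ a₂ a₃ : ℝ} (h₁₂ : a₂ < a₁)
    (h₂₃ : a₃ < a₂) (p c c' : Fin N → ℝ) (s l m n : ℤ) :
    a₁ + (tauKP a₁ a₂ a₃ p c c' s l (m + 1) n + tauKP a₁ a₂ a₃ p c c' s (l + 1) m (n + 1)) =
      max
        (a₂ + (tauKP a₁ a₂ a₃ p c c' s (l + 1) m n +
          tauKP a₁ a₂ a₃ p c c' s l (m + 1) (n + 1)))
        (a₁ + (tauKP a₁ a₂ a₃ p c c' s l m (n + 1) +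
          tauKP a₁ a₂ a₃ p c c' s (l + 1) (m + 1) n)) := by
  set q : Fin N → ℝ := fun i => |p i| with hq
  set e := Tuple.sort q
  have h := tauKP_reduced_of_monotone hN h₁₂ h₂₃ (p := q ∘ e) (fun i => abs_nonneg _)
    (Tuple.monotone_sort q) ((fun i => if 0 ≤ p i then c i else c' i) ∘ e)
    ((fun i => if 0 ≤ p i then c' i else c i) ∘ e) s l m n
  simpa only [tauKP_comp_perm, hq, tauKP_abs] using h

/-- The symmetric bilinear identity satisfied by the uKP tau function. -/
theorem tauKP_bilinear (N : ℕ) (hN : 1 ≤ N) (a₁ a₂ a₃ : ℝ) (h₁₂ : a₂ < a₁) (h₂₃ : a₃ < a₂)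
    (p c c' : Fin N → ℝ) (s l m n : ℤ) :
    max
      (max
        (tauKP a₁ a₂ a₃ p c c' s (l + 1) m n + tauKP a₁ a₂ a₃ p c c' s l (m + 1) (n + 1)
          - a₁ - a₂)
        (tauKP a₁ a₂ a₃ p c c' s l (m + 1) n + tauKP a₁ a₂ a₃ p c c' s (l + 1) m (n + 1)
          - a₂ - a₃))
      (tauKP a₁ a₂ a₃ p c c' s l m (n + 1) + tauKP a₁ a₂ a₃ p c c' s (l + 1) (m + 1) n
        - a₁ - a₃) =
    max
      (max
        (tauKP a₁ a₂ a₃ p c c' s (l + 1) m n + tauKP a₁ a₂ a₃ p c c' s l (m + 1) (n + 1)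
          - a₁ - a₃)
        (tauKP a₁ a₂ a₃ p c c' s l (m + 1) n + tauKP a₁ a₂ a₃ p c c' s (l + 1) m (n + 1)
          - a₁ - a₂))
      (tauKP a₁ a₂ a₃ p c c' s l m (n + 1) + tauKP a₁ a₂ a₃ p c c' s (l + 1) (m + 1) n
        - a₂ - a₃) := by
  have h := tauKP_reduced hN h₁₂ h₂₃ p c c' s l m n
  generalize tauKP a₁ a₂ a₃ p c c' s (l + 1) m n + tauKP a₁ a₂ a₃ p c c' s l (m + 1) (n + 1) = X₁
    at h ⊢
  generalize tauKP a₁ a₂ a₃ p c c' s l (m + 1) n + tauKP a₁ a₂ a₃ p c c' s (l + 1) m (n + 1) = X₂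
    at h ⊢
  generalize tauKP a₁ a₂ a₃ p c c' s l m (n + 1) + tauKP a₁ a₂ a₃ p c c' s (l + 1) (m + 1) n = X₃
    at h ⊢
  have h₁ : a₂ + X₁ ≤ a₁ + X₂ := h ▸ le_max_left _ _
  have h₃ : a₁ + X₃ ≤ a₁ + X₂ := h ▸ le_max_right _ _
  have hlhs : max (max (X₁ - a₁ - a₂) (X₂ - a₂ - a₃)) (X₃ - a₁ - a₃) = X₂ - a₂ - a₃ := by
    have e : max (X₁ - a₁ - a₂) (X₂ - a₂ - a₃) = X₂ - a₂ - a₃ := max_eq_right (by linarith)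
    rw [e, max_eq_left (by linarith)]
  rw [hlhs]
  refine le_antisymm ?_ (max_le (max_le ?_ ?_) ?_)
  · rcases max_choice (a₂ + X₁) (a₁ + X₃) with e | e <;> rw [e] at h
    · exact le_max_of_le_left (le_max_of_le_left (by linarith))
    · exact le_max_of_le_right (by linarith)
  all_goals linarith
end

section
/- (Theorem 3: soliton solution of the ultradiscrete KP equation) In the uKP setting, the tau function τ satisfies the ultradiscrete KP equation: for all integers l, m, n, τ(l,m+1,n) + τ(l+1,m,n+1) − a_2 = max( τ(l+1,m,n) + τ(l,m+1,n+1) − a_1, τ(l,m,n+1) + τ(l+1,m+1,n) − a_2 ). -/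
/-- The sum of the pairwise maxima of a finite family, over all ordered pairs. -/
noncomputable def pairMax {ι : Type*} [Fintype ι] (z : ι → ℝ) : ℝ :=
  ∑ i, ∑ j, max (z i) (z j)

lemma two_mul_sum_mul_rank {ι : Type*} [Fintype ι] [DecidableEq ι] {n : ℕ}
    (z : ι → ℝ) (e : ι ≃ Fin n) :
    2 * ∑ i, z i * ((e i : ℕ) : ℝ) =
      ∑ i, ∑ j, ((if e j < e i then z i else 0) + if e i < e j then z j else 0) := by
  have hrank (i : ι) : ((e i : ℕ) : ℝ) = ∑ j, if e j < e i then (1 : ℝ) else 0 := by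
    rw [e.sum_comp (fun k => if k < e i then (1 : ℝ) else 0), Finset.sum_boole]
    have : (Finset.univ.filter fun k => k < e i) = Finset.Iio (e i) := by ext; simp
    rw [this, Fin.card_Iio]
  have hsum : ∑ i, z i * ((e i : ℕ) : ℝ) = ∑ i, ∑ j, if e j < e i then z i else 0 := by
    refine Finset.sum_congr rfl fun i _ => ?_
    rw [hrank, Finset.mul_sum]
    exact Finset.sum_congr rfl fun j _ => by split_ifs <;> simp
  simp only [Finset.sum_add_distrib]
  rw [Finset.sum_comm (f := fun i j => if e i < e j then z j else 0), hsum]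
  ring

lemma pairMax_sub_sum {ι : Type*} [Fintype ι] [DecidableEq ι] (z : ι → ℝ) :
    pairMax z - ∑ i, z i = ∑ i, ∑ j, if i = j then 0 else max (z i) (z j) := by
  rw [pairMax, ← Finset.sum_sub_distrib]
  refine Finset.sum_congr rfl fun i _ => ?_
  have : z i = ∑ j, if i = j then max (z i) (z j) else 0 := by simp
  nth_rw 2 [this]
  rw [← Finset.sum_sub_distrib]
  exact Finset.sum_congr rfl fun j _ => by split_ifs <;> simp

lemma two_mul_sum_mul_rank_le {ι : Type*} [Fintype ι] {n : ℕ} (z : ι → ℝ) (e : ι ≃ Fin n) :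
    2 * ∑ i, z i * ((e i : ℕ) : ℝ) ≤ pairMax z - ∑ i, z i := by
  classical
  rw [two_mul_sum_mul_rank, pairMax_sub_sum]
  refine Finset.sum_le_sum fun i _ => Finset.sum_le_sum fun j _ => ?_
  rcases eq_or_ne i j with rfl | hij
  · simp
  · rcases lt_or_gt_of_ne (e.injective.ne hij) with h | h <;> simp [h, hij, h.not_gt]

lemma exists_two_mul_sum_mul_rank_eq {ι : Type*} [Fintype ι] {n : ℕ} (hn : Fintype.card ι = n)
    (z : ι → ℝ) :
    ∃ e : ι ≃ Fin n, 2 * ∑ i, z i * ((e i : ℕ) : ℝ) = pairMax z - ∑ i, z i := by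
  classical
  let e₀ : ι ≃ Fin n := Fintype.equivFinOfCardEq hn
  let σ := Tuple.sort (z ∘ e₀.symm)
  let e : ι ≃ Fin n := e₀.trans σ.symm
  have hmono : ∀ i j, e i < e j → z i ≤ z j := by
    intro i j h
    have := Tuple.monotone_sort (z ∘ e₀.symm) h.le
    simpa [e, σ] using this
  refine ⟨e, ?_⟩
  rw [two_mul_sum_mul_rank, pairMax_sub_sum]
  refine Finset.sum_congr rfl fun i _ => Finset.sum_congr rfl fun j _ => ?_
  rcases eq_or_ne i j with rfl | hij
  · simp
  · rcases lt_or_gt_of_ne (e.injective.ne hij) with h | h <;>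
      simp [h, hij, h.not_gt, hmono _ _ h]

/-- Either the `σ`-orbit of `r₁` misses `r₂`, or composing `σ` with the transposition of `r₁`
and `r₂` splits the common cycle of these two points. -/
lemma exists_invariant_separating_s16 {ι : Type*} [Fintype ι] [DecidableEq ι] (σ : Equiv.Perm ι)
    {r₁ r₂ : ι} (hr : r₁ ≠ r₂) :
    ∃ T : Finset ι, r₁ ∈ T ∧ r₂ ∉ T ∧
      ((∀ i ∈ T, σ i ∈ T) ∨ ∀ i ∈ T, Equiv.swap r₁ r₂ (σ i) ∈ T) := by
  classical
  by_cases h : ∃ k : ℕ, (σ ^ k) r₁ = r₂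
  · have hk := Nat.find_spec h
    have hmin := fun j => Nat.find_min (H := h) (m := j)
    set k := Nat.find h
    have hk0 : 0 < k := by
      rcases Nat.eq_zero_or_pos k with h0 | h0
      · rw [h0] at hk; exact absurd (by simpa using hk) hr
      · exact h0
    refine ⟨(Finset.range k).image fun j => (σ ^ j) r₁, ?_, ?_, Or.inr ?_⟩
    · exact Finset.mem_image.2 ⟨0, by simpa using hk0, by simp⟩
    · intro hm
      obtain ⟨j, hj, hj'⟩ := Finset.mem_image.1 hm
      exact hmin j (Finset.mem_range.1 hj) hj'
    · intro i hi
      obtain ⟨j, hj, rfl⟩ := Finset.mem_image.1 hi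
      have hj := Finset.mem_range.1 hj
      rw [← Equiv.Perm.mul_apply σ, ← pow_succ']
      rcases (Nat.succ_le_of_lt hj).lt_or_eq with hlt | heq
      · have h2 : (σ ^ (j + 1)) r₁ ≠ r₂ := hmin _ hlt
        have h1 : (σ ^ (j + 1)) r₁ ≠ r₁ := by
          intro h1
          refine hmin (k - (j + 1)) (by omega) ?_
          have : (σ ^ (k - (j + 1) + (j + 1))) r₁ = r₂ := by
            rw [Nat.sub_add_cancel hlt.le]; exact hk
          rwa [pow_add, Equiv.Perm.mul_apply, h1] at this
        rw [Equiv.swap_apply_of_ne_of_ne h1 h2]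
        exact Finset.mem_image.2 ⟨j + 1, Finset.mem_range.2 hlt, rfl⟩
      · have : j + 1 = k := heq
        rw [this, hk, Equiv.swap_apply_right]
        exact Finset.mem_image.2 ⟨0, by simpa using hk0, by simp⟩
  · refine ⟨Finset.univ.filter fun i => ∃ k : ℕ, (σ ^ k) r₁ = i, ?_, ?_, Or.inl ?_⟩
    · simpa using ⟨0, by simp⟩
    · simpa using h
    · intro i hi
      obtain ⟨k, rfl⟩ := (Finset.mem_filter.1 hi).2
      refine Finset.mem_filter.2 ⟨Finset.mem_univ _, k + 1, ?_⟩
      rw [pow_succ', Equiv.Perm.mul_apply]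

lemma pairMax_comp {ι : Type*} [Fintype ι] (z : ι → ℝ) (σ : Equiv.Perm ι) :
    pairMax (z ∘ σ) = pairMax z := by
  simp only [pairMax, Function.comp_apply]
  rw [Equiv.sum_comp σ fun i => ∑ j, max (z i) (z (σ j))]
  exact Finset.sum_congr rfl fun i _ => Equiv.sum_comp σ fun j => max (z i) (z j)

lemma sum_piecewise_add_sum_piecewise {ι M : Type*} [Fintype ι] [DecidableEq ι] {α : ι → Type*}
    [AddCommMonoid M] (T : Finset ι) (x x' : ∀ i, α i) (b : ∀ i, α i → M) :
    ∑ i, b i (T.piecewise x' x i) + ∑ i, b i (T.piecewise x x' i) =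
      ∑ i, b i (x i) + ∑ i, b i (x' i) := by
  rw [← Finset.sum_add_distrib, ← Finset.sum_add_distrib]
  refine Finset.sum_congr rfl fun i _ => ?_
  by_cases hi : i ∈ T <;> simp [hi, add_comm]

lemma pairMax_add_le_of_invariant {ι : Type*} [Fintype ι] [DecidableEq ι] {n : ℕ}
    (z z' : ι → ℝ) (e e' : ι ≃ Fin n)
    (he : 2 * ∑ i, z i * ((e i : ℕ) : ℝ) = pairMax z - ∑ i, z i)
    (he' : 2 * ∑ i, z' i * ((e' i : ℕ) : ℝ) = pairMax z' - ∑ i, z' i)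
    (T : Finset ι) (hT : ∀ i ∈ T, e'.symm (e i) ∈ T) :
    pairMax z + pairMax z' ≤ pairMax (T.piecewise z' z) + pairMax (T.piecewise z z') := by
  have hT' : ∀ i, e'.symm (e i) ∈ T → i ∈ T := by
    intro i hi
    have himg : T.image (fun i => e'.symm (e i)) = T :=
      Finset.eq_of_subset_of_card_le (Finset.image_subset_iff.2 hT)
        (Finset.card_image_of_injective _ (e'.symm.injective.comp e.injective)).ge
    rw [← himg] at hi
    obtain ⟨j, hj, hji⟩ := Finset.mem_image.1 hi
    rwa [← e.injective (e'.symm.injective hji)]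
  have hn : Fintype.card ι = Fintype.card (Fin n) := Fintype.card_congr e
  have key : ∀ i ∈ T, ∀ j ∉ T, e i ≠ e' j := by
    intro i hi j hj h
    exact hj (by simpa [h] using hT i hi)
  have key' : ∀ i ∈ T, ∀ j ∉ T, e' i ≠ e j := by
    intro i hi j hj h
    exact hj (hT' j (by simpa [← h] using hi))
  have inj : Function.Injective (T.piecewise e' e) := by
    intro i j h
    by_cases hi : i ∈ T <;> by_cases hj : j ∈ T <;> simp [hi, hj] at h
    · exact h
    · exact absurd h (key' i hi j hj)
    · exact absurd h.symm (key' j hj i hi)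
    · exact h
  have inj' : Function.Injective (T.piecewise e e') := by
    intro i j h
    by_cases hi : i ∈ T <;> by_cases hj : j ∈ T <;> simp [hi, hj] at h
    · exact h
    · exact absurd h (key i hi j hj)
    · exact absurd h.symm (key j hj i hi)
    · exact h
  have h₁ := two_mul_sum_mul_rank_le (T.piecewise z' z)
    (Equiv.ofBijective _ ((Fintype.bijective_iff_injective_and_card _).2 ⟨inj, hn⟩))
  have h₂ := two_mul_sum_mul_rank_le (T.piecewise z z')
    (Equiv.ofBijective _ ((Fintype.bijective_iff_injective_and_card _).2 ⟨inj', hn⟩))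
  simp only [Equiv.ofBijective_apply] at h₁ h₂
  have hs := sum_piecewise_add_sum_piecewise T z z' (fun _ x => x)
  have hs' := sum_piecewise_add_sum_piecewise T (fun i => z i * ((e i : ℕ) : ℝ))
    (fun i => z' i * ((e' i : ℕ) : ℝ)) (fun _ x => x)
  have t₁ : ∑ i, T.piecewise z' z i * ((T.piecewise e' e i : ℕ) : ℝ) =
      ∑ i, T.piecewise (fun i => z' i * ((e' i : ℕ) : ℝ)) (fun i => z i * ((e i : ℕ) : ℝ)) i :=
    Finset.sum_congr rfl fun i _ => by by_cases hi : i ∈ T <;> simp [hi]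
  have t₂ : ∑ i, T.piecewise z z' i * ((T.piecewise e e' i : ℕ) : ℝ) =
      ∑ i, T.piecewise (fun i => z i * ((e i : ℕ) : ℝ)) (fun i => z' i * ((e' i : ℕ) : ℝ)) i :=
    Finset.sum_congr rfl fun i _ => by by_cases hi : i ∈ T <;> simp [hi]
  rw [t₁] at h₁
  rw [t₂] at h₂
  linarith

lemma exists_separating_pairMax_le {ι : Type*} [Fintype ι] [DecidableEq ι] (z z' : ι → ℝ)
    {r₁ r₂ : ι} (hr : r₁ ≠ r₂) :
    ∃ T : Finset ι, r₁ ∈ T ∧ r₂ ∉ T ∧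
      (pairMax z + pairMax z' ≤ pairMax (T.piecewise z' z) + pairMax (T.piecewise z z') ∨
        pairMax z + pairMax z' ≤ pairMax (T.piecewise (z' ∘ Equiv.swap r₁ r₂) z) +
          pairMax (T.piecewise z (z' ∘ Equiv.swap r₁ r₂))) := by
  obtain ⟨e, he⟩ := exists_two_mul_sum_mul_rank_eq rfl z
  obtain ⟨e', he'⟩ := exists_two_mul_sum_mul_rank_eq rfl z'
  obtain ⟨T, h₁, h₂, hT | hT⟩ := exists_invariant_separating_s16 (e.trans e'.symm) hr
  · exact ⟨T, h₁, h₂, Or.inl (pairMax_add_le_of_invariant z z' e e' he he' T hT)⟩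
  · refine ⟨T, h₁, h₂, Or.inr ?_⟩
    rw [← pairMax_comp z' (Equiv.swap r₁ r₂)]
    refine pairMax_add_le_of_invariant z _ e ((Equiv.swap r₁ r₂).trans e') he ?_ T ?_
    · rw [pairMax_comp]
      simp only [Function.comp_apply, Equiv.trans_apply]
      rw [Equiv.sum_comp (Equiv.swap r₁ r₂) fun i => z' i * ((e' i : ℕ) : ℝ),
        Equiv.sum_comp (Equiv.swap r₁ r₂) z', he']
    · intro i hi
      simpa [Equiv.symm_trans_apply] using hT i hi

/-- The energy of a row configuration `y` completed by two extra values. -/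
lemma pairMax_sumElim {N : ℕ} (y : Fin N → ℝ) (v : Bool → ℝ) :
    pairMax (Sum.elim y v) = pairMax y + 2 * ∑ i, max 0 (y i - v true) +
      2 * ∑ i, max 0 (y i - v false) + 2 * N * (v true + v false) + v true + v false +
      2 * max (v true) (v false) := by
  have h (a x : ℝ) : max x a = max 0 (x - a) + a := by
    rw [← max_add_add_right]; simp [max_comm]
  simp only [pairMax, Fintype.sum_sum_type, Sum.elim_inl, Sum.elim_inr, Fintype.sum_bool,
    Finset.sum_add_distrib, max_self, max_comm (v _) (y _), h _ (y _), Finset.sum_const,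
    Finset.card_univ, Fintype.card_fin, nsmul_eq_mul, max_comm (v false) (v true)]
  ring

lemma piecewise_sumElim {α β γ : Type*} [DecidableEq α] [DecidableEq β]
    (T : Finset (α ⊕ β)) (y y' : α → γ) (v v' : β → γ) :
    T.piecewise (Sum.elim y v) (Sum.elim y' v') =
      Sum.elim (T.toLeft.piecewise y y') (T.toRight.piecewise v v') := by
  funext x
  rcases x with i | b
  · by_cases h : Sum.inl i ∈ T <;> simp [Finset.piecewise, h]
  · by_cases h : Sum.inr b ∈ T <;> simp [Finset.piecewise, h]

/-- The energy of a pair of configurations, with one external value `b` on the first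
and two external values `b'`, `b''` on the second. -/
noncomputable def pairEnergy {ι : Type*} [Fintype ι] (b b' b'' : ℝ) (y y' : ι → ℝ) : ℝ :=
  pairMax y + pairMax y' + 2 * ∑ i, max 0 (y i - b) +
    2 * ∑ i, (max 0 (y' i - b') + max 0 (y' i - b''))

lemma exists_exchange_le {N : ℕ} {a₁ a₂ a₃ : ℝ} (h₁₂ : a₂ ≤ a₁) (h₂₃ : a₃ ≤ a₂)
    (y y' : Fin N → ℝ) :
    ∃ T : Finset (Fin N),
      pairEnergy a₂ a₁ a₃ y y' - 2 * a₂ ≤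
        pairEnergy a₁ a₂ a₃ (T.piecewise y y') (T.piecewise y' y) - 2 * a₁ ∨
      pairEnergy a₂ a₁ a₃ y y' ≤
        pairEnergy a₃ a₁ a₂ (T.piecewise y y') (T.piecewise y' y) := by
  unfold pairEnergy
  obtain ⟨a₀, h₀, hy, hy'⟩ : ∃ a₀, a₁ ≤ a₀ ∧ (∀ i, y i ≤ a₀) ∧ ∀ i, y' i ≤ a₀ := by
    obtain ⟨B, hB⟩ := (Set.finite_range y).bddAbove
    obtain ⟨B', hB'⟩ := (Set.finite_range y').bddAbove
    exact ⟨a₁ ⊔ (B ⊔ B'), le_sup_left,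
      fun i => (hB ⟨i, rfl⟩).trans (le_sup_left.trans le_sup_right),
      fun i => (hB' ⟨i, rfl⟩).trans (le_sup_right.trans le_sup_right)⟩
  have hzero (x : Fin N → ℝ) (hx : ∀ i, x i ≤ a₀) : ∑ i, max 0 (x i - a₀) = 0 :=
    Finset.sum_eq_zero fun i _ => max_eq_left (by linarith [hx i])
  obtain ⟨T, hT₁, hT₂, hT⟩ := exists_separating_pairMax_le
    (Sum.elim y fun b => cond b a₀ a₂) (Sum.elim y' fun b => cond b a₁ a₃)
    (r₁ := Sum.inr true) (r₂ := Sum.inr false) (by simp)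
  have hpw : ∀ i, T.toLeft.piecewise y y' i ≤ a₀ := fun i => by
    by_cases hi : i ∈ T.toLeft <;> simp only [Finset.piecewise, hi, if_true, if_false, hy, hy']
  have hswap : (Sum.elim y' fun b => cond b a₁ a₃) ∘
      Equiv.swap (Sum.inr true : Fin N ⊕ Bool) (Sum.inr false) =
      Sum.elim y' fun b => cond b a₃ a₁ := by
    funext x
    rcases x with i | _ | _ <;> simp [Equiv.swap_apply_of_ne_of_ne]
  refine ⟨T.toLeft, hT.symm.imp (fun h => ?_) fun h => ?_⟩
  · rw [hswap] at h
    simp only [piecewise_sumElim, pairMax_sumElim, Finset.piecewise, Finset.mem_toRight, hT₁, hT₂,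
      if_true, if_false, cond_true, cond_false] at h
    rw [hzero _ hy, max_eq_left (h₂₃.trans h₁₂), max_eq_left (h₁₂.trans h₀),
      max_eq_right h₂₃, max_eq_left h₀] at h
    have := hzero _ hpw
    simp only [Finset.piecewise, Finset.sum_add_distrib] at h this ⊢
    linarith
  · simp only [piecewise_sumElim, pairMax_sumElim, Finset.piecewise, Finset.mem_toRight, hT₁, hT₂,
      if_true, if_false, cond_true, cond_false] at h
    rw [hzero _ hy, max_eq_left (h₂₃.trans h₁₂), max_eq_left (h₁₂.trans h₀),
      max_eq_left h₁₂, max_eq_left ((h₂₃.trans h₁₂).trans h₀)] at h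
    have := hzero _ hpw
    simp only [Finset.piecewise, Finset.sum_add_distrib] at h this ⊢
    linarith

/-- The number `a` clamped to the interval `[-x, x]`. -/
noncomputable def clampTo (a x : ℝ) : ℝ := max (-x) (min a x)

lemma clampTo_increment_mono {a b q x : ℝ} (hab : a ≤ b) (hq : 0 ≤ q) (hqx : q ≤ x) :
    clampTo a x - clampTo a q ≤ clampTo b x - clampTo b q := by
  unfold clampTo
  rcases max_cases (-x) (min a x) with h₁ | h₁ <;> rcases min_cases a x with h₂ | h₂ <;>
  rcases max_cases (-q) (min a q) with h₃ | h₃ <;> rcases min_cases a q with h₄ | h₄ <;>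
  rcases max_cases (-x) (min b x) with h₅ | h₅ <;> rcases min_cases b x with h₆ | h₆ <;>
  rcases max_cases (-q) (min b q) with h₇ | h₇ <;> rcases min_cases b q with h₈ | h₈ <;>
  linarith

lemma clampTo_increment_le {a q x : ℝ} (hq : 0 ≤ q) (hqx : q ≤ x) :
    clampTo a x - clampTo a q ≤ x - q := by
  unfold clampTo
  rcases max_cases (-x) (min a x) with h₁ | h₁ <;> rcases min_cases a x with h₂ | h₂ <;>
  rcases max_cases (-q) (min a q) with h₃ | h₃ <;> rcases min_cases a q with h₄ | h₄ <;>
  linarith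

lemma neg_le_clampTo_increment {a q x : ℝ} (hq : 0 ≤ q) (hqx : q ≤ x) :
    -(x - q) ≤ clampTo a x - clampTo a q := by
  unfold clampTo
  rcases max_cases (-x) (min a x) with h₁ | h₁ <;> rcases min_cases a x with h₂ | h₂ <;>
  rcases max_cases (-q) (min a q) with h₃ | h₃ <;> rcases min_cases a q with h₄ | h₄ <;>
  linarith

lemma clampTo_sub_le {a b x : ℝ} (hab : a ≤ b) (hx : 0 ≤ x) :
    clampTo b x - clampTo a x ≤ b - a := by
  unfold clampTo
  rcases max_cases (-x) (min a x) with h₁ | h₁ <;> rcases min_cases a x with h₂ | h₂ <;>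
  rcases max_cases (-x) (min b x) with h₃ | h₃ <;> rcases min_cases b x with h₄ | h₄ <;>
  linarith

lemma clampTo_zero (a : ℝ) : clampTo a 0 = 0 := by
  unfold clampTo
  rcases max_cases (-0) (min a 0) with h₁ | h₁ <;> rcases min_cases a 0 with h₂ | h₂ <;> linarith

/-- The part of the energy of a pair of configurations that depends on the relative signs `d`. -/
noncomputable def signEnergy {ι : Type*} (P : ι → ℝ) (g : ℝ → ℝ) (s : Finset ι) (d : ι → ℤ) : ℝ :=
  -(∑ i ∈ s, ∑ j ∈ s, (d i : ℝ) * d j * min (P i) (P j)) - ∑ i ∈ s, (d i : ℝ) * g (P i)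

lemma signEnergy_insert {ι : Type*} [DecidableEq ι] (P : ι → ℝ) (g : ℝ → ℝ) {s : Finset ι}
    (d : ι → ℤ) {a : ι} (ha : a ∉ s) (hP : ∀ x ∈ s, P a ≤ P x) :
    signEnergy P g (insert a s) d + P a * ((∑ i ∈ insert a s, d i : ℤ) : ℝ) ^ 2 +
        ((∑ i ∈ insert a s, d i : ℤ) : ℝ) * g (P a) =
      signEnergy P g s d + P a * ((∑ i ∈ s, d i : ℤ) : ℝ) ^ 2 +
        ((∑ i ∈ s, d i : ℤ) : ℝ) * g (P a) := by
  have h₁ : ∑ j ∈ s, (d a : ℝ) * d j * min (P a) (P j) = d a * P a * ∑ j ∈ s, (d j : ℝ) := by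
    rw [Finset.mul_sum]
    exact Finset.sum_congr rfl fun j hj => by rw [min_eq_left (hP j hj)]; ring
  have h₂ : ∑ j ∈ s, (d j : ℝ) * d a * min (P j) (P a) = d a * P a * ∑ j ∈ s, (d j : ℝ) := by
    rw [Finset.mul_sum]
    exact Finset.sum_congr rfl fun j hj => by rw [min_eq_right (hP j hj)]; ring
  simp only [signEnergy, Finset.sum_insert ha, Finset.sum_add_distrib, h₁, h₂, min_self]
  push_cast
  ring

lemma exists_alternating_signs {ι : Type*} [DecidableEq ι] (P : ι → ℝ) (hP : ∀ i, 0 ≤ P i)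
    (d : ι → ℤ) (hd : ∀ i, d i = 0 ∨ d i = 1 ∨ d i = -1) (g g' C : ℝ → ℝ)
    (hC : ∀ x, 0 ≤ x → 0 ≤ C x)
    (hg : ∀ q x : ℝ, 0 ≤ q → q ≤ x → ∀ X X' : ℤ, (X' = 0 ∨ X' = -1) → (2 : ℤ) ∣ X - X' →
      (x - q) * (X' : ℝ) ^ 2 + X' * (g' x - g' q) + (C x - C q) ≤
        (x - q) * (X : ℝ) ^ 2 + X * (g x - g q))
    (s : Finset ι) :
    ∃ d' : ι → ℤ, (∀ i, d' i = d i ∨ d' i = -d i) ∧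
      ((∑ i ∈ s, d' i) = 0 ∨ (∑ i ∈ s, d' i) = -1) ∧ (2 : ℤ) ∣ (∑ i ∈ s, d i) - ∑ i ∈ s, d' i ∧
      ∀ q, 0 ≤ q → (∀ x ∈ s, q ≤ P x) →
        signEnergy P g s d + q * ((∑ i ∈ s, d i : ℤ) : ℝ) ^ 2 + ((∑ i ∈ s, d i : ℤ) : ℝ) * g q ≤
          signEnergy P g' s d' + q * ((∑ i ∈ s, d' i : ℤ) : ℝ) ^ 2 +
            ((∑ i ∈ s, d' i : ℤ) : ℝ) * g' q + C q := by
  induction s using Finset.induction_on_min_value P with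
  | empty => exact ⟨d, fun _ => Or.inl rfl, by simp, by simp, fun q hq _ => by
      simpa [signEnergy] using hC q hq⟩
  | insert a s ha hmin ih =>
    obtain ⟨d', hd', hX', hpar, hle⟩ := ih
    obtain ⟨t, ht, hXt, hpart⟩ : ∃ t : ℤ, (t = d a ∨ t = -d a) ∧
        (t + ∑ i ∈ s, d' i = 0 ∨ t + ∑ i ∈ s, d' i = -1) ∧
        (2 : ℤ) ∣ (d a + ∑ i ∈ s, d i) - (t + ∑ i ∈ s, d' i) := by
      rcases hd a with h | h | h
      · exact ⟨0, by omega, by omega, by omega⟩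
      · rcases hX' with h' | h'
        · exact ⟨-1, by omega, by omega, by omega⟩
        · exact ⟨1, by omega, by omega, by omega⟩
      · rcases hX' with h' | h'
        · exact ⟨-1, by omega, by omega, by omega⟩
        · exact ⟨1, by omega, by omega, by omega⟩
    have hupd : ∀ i ∈ s, Function.update d' a t i = d' i := fun i hi =>
      Function.update_of_ne (ne_of_mem_of_not_mem hi ha) _ _
    have hsum : ∑ i ∈ insert a s, Function.update d' a t i = t + ∑ i ∈ s, d' i := by
      rw [Finset.sum_insert ha, Function.update_self, Finset.sum_congr rfl hupd]
    have hsumd : ∑ i ∈ insert a s, d i = d a + ∑ i ∈ s, d i := Finset.sum_insert ha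
    have henergy : signEnergy P g' s (Function.update d' a t) = signEnergy P g' s d' := by
      unfold signEnergy
      congr 1
      · congr 1
        exact Finset.sum_congr rfl fun i hi => Finset.sum_congr rfl fun j hj => by
          rw [hupd i hi, hupd j hj]
      · exact Finset.sum_congr rfl fun i hi => by rw [hupd i hi]
    refine ⟨Function.update d' a t, fun i => ?_, by rwa [hsum], by rwa [hsum, hsumd], ?_⟩
    · rcases eq_or_ne i a with rfl | hia
      · simpa using ht
      · simpa [hia] using hd' i
    · intro q hq hqP
      have hqa := hqP a (Finset.mem_insert_self a s)
      have h₀ := hle (P a) (hP a) hmin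
      have h₁ := signEnergy_insert P g d ha hmin
      have h₂ := signEnergy_insert P g' (Function.update d' a t) ha hmin
      rw [henergy, Finset.sum_congr rfl hupd, hsum] at h₂
      rw [hsumd] at h₁
      have h₃ := hg q (P a) hq hqa _ _ hXt hpart
      rw [hsum, hsumd]
      linarith

lemma parity_quadratic_bounds {X X' : ℤ} (h : (2 : ℤ) ∣ X - X') (hX' : X' = 0 ∨ X' = -1) :
    0 ≤ (X : ℝ) ^ 2 + 2 * X - X' ∧ 0 ≤ (X : ℝ) ^ 2 - 2 * X - X' ∧ 0 ≤ (X : ℝ) ^ 2 + X' := by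
  obtain ⟨k, hk⟩ := h
  obtain rfl : X = X' + 2 * k := by omega
  have hk : 0 ≤ k * (k + 1) := by rcases le_or_gt 0 k with h | h <;> nlinarith
  have hk' : 0 ≤ k * (k - 1) := by rcases le_or_gt 1 k with h | h <;> nlinarith
  refine ⟨?_, ?_, ?_⟩ <;> norm_cast <;> rcases hX' with rfl | rfl <;> nlinarith

lemma max_zero_sub_eq {a P : ℝ} (hP : 0 ≤ P) :
    max 0 (P - a) = (max 0 (P - a) + max 0 (-P - a)) / 2 + (P - clampTo a P) / 2 ∧
    max 0 (-P - a) = (max 0 (P - a) + max 0 (-P - a)) / 2 - (P - clampTo a P) / 2 := by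
  unfold clampTo
  rcases max_cases (-P) (min a P) with h₁ | h₁ <;> rcases min_cases a P with h₂ | h₂ <;>
  rcases max_cases 0 (P - a) with h₃ | h₃ <;> rcases max_cases 0 (-P - a) with h₄ | h₄ <;>
  constructor <;> linarith

/-- `(y, y')` is a pair of numbers of absolute value `P` with relative sign `d`. -/
def IsSignPair (P y y' : ℝ) (d : ℤ) : Prop :=
  (d = 0 ∧ y' = y ∧ (y = P ∨ y = -P)) ∨ (d = 1 ∧ y = P ∧ y' = -P) ∨ (d = -1 ∧ y = -P ∧ y' = P)

lemma IsSignPair.swap {P y y' : ℝ} {d : ℤ} (h : IsSignPair P y y' d) :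
    IsSignPair P y' y (-d) := by
  rcases h with ⟨rfl, rfl, h⟩ | ⟨rfl, rfl, rfl⟩ | ⟨rfl, rfl, rfl⟩
  · exact Or.inl ⟨rfl, rfl, h⟩
  · exact Or.inr (Or.inr ⟨rfl, rfl, rfl⟩)
  · exact Or.inr (Or.inl ⟨rfl, rfl, rfl⟩)

lemma exists_isSignPair {y y' : ℝ} (h : y' = y ∨ y' = -y) : ∃ d, IsSignPair |y| y y' d := by
  rcases h with rfl | rfl
  · exact ⟨0, Or.inl ⟨rfl, rfl, by rcases abs_choice y' with h | h <;> simp [h]⟩⟩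
  · rcases abs_choice y with h | h
    · exact ⟨1, Or.inr (Or.inl ⟨rfl, h.symm, by rw [h]⟩)⟩
    · exact ⟨-1, Or.inr (Or.inr ⟨rfl, by rw [h, neg_neg], h.symm⟩)⟩

lemma max_add_max_neg {P₁ P₂ : ℝ} (hP₁ : 0 ≤ P₁) (hP₂ : 0 ≤ P₂) :
    max P₁ P₂ + max (-P₁) (-P₂) = max P₁ (-P₂) + max (-P₁) P₂ - 2 * min P₁ P₂ := by
  rw [max_eq_left (show -P₂ ≤ P₁ by linarith), max_eq_right (show -P₁ ≤ P₂ by linarith),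
    max_neg_neg]
  linarith [max_add_min P₁ P₂]

lemma IsSignPair.max_add_max {P₁ P₂ y₁ y₁' y₂ y₂' : ℝ} {d₁ d₂ : ℤ} (hP₁ : 0 ≤ P₁) (hP₂ : 0 ≤ P₂)
    (h₁ : IsSignPair P₁ y₁ y₁' d₁) (h₂ : IsSignPair P₂ y₂ y₂' d₂) :
    max y₁ y₂ + max y₁' y₂' =
      (max y₁ y₂ + max y₁ y₂' + max y₁' y₂ + max y₁' y₂') / 2 -
        (d₁ : ℝ) * d₂ * min P₁ P₂ := by
  have key := max_add_max_neg hP₁ hP₂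
  rcases h₁ with ⟨rfl, rfl, rfl | rfl⟩ | ⟨rfl, rfl, rfl⟩ | ⟨rfl, rfl, rfl⟩ <;>
  rcases h₂ with ⟨rfl, rfl, rfl | rfl⟩ | ⟨rfl, rfl, rfl⟩ | ⟨rfl, rfl, rfl⟩ <;>
  push_cast <;> linarith

lemma IsSignPair.hinge_sum {P y y' b b' b'' : ℝ} {d : ℤ} (hP : 0 ≤ P)
    (h : IsSignPair P y y' d) :
    2 * (max 0 (y - b) + (max 0 (y' - b') + max 0 (y' - b''))) =
      max 0 (y - b) + max 0 (y - b') + max 0 (y - b'') +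
        (max 0 (y' - b) + max 0 (y' - b') + max 0 (y' - b'')) -
        d * (P + clampTo b P - clampTo b' P - clampTo b'' P) := by
  have h₁ := max_zero_sub_eq (a := b) hP
  have h₂ := max_zero_sub_eq (a := b') hP
  have h₃ := max_zero_sub_eq (a := b'') hP
  rcases h with ⟨rfl, rfl, -⟩ | ⟨rfl, rfl, rfl⟩ | ⟨rfl, rfl, rfl⟩ <;> push_cast <;> linarith

lemma pairEnergy_eq {ι : Type*} [Fintype ι] {P y y' : ι → ℝ} {d : ι → ℤ} (hP : ∀ i, 0 ≤ P i)
    (h : ∀ i, IsSignPair (P i) (y i) (y' i) (d i)) (b b' b'' : ℝ) :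
    pairEnergy b b' b'' y y' =
      ∑ i, ∑ j, (max (y i) (y j) + max (y i) (y' j) + max (y' i) (y j) + max (y' i) (y' j)) / 2 +
      ∑ i, (max 0 (y i - b) + max 0 (y i - b') + max 0 (y i - b'') +
        (max 0 (y' i - b) + max 0 (y' i - b') + max 0 (y' i - b''))) +
      signEnergy P (fun x => x + clampTo b x - clampTo b' x - clampTo b'' x) Finset.univ d := by
  have h₁ : pairMax y + pairMax y' =
      ∑ i, ∑ j, (max (y i) (y j) + max (y i) (y' j) + max (y' i) (y j) + max (y' i) (y' j)) / 2 -
      ∑ i, ∑ j, (d i : ℝ) * d j * min (P i) (P j) := by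
    simp only [pairMax, ← Finset.sum_add_distrib, ← Finset.sum_sub_distrib]
    exact Finset.sum_congr rfl fun i _ => Finset.sum_congr rfl fun j _ =>
      (h i).max_add_max (hP i) (hP j) (h j)
  have h₂ : 2 * ∑ i, max 0 (y i - b) + 2 * ∑ i, (max 0 (y' i - b') + max 0 (y' i - b'')) =
      ∑ i, (max 0 (y i - b) + max 0 (y i - b') + max 0 (y i - b'') +
        (max 0 (y' i - b) + max 0 (y' i - b') + max 0 (y' i - b''))) -
      ∑ i, (d i : ℝ) * (P i + clampTo b (P i) - clampTo b' (P i) - clampTo b'' (P i)) := by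
    rw [← mul_add, ← Finset.sum_add_distrib, Finset.mul_sum, ← Finset.sum_sub_distrib]
    exact Finset.sum_congr rfl fun i _ => (h i).hinge_sum (hP i)
  unfold pairEnergy signEnergy
  linarith

lemma exists_pairEnergy_le {ι : Type*} [Fintype ι] [DecidableEq ι] {y y' : ι → ℝ}
    (hy : ∀ i, y' i = y i ∨ y' i = -y i) {a a' a'' b b' b'' : ℝ}
    (hab : ∀ x : ℝ, max 0 (x - b) + max 0 (x - b') + max 0 (x - b'') =
      max 0 (x - a) + max 0 (x - a') + max 0 (x - a'')) (C : ℝ → ℝ)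
    (hC : ∀ x, 0 ≤ x → 0 ≤ C x)
    (hg : ∀ q x : ℝ, 0 ≤ q → q ≤ x → ∀ X X' : ℤ, (X' = 0 ∨ X' = -1) → (2 : ℤ) ∣ X - X' →
      (x - q) * (X' : ℝ) ^ 2 + X' * ((x + clampTo a x - clampTo a' x - clampTo a'' x) -
          (q + clampTo a q - clampTo a' q - clampTo a'' q)) + (C x - C q) ≤
        (x - q) * (X : ℝ) ^ 2 + X * ((x + clampTo b x - clampTo b' x - clampTo b'' x) -
          (q + clampTo b q - clampTo b' q - clampTo b'' q))) :
    ∃ T : Finset ι, pairEnergy b b' b'' y y' ≤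
      pairEnergy a a' a'' (T.piecewise y' y) (T.piecewise y y') + C 0 := by
  choose d hd using fun i => exists_isSignPair (hy i)
  have hP : ∀ i, 0 ≤ |y i| := fun i => abs_nonneg _
  obtain ⟨d', hd', -, -, hle⟩ := exists_alternating_signs (fun i => |y i|) hP d
    (fun i => by rcases hd i with h | h | h <;> simp [h.1]) _ _ C hC hg Finset.univ
  have hle := hle 0 le_rfl fun i _ => hP i
  refine ⟨Finset.univ.filter fun i => d' i ≠ d i, ?_⟩
  set T := Finset.univ.filter fun i => d' i ≠ d i with hT
  have hswap : ∀ i, (T.piecewise y' y i = y i ∧ T.piecewise y y' i = y' i ∧ d' i = d i) ∨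
      (T.piecewise y' y i = y' i ∧ T.piecewise y y' i = y i ∧ d' i = -d i) := by
    intro i
    by_cases hi : d' i = d i
    · exact Or.inl (by simp [hT, hi])
    · have hiT : i ∈ T := by simp [hT, hi]
      exact Or.inr ⟨by simp [hiT], by simp [hiT], (hd' i).resolve_left hi⟩
  have hpair : ∀ i, IsSignPair |y i| (T.piecewise y' y i) (T.piecewise y y' i) (d' i) := by
    intro i
    rcases hswap i with ⟨h₁, h₂, h₃⟩ | ⟨h₁, h₂, h₃⟩ <;> rw [h₁, h₂, h₃]
    exacts [hd i, (hd i).swap]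
  rw [pairEnergy_eq hP hd, pairEnergy_eq hP hpair]
  simp only [clampTo_zero, zero_mul, add_zero, sub_zero, mul_zero] at hle
  have e₁ : ∑ i, ∑ j, (max (y i) (y j) + max (y i) (y' j) + max (y' i) (y j) +
        max (y' i) (y' j)) / 2 =
      ∑ i, ∑ j, (max (T.piecewise y' y i) (T.piecewise y' y j) +
        max (T.piecewise y' y i) (T.piecewise y y' j) +
        max (T.piecewise y y' i) (T.piecewise y' y j) +
        max (T.piecewise y y' i) (T.piecewise y y' j)) / 2 := by
    refine Finset.sum_congr rfl fun i _ => Finset.sum_congr rfl fun j _ => ?_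
    rcases hswap i with ⟨h₁, h₂, -⟩ | ⟨h₁, h₂, -⟩ <;>
      rcases hswap j with ⟨h₃, h₄, -⟩ | ⟨h₃, h₄, -⟩ <;> rw [h₁, h₂, h₃, h₄] <;> ring
  have e₂ : ∑ i, (max 0 (y i - b) + max 0 (y i - b') + max 0 (y i - b'') +
        (max 0 (y' i - b) + max 0 (y' i - b') + max 0 (y' i - b''))) =
      ∑ i, (max 0 (T.piecewise y' y i - a) + max 0 (T.piecewise y' y i - a') +
        max 0 (T.piecewise y' y i - a'') + (max 0 (T.piecewise y y' i - a) +
        max 0 (T.piecewise y y' i - a') + max 0 (T.piecewise y y' i - a''))) := by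
    refine Finset.sum_congr rfl fun i _ => ?_
    rw [hab, hab]
    rcases hswap i with ⟨h₁, h₂, -⟩ | ⟨h₁, h₂, -⟩ <;> rw [h₁, h₂]
    ring
  rw [e₁, e₂]
  linarith

lemma exists_pairEnergy_first_le {ι : Type*} [Fintype ι] [DecidableEq ι] {a₁ a₂ a₃ : ℝ}
    (h₁₂ : a₂ ≤ a₁) (h₂₃ : a₃ ≤ a₂) {y y' : ι → ℝ} (hy : ∀ i, y' i = y i ∨ y' i = -y i) :
    ∃ T : Finset ι, pairEnergy a₁ a₂ a₃ y y' ≤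
      pairEnergy a₂ a₁ a₃ (T.piecewise y' y) (T.piecewise y y') + 2 * (a₁ - a₂) := by
  refine (exists_pairEnergy_le (a := a₂) (a' := a₁) (a'' := a₃) (b := a₁) (b' := a₂) (b'' := a₃)
    hy (by intro x; ring)
    (fun x => 2 * (a₁ - a₂) - 2 * (clampTo a₁ x - clampTo a₂ x))
    (fun x hx => by linarith [clampTo_sub_le h₁₂ hx]) ?_).imp
    fun T hT => by simpa [clampTo_zero] using hT
  intro q x hq hqx X X' hX' hpar
  have m₁ := sub_nonneg.2 (clampTo_increment_mono h₁₂ hq hqx)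
  have m₂ := sub_nonneg.2 (clampTo_increment_mono h₂₃ hq hqx)
  have m₃ := sub_nonneg.2 (clampTo_increment_le (a := a₁) hq hqx)
  have m₄ := sub_nonneg.2 (neg_le_clampTo_increment (a := a₃) hq hqx)
  obtain ⟨q₁, -, q₃⟩ := parity_quadratic_bounds hpar hX'
  have hX'2 : (X' : ℝ) ^ 2 = -X' := by rcases hX' with rfl | rfl <;> norm_num
  rw [hX'2]
  have q₄ : 0 ≤ (X : ℝ) ^ 2 + 4 * X + 4 + X' := by
    have := (parity_quadratic_bounds (X := X + 2) (X' := X') (by omega) hX').2.2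
    push_cast at this
    linarith
  linarith [mul_nonneg m₁ q₄, mul_nonneg m₂ q₁, mul_nonneg m₃ q₁, mul_nonneg m₄ q₃]

lemma exists_pairEnergy_last_le {ι : Type*} [Fintype ι] [DecidableEq ι] {a₁ a₂ a₃ : ℝ}
    (h₁₂ : a₂ ≤ a₁) (h₂₃ : a₃ ≤ a₂) {y y' : ι → ℝ} (hy : ∀ i, y' i = y i ∨ y' i = -y i) :
    ∃ T : Finset ι, pairEnergy a₃ a₁ a₂ y y' ≤
      pairEnergy a₂ a₁ a₃ (T.piecewise y' y) (T.piecewise y y') := by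
  refine (exists_pairEnergy_le (a := a₂) (a' := a₁) (a'' := a₃) (b := a₃) (b' := a₁) (b'' := a₂)
    hy (by intro x; ring) (fun _ => 0) (fun _ _ => le_rfl) ?_).imp
    fun T hT => by simpa using hT
  intro q x hq hqx X X' hX' hpar
  have m₁ := sub_nonneg.2 (clampTo_increment_mono h₁₂ hq hqx)
  have m₂ := sub_nonneg.2 (clampTo_increment_mono h₂₃ hq hqx)
  have m₃ := sub_nonneg.2 (clampTo_increment_le (a := a₁) hq hqx)
  have m₄ := sub_nonneg.2 (neg_le_clampTo_increment (a := a₃) hq hqx)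
  obtain ⟨q₁, q₂, q₃⟩ := parity_quadratic_bounds hpar hX'
  have hX'2 : (X' : ℝ) ^ 2 = -X' := by rcases hX' with rfl | rfl <;> norm_num
  rw [hX'2]
  linarith [mul_nonneg m₁ q₃, mul_nonneg m₂ q₂, mul_nonneg m₃ q₁, mul_nonneg m₄ q₃]

/-- The slopes selected by a choice of signs. -/
def signedSlope {N : ℕ} (p : Fin N → ℝ) (ε : Fin N → Bool) (i : Fin N) : ℝ :=
  cond (ε i) (p i) (-p i)

lemma signedSlope_piecewise {N : ℕ} (p : Fin N → ℝ) (T : Finset (Fin N)) (ε ε' : Fin N → Bool) :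
    signedSlope p (T.piecewise ε ε') = T.piecewise (signedSlope p ε) (signedSlope p ε') := by
  funext i
  by_cases hi : i ∈ T <;> simp [signedSlope, hi]

/-- The summand of row `i` in the soliton expansion of `tauKP`, apart from the interactions. -/
noncomputable def rowPhase {N : ℕ} (a₁ a₂ a₃ : ℝ) (p c c' : Fin N → ℝ) (s l m n : ℤ)
    (i : Fin N) (β : Bool) : ℝ :=
  cond β (p i) (-p i) * (s - 1 / 2) + max 0 (cond β (p i) (-p i) - a₁) * l +
    max 0 (cond β (p i) (-p i) - a₂) * m + max 0 (cond β (p i) (-p i) - a₃) * n +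
    cond β (c i) (c' i)

/-- The term of the soliton expansion of `tauKP` attached to a choice of signs. -/
noncomputable def tauTerm {N : ℕ} (a₁ a₂ a₃ : ℝ) (p c c' : Fin N → ℝ) (s l m n : ℤ)
    (ε : Fin N → Bool) : ℝ :=
  ∑ i, rowPhase a₁ a₂ a₃ p c c' s l m n i (ε i) + pairMax (signedSlope p ε) / 2

lemma sum_rowPhase_add {N : ℕ} (a₁ a₂ a₃ : ℝ) (p c c' : Fin N → ℝ) (s l m n : ℤ)
    (ε : Fin N → Bool) (e : Fin N → Fin N) :
    ∑ i, (rowPhase a₁ a₂ a₃ p c c' s l m n i (ε i) + signedSlope p ε i / 2 +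
        signedSlope p ε i * ((e i : ℕ) : ℝ)) =
      tauTerm a₁ a₂ a₃ p c c' s l m n ε + (2 * ∑ i, signedSlope p ε i * ((e i : ℕ) : ℝ) -
        (pairMax (signedSlope p ε) - ∑ i, signedSlope p ε i)) / 2 := by
  simp only [tauTerm, Finset.sum_add_distrib, ← Finset.sum_div]
  ring

lemma tauTerm_le_tauKP {N : ℕ} (a₁ a₂ a₃ : ℝ) (p c c' : Fin N → ℝ) (s l m n : ℤ)
    (ε : Fin N → Bool) :
    tauTerm a₁ a₂ a₃ p c c' s l m n ε ≤ tauKP a₁ a₂ a₃ p c c' s l m n := by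
  obtain ⟨e, he⟩ := exists_two_mul_sum_mul_rank_eq (Fintype.card_fin N) (signedSlope p ε)
  have h := sum_rowPhase_add a₁ a₂ a₃ p c c' s l m n ε e
  rw [he, sub_self, zero_div, add_zero] at h
  rw [← h]
  refine le_trans (Finset.sum_le_sum fun i _ => ?_)
    (Finset.le_sup' (fun π : Equiv.Perm (Fin N) => ∑ i, (Matrix.of fun i j : Fin N =>
      phiKP a₁ a₂ a₃ p c c' i l m n (s + (j.1 : ℤ))) i (π i)) (Finset.mem_univ e))
  simp only [Matrix.of_apply, phiKP, rowPhase, signedSlope]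
  cases ε i
  · refine le_trans (le_of_eq ?_) (le_max_right _ _)
    simp only [cond_false]
    push_cast
    ring
  · refine le_trans (le_of_eq ?_) (le_max_left _ _)
    simp only [cond_true]
    push_cast
    ring

lemma exists_tauKP_le_tauTerm {N : ℕ} (a₁ a₂ a₃ : ℝ) (p c c' : Fin N → ℝ) (s l m n : ℤ) :
    ∃ ε : Fin N → Bool,
      tauKP a₁ a₂ a₃ p c c' s l m n ≤ tauTerm a₁ a₂ a₃ p c c' s l m n ε := by
  obtain ⟨π, -, hπ⟩ := Finset.exists_mem_eq_sup' ⟨1, Finset.mem_univ 1⟩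
    (fun π : Equiv.Perm (Fin N) => ∑ i, (Matrix.of fun i j : Fin N =>
      phiKP a₁ a₂ a₃ p c c' i l m n (s + (j.1 : ℤ))) i (π i))
  have hchoice (i : Fin N) : ∃ β : Bool, phiKP a₁ a₂ a₃ p c c' i l m n (s + ((π i).1 : ℤ)) =
      rowPhase a₁ a₂ a₃ p c c' s l m n i β + cond β (p i) (-p i) / 2 +
        cond β (p i) (-p i) * ((π i : ℕ) : ℝ) := by
    unfold phiKP rowPhase
    rcases max_choice
      (p i * ((s + ((π i).1 : ℤ) : ℤ) : ℝ) + max 0 (p i - a₁) * (l : ℝ) +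
        max 0 (p i - a₂) * (m : ℝ) + max 0 (p i - a₃) * (n : ℝ) + c i)
      (-p i * ((s + ((π i).1 : ℤ) : ℤ) : ℝ) + max 0 (-p i - a₁) * (l : ℝ) +
        max 0 (-p i - a₂) * (m : ℝ) + max 0 (-p i - a₃) * (n : ℝ) + c' i) with h | h
    · refine ⟨true, h.trans ?_⟩
      simp only [cond_true]
      push_cast
      ring
    · refine ⟨false, h.trans ?_⟩
      simp only [cond_false]
      push_cast
      ring
  choose ε hε using hchoice
  refine ⟨ε, ?_⟩
  have h := sum_rowPhase_add a₁ a₂ a₃ p c c' s l m n ε π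
  have hle := two_mul_sum_mul_rank_le (signedSlope p ε) π
  have hτ : tauKP a₁ a₂ a₃ p c c' s l m n =
      ∑ i, (rowPhase a₁ a₂ a₃ p c c' s l m n i (ε i) + signedSlope p ε i / 2 +
        signedSlope p ε i * ((π i : ℕ) : ℝ)) :=
    hπ.trans (Finset.sum_congr rfl fun i _ => hε i)
  linarith

lemma tauTerm_shift {N : ℕ} (a₁ a₂ a₃ : ℝ) (p c c' : Fin N → ℝ) (s l m n i j k : ℤ)
    (ε : Fin N → Bool) :
    tauTerm a₁ a₂ a₃ p c c' s (l + i) (m + j) (n + k) ε =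
      tauTerm a₁ a₂ a₃ p c c' s l m n ε + i * ∑ r, max 0 (signedSlope p ε r - a₁) +
        j * ∑ r, max 0 (signedSlope p ε r - a₂) + k * ∑ r, max 0 (signedSlope p ε r - a₃) := by
  have h : ∑ r, rowPhase a₁ a₂ a₃ p c c' s (l + i) (m + j) (n + k) r (ε r) =
      ∑ r, (rowPhase a₁ a₂ a₃ p c c' s l m n r (ε r) + i * max 0 (signedSlope p ε r - a₁) +
        j * max 0 (signedSlope p ε r - a₂) + k * max 0 (signedSlope p ε r - a₃)) := by
    refine Finset.sum_congr rfl fun r _ => ?_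
    simp only [rowPhase, signedSlope]
    push_cast
    ring
  simp only [tauTerm, h, Finset.sum_add_distrib, ← Finset.mul_sum]
  ring

/-- Theorem 3: the tau function solves the ultradiscrete KP equation. -/
theorem tauKP_solves_uKP (N : ℕ) (hN : 1 ≤ N) (a₁ a₂ a₃ : ℝ) (h₁₂ : a₂ < a₁) (h₂₃ : a₃ < a₂)
    (p c c' : Fin N → ℝ) (s l m n : ℤ) :
    tauKP a₁ a₂ a₃ p c c' s l (m + 1) n + tauKP a₁ a₂ a₃ p c c' s (l + 1) m (n + 1) - a₂ =
      max
        (tauKP a₁ a₂ a₃ p c c' s (l + 1) m n + tauKP a₁ a₂ a₃ p c c' s l (m + 1) (n + 1) - a₁)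
        (tauKP a₁ a₂ a₃ p c c' s l m (n + 1) + tauKP a₁ a₂ a₃ p c c' s (l + 1) (m + 1) n - a₂) := by
  have shift₁ := tauTerm_shift a₁ a₂ a₃ p c c' s l m n 1 0 0
  have shift₂ := tauTerm_shift a₁ a₂ a₃ p c c' s l m n 0 1 0
  have shift₃ := tauTerm_shift a₁ a₂ a₃ p c c' s l m n 0 0 1
  have shift₁₂ := tauTerm_shift a₁ a₂ a₃ p c c' s l m n 1 1 0
  have shift₁₃ := tauTerm_shift a₁ a₂ a₃ p c c' s l m n 1 0 1
  have shift₂₃ := tauTerm_shift a₁ a₂ a₃ p c c' s l m n 0 1 1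
  simp only [add_zero, Int.cast_zero, Int.cast_one, zero_mul, one_mul, tauTerm]
    at shift₁ shift₂ shift₃ shift₁₂ shift₁₃ shift₂₃
  have lower := tauTerm_le_tauKP a₁ a₂ a₃ p c c' s
  have upper := exists_tauKP_le_tauTerm a₁ a₂ a₃ p c c' s
  simp only [tauTerm] at lower upper
  have phases (T : Finset (Fin N)) (ε ε' : Fin N → Bool) :=
    sum_piecewise_add_sum_piecewise T ε ε' (rowPhase a₁ a₂ a₃ p c c' s l m n)
  have slopes (ε ε' : Fin N → Bool) (i : Fin N) :
      signedSlope p ε' i = signedSlope p ε i ∨ signedSlope p ε' i = -signedSlope p ε i := by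
    unfold signedSlope
    cases ε i <;> cases ε' i <;> simp
  refine le_antisymm ?_ (max_le ?_ ?_)
  · obtain ⟨ε, hε⟩ := upper l (m + 1) n
    obtain ⟨ε', hε'⟩ := upper (l + 1) m (n + 1)
    rw [shift₂] at hε
    rw [shift₁₃] at hε'
    obtain ⟨T, hT⟩ := exists_exchange_le h₁₂.le h₂₃.le (signedSlope p ε) (signedSlope p ε')
    have hphase := phases T ε ε'
    simp only [← signedSlope_piecewise, pairEnergy, Finset.sum_add_distrib] at hT
    rcases hT with hT | hT
    · have h₁ := lower (l + 1) m n (T.piecewise ε ε')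
      have h₂ := lower l (m + 1) (n + 1) (T.piecewise ε' ε)
      rw [shift₁] at h₁
      rw [shift₂₃] at h₂
      exact le_max_of_le_left (by linarith)
    · have h₁ := lower l m (n + 1) (T.piecewise ε ε')
      have h₂ := lower (l + 1) (m + 1) n (T.piecewise ε' ε)
      rw [shift₃] at h₁
      rw [shift₁₂] at h₂
      exact le_max_of_le_right (by linarith)
  · obtain ⟨ε, hε⟩ := upper (l + 1) m n
    obtain ⟨ε', hε'⟩ := upper l (m + 1) (n + 1)
    rw [shift₁] at hε
    rw [shift₂₃] at hε'
    obtain ⟨T, hT⟩ := exists_pairEnergy_first_le h₁₂.le h₂₃.le (slopes ε ε')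
    have hphase := phases T ε ε'
    have h₁ := lower l (m + 1) n (T.piecewise ε' ε)
    have h₂ := lower (l + 1) m (n + 1) (T.piecewise ε ε')
    rw [shift₂] at h₁
    rw [shift₁₃] at h₂
    simp only [← signedSlope_piecewise, pairEnergy, Finset.sum_add_distrib] at hT
    linarith
  · obtain ⟨ε, hε⟩ := upper l m (n + 1)
    obtain ⟨ε', hε'⟩ := upper (l + 1) (m + 1) n
    rw [shift₃] at hε
    rw [shift₁₂] at hε'
    obtain ⟨T, hT⟩ := exists_pairEnergy_last_le h₁₂.le h₂₃.le (slopes ε ε')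
    have hphase := phases T ε ε'
    have h₁ := lower l (m + 1) n (T.piecewise ε' ε)
    have h₂ := lower (l + 1) m (n + 1) (T.piecewise ε ε')
    rw [shift₂] at h₁
    rw [shift₁₃] at h₂
    simp only [← signedSlope_piecewise, pairEnergy, Finset.sum_add_distrib] at hT
    linarith
end
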